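/- Let c > 60 be a real number and 0 < ε < 1. Let n > 0 and 0 ≤ m < n be integers with n > 2c/π + (10 + (3/2)·log c + (1/2)·log(1/ε))·log(c/2) (natural logarithms). Then the quadrature error satisfies |∫_{-1}^{1} ψ_m(s) ds − Σ_{j=1}^{n} W_j·ψ_m(t_j)| < ε. -/

import Mathlib

open Real MeasureTheory Set

/-- A `k`-th prolate datum for band limit `c`: `ψ` is real-analytic with unit
`L²[-1,1]` norm, has exactly `k` zeros in `(-1,1)`, is an eigenfunction of the
prolate integral operator with nonzero eigenvalue `lam`, and satisfies the
prolate differential equation with eigenvalue `χ`. -/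
structure ProlateDatum (c : ℝ) (k : ℕ) (ψ : ℝ → ℝ) (lam : ℂ) (χ : ℝ) : Prop where
  analytic : ∀ x : ℝ, AnalyticAt ℝ ψ x
  normalized : ∫ t in (-1:ℝ)..1, (ψ t)^2 = 1
  zeros_card : {x : ℝ | x ∈ Set.Ioo (-1:ℝ) 1 ∧ ψ x = 0}.encard = k
  lam_ne_zero : lam ≠ 0
  integral_eig : ∀ x : ℝ,
    lam * (ψ x : ℂ) =
      ∫ t in (-1:ℝ)..1, (ψ t : ℂ) * Complex.exp (Complex.I * (c:ℂ) * (x:ℂ) * (t:ℂ))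
  diff_eq : ∀ x : ℝ,
    (1 - x^2) * deriv (deriv ψ) x - 2*x * deriv ψ x + (χ - c^2 * x^2) * ψ x = 0

/-- The `j`-th weight of the PSWF-based quadrature rule:
`W_j = (1/ψₙ'(t_j)) ∫_{-1}^1 ψₙ(s)/(s - t_j) ds`. -/
noncomputable def quadWeight (ψn : ℝ → ℝ) (tj : ℝ) : ℝ :=
  (1 / deriv ψn tj) * ∫ s in (-1:ℝ)..1, ψn s / (s - tj)

section
theorem mono_help {f f' : ℝ → ℝ} {a b : ℝ} (hab : a ≤ b) (hc : ContinuousOn f (Icc a b))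
    (hd : ∀ x ∈ Ioo a b, HasDerivAt f (f' x) x) (hp : ∀ x ∈ Ioo a b, 0 ≤ f' x) : f a ≤ f b := by
  have : MonotoneOn f (Icc a b) := by
    apply monotoneOn_of_deriv_nonneg (convex_Icc a b) hc
    · intro x hx
      rw [interior_Icc] at hx
      exact (hd x hx).differentiableAt.differentiableWithinAt
    · intro x hx
      rw [interior_Icc] at hx
      rw [(hd x hx).deriv]; exact hp x hx
  exact this (left_mem_Icc.2 hab) (right_mem_Icc.2 hab) hab

theorem anti_help {f f' : ℝ → ℝ} {a b : ℝ} (hab : a ≤ b) (hc : ContinuousOn f (Icc a b))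
    (hd : ∀ x ∈ Ioo a b, HasDerivAt f (f' x) x) (hp : ∀ x ∈ Ioo a b, f' x ≤ 0) : f b ≤ f a := by
  have := mono_help (f := fun x => - f x) (f' := fun x => - f' x) hab hc.neg
    (fun x hx => (hd x hx).neg) (fun x hx => by have := hp x hx; linarith)
  simpa using this

/-- analytic solutions of the prolate equation -/
structure ProlSol (c χ : ℝ) (ψ : ℝ → ℝ) : Prop where
  an : ∀ x, AnalyticAt ℝ ψ x
  ode : ∀ x, (1 - x^2) * deriv (deriv ψ) x - 2*x*deriv ψ x + (χ - c^2*x^2) * ψ x = 0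

namespace ProlSol
variable {c χ : ℝ} {ψ φ : ℝ → ℝ}

theorem hd (h : ProlSol c χ ψ) (x : ℝ) : HasDerivAt ψ (deriv ψ x) x :=
  (h.an x).differentiableAt.hasDerivAt

theorem hd2 (h : ProlSol c χ ψ) (x : ℝ) : HasDerivAt (deriv ψ) (deriv (deriv ψ) x) x :=
  (h.an x).deriv.differentiableAt.hasDerivAt

theorem cont (h : ProlSol c χ ψ) : Continuous ψ :=
  continuous_iff_continuousAt.2 fun x => (h.hd x).continuousAt

theorem cont' (h : ProlSol c χ ψ) : Continuous (deriv ψ) :=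
  continuous_iff_continuousAt.2 fun x => (h.hd2 x).continuousAt

theorem cont'' (h : ProlSol c χ ψ) : Continuous (deriv (deriv ψ)) :=
  continuous_iff_continuousAt.2 fun x => (h.an x).deriv.deriv.continuousAt

theorem hp (h : ProlSol c χ ψ) (x : ℝ) :
    HasDerivAt (fun x => (1 - x^2) * deriv ψ x) (-((χ - c^2*x^2) * ψ x)) x := by
  have h1 : HasDerivAt (fun x : ℝ => 1 - x^2) (-(2*x)) x := by
    simpa using ((hasDerivAt_id x).pow 2).const_sub 1
  have := h1.mul (h.hd2 x)
  refine this.congr_deriv ?_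
  have := h.ode x
  linarith

theorem neg (h : ProlSol c χ ψ) : ProlSol c χ (fun x => - ψ x) where
  an x := (h.an x).neg
  ode x := by
    have e1 : deriv (fun x => - ψ x) = fun x => - deriv ψ x := by
      funext y; exact (h.hd y).neg.deriv
    have e2 : deriv (fun x => - deriv ψ x) = fun x => - deriv (deriv ψ) x := by
      funext y; exact (h.hd2 y).neg.deriv
    rw [e1, e2]
    have := h.ode x
    linarith

theorem add (h : ProlSol c χ ψ) (k : ProlSol c χ φ) : ProlSol c χ (fun x => ψ x + φ x) where
  an x := (h.an x).add (k.an x)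
  ode x := by
    have e1 : deriv (fun x => ψ x + φ x) = fun x => deriv ψ x + deriv φ x := by
      funext y; exact ((h.hd y).add (k.hd y)).deriv
    have e2 : deriv (fun x => deriv ψ x + deriv φ x)
        = fun x => deriv (deriv ψ) x + deriv (deriv φ) x := by
      funext y; exact ((h.hd2 y).add (k.hd2 y)).deriv
    rw [e1, e2]
    have := h.ode x
    have := k.ode x
    linarith

theorem refl_deriv (h : ProlSol c χ ψ) (x : ℝ) :
    HasDerivAt (fun x => ψ (-x)) (- deriv ψ (-x)) x := by
  have := (h.hd (-x)).comp x (hasDerivAt_neg x)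
  simpa [Function.comp_def] using this

theorem reflect (h : ProlSol c χ ψ) : ProlSol c χ (fun x => ψ (-x)) where
  an x := by
    have : AnalyticAt ℝ (fun x : ℝ => -x) x := analyticAt_id.neg
    exact AnalyticAt.fun_comp (h.an (-x)) this
  ode x := by
    have e1 : deriv (fun x => ψ (-x)) = fun x => - deriv ψ (-x) := by
      funext y; exact (h.refl_deriv y).deriv
    have e2 : deriv (fun x => - deriv ψ (-x)) = fun x => deriv (deriv ψ) (-x) := by
      funext y
      have := ((h.hd2 (-y)).comp y (hasDerivAt_neg y)).fun_neg
      have h2 : HasDerivAt (fun x => - deriv ψ (-x)) (deriv (deriv ψ) (-y)) y := by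
        simpa [Function.comp_def] using this
      exact h2.deriv
    rw [e1, e2]
    have := h.ode (-x)
    simp only [neg_sq] at this
    linarith

theorem eq_zero_of_Icc (h : ProlSol c χ ψ) {a b : ℝ} (hab : a < b)
    (h0 : ∀ x ∈ Icc a b, ψ x = 0) : ∀ x, ψ x = 0 := by
  have hU : AnalyticOnNhd ℝ ψ univ := fun x _ => h.an x
  have hev : ψ =ᶠ[nhds ((a+b)/2)] 0 := by
    filter_upwards [Icc_mem_nhds (show a < (a+b)/2 by linarith) (show (a+b)/2 < b by linarith)] with x hx
    exact h0 x hx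
  have := hU.eqOn_zero_of_preconnected_of_eventuallyEq_zero isPreconnected_univ (mem_univ _) hev
  exact fun x => this (mem_univ x)

/-- uniqueness at a regular point -/
theorem unique_reg (h : ProlSol c χ ψ) {x0 : ℝ} (hx0 : 1 - x0^2 ≠ 0) (h0 : ψ x0 = 0)
    (h1 : deriv ψ x0 = 0) : ∀ x, ψ x = 0 := by
  obtain ⟨b, hb, hp⟩ : ∃ b, x0 < b ∧ ∀ x ∈ Icc x0 b, 1 - x^2 ≠ 0 := by
    have : ∀ᶠ x in nhds x0, 1 - x^2 ≠ 0 :=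
      (by fun_prop : Continuous fun x : ℝ => 1 - x^2).continuousAt.eventually_ne hx0
    obtain ⟨e, he, hs⟩ := Metric.eventually_nhds_iff.1 this
    refine ⟨x0 + e/2, by linarith, fun x hx => hs ?_⟩
    rw [Real.dist_eq, abs_lt]; constructor <;> linarith [hx.1, hx.2]
  have hc1 : ContinuousOn (fun x => |2*x/(1-x^2)| + |(χ - c^2*x^2)/(1-x^2)|) (Icc x0 b) := by
    apply ContinuousOn.add
    · apply ContinuousOn.abs
      apply ContinuousOn.div (by fun_prop) (by fun_prop) hp
    · apply ContinuousOn.abs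
      apply ContinuousOn.div (by fun_prop) (by fun_prop) hp
  obtain ⟨C, hC⟩ := isCompact_Icc.bddAbove_image hc1
  have hC' : ∀ x ∈ Icc x0 b, |2*x/(1-x^2)| + |(χ - c^2*x^2)/(1-x^2)| ≤ C :=
    fun x hx => hC (mem_image_of_mem _ hx)
  set K := 2*C + 1 with hK
  have key : ∀ y ∈ Icc x0 b, (ψ y)^2 + (deriv ψ y)^2 ≤ 0 := by
    intro y hy
    have := anti_help (f := fun x => ((ψ x)^2 + (deriv ψ x)^2) * exp (-K * x))
      (f' := fun x => (2 * ψ x * deriv ψ x + 2 * deriv ψ x * deriv (deriv ψ) x) * exp (-K * x)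
        + ((ψ x)^2 + (deriv ψ x)^2) * (exp (-K*x) * (-K))) hy.1
      (by have := h.cont; have := h.cont'; fun_prop) ?_ ?_
    · simp only [h0, h1] at this
      have hpos := exp_pos (-K*y)
      by_contra hcon
      push Not at hcon
      have := mul_pos hcon hpos
      linarith
    · intro x hx
      have e1 := ((h.hd x).pow 2).add ((h.hd2 x).pow 2)
      have e2 : HasDerivAt (fun x => exp (-K * x)) (exp (-K*x) * (-K)) x := by
        have := ((hasDerivAt_id x).const_mul (-K)).exp
        simpa using this
      refine (e1.mul e2).congr_deriv ?_
      simp only [Pi.add_apply, Pi.pow_apply]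
      norm_num
    · intro x hx
      have hxm : x ∈ Icc x0 b := ⟨hx.1.le, hx.2.le.trans hy.2⟩
      have hb1 := hC' x hxm
      have hpx := hp x hxm
      have ho : deriv (deriv ψ) x = (2*x/(1-x^2)) * deriv ψ x - ((χ - c^2*x^2)/(1-x^2)) * ψ x := by
        field_simp
        have := h.ode x
        linarith
      set A := 2*x/(1-x^2)
      set B := (χ - c^2*x^2)/(1-x^2)
      set u := ψ x
      set v := deriv ψ x
      have hpos := exp_pos (-K*x)
      have : 2*u*v + 2*v*(A*v - B*u) - K*(u^2+v^2) ≤ 0 := by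
        have hA := le_abs_self A
        have hA0 := abs_nonneg A
        have hB0 := abs_nonneg B
        have hB := neg_abs_le B
        have hB' := le_abs_self B
        have t1 : 2*v*A*v ≤ 2*|A| * (u^2+v^2) := by nlinarith [sq_nonneg u, sq_nonneg v]
        have t2 : -(2*v*B*u) ≤ |B| * (u^2+v^2) := by
          nlinarith [sq_nonneg (u+v), sq_nonneg (u-v), mul_nonneg hB0 (sq_nonneg (u-v)), mul_nonneg hB0 (sq_nonneg (u+v))]
        have t3 : 2*u*v ≤ u^2+v^2 := by nlinarith [sq_nonneg (u-v)]
        have t4 : (2*|A| + |B|) * (u^2+v^2) ≤ 2*C*(u^2+v^2) := by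
          apply mul_le_mul_of_nonneg_right _ (by positivity)
          linarith
        rw [hK]
        nlinarith
      rw [ho]
      nlinarith
  apply h.eq_zero_of_Icc hb
  intro x hx
  have := key x hx
  nlinarith [sq_nonneg (ψ x), sq_nonneg (deriv ψ x)]

theorem unique_one (h : ProlSol c χ ψ) (h0 : ψ 1 = 0) : ∀ x, ψ x = 0 := by
  have hc1 : ContinuousOn (fun x : ℝ => |1 - (χ - c^2*x^2)|) (Icc (1/2) 1) := by fun_prop
  obtain ⟨C, hC⟩ := isCompact_Icc.bddAbove_image hc1
  have hC' : ∀ x ∈ Icc (1/2:ℝ) 1, |1 - (χ - c^2*x^2)| ≤ C :=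
    fun x hx => hC (mem_image_of_mem _ hx)
  set K := C^2 with hK
  have key : ∀ y ∈ Icc (1/2:ℝ) 1, (ψ y)^2 + (1-y^2)*(deriv ψ y)^2 ≤ 0 := by
    intro y hy
    have := mono_help (f := fun x => ((ψ x)^2 + (1-x^2)*(deriv ψ x)^2) * exp (K * x))
      (f' := fun x => (2 * ψ x * deriv ψ x + (2 * x * (deriv ψ x)^2 - 2 * (χ - c^2*x^2) * ψ x * deriv ψ x)) * exp (K * x)
        + ((ψ x)^2 + (1-x^2)*(deriv ψ x)^2) * (exp (K*x) * K)) hy.2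
      (by have := h.cont; have := h.cont'; fun_prop) ?_ ?_
    · simp only [h0] at this
      have hpos := exp_pos (K*y)
      by_contra hcon
      push Not at hcon
      have := mul_pos hcon hpos
      linarith
    · intro x hx
      have e1 := ((h.hd x).pow 2).add ((h.hp x).mul (h.hd2 x))
      have e3 := ((h.hd x).pow 2).add ((h.hp x).mul (h.hd x))
      have e2 : HasDerivAt (fun x => exp (K * x)) (exp (K*x) * K) x := by
        have := ((hasDerivAt_id x).const_mul K).exp
        simpa using this
      have e4 : HasDerivAt (fun x => (ψ x)^2 + (1-x^2)*(deriv ψ x)^2)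
          (2 * ψ x * deriv ψ x + (2 * x * (deriv ψ x)^2 - 2 * (χ - c^2*x^2) * ψ x * deriv ψ x)) x := by
        have h5 := ((h.hd x).pow 2).add ((h.hp x).mul (h.hd2 x))
        have h6 : (fun x => (ψ x)^2 + (1-x^2)*(deriv ψ x)^2)
          = (fun x => (ψ x)^2 + ((1-x^2)*(deriv ψ x))*(deriv ψ x)) := by funext; ring
        rw [h6]
        refine h5.congr_deriv ?_
        have := h.ode x
        have e : (1 - x^2) * deriv (deriv ψ) x = 2*x*deriv ψ x - (χ - c^2*x^2) * ψ x := by linarith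
        norm_num
        linear_combination (deriv ψ x) * e
      exact e4.mul e2
    · intro x hx
      have hxm : x ∈ Icc (1/2:ℝ) 1 := ⟨hy.1.trans hx.1.le, hx.2.le⟩
      have hb1 := hC' x hxm
      have hpos := exp_pos (K*x)
      set u := ψ x
      set v := deriv ψ x
      set B := 1 - (χ - c^2*x^2) with hB
      have hKB : B^2 ≤ K := by
        rw [hK, ← sq_abs B]
        exact pow_le_pow_left₀ (abs_nonneg _) hb1 2
      have hx2 := hxm.1
      have hx1 := hxm.2
      have hq : χ - c^2*x^2 = 1 - B := by rw [hB]; ring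
      have : 0 ≤ 2*u*v + (2*x*v^2 - 2*(χ - c^2*x^2)*u*v) + K * (u^2 + (1-x^2)*v^2) := by
        rw [hq]
        have t0 : 0 ≤ K := by positivity
        have t1 : 0 ≤ K*((1-x^2)*v^2) := by
          apply mul_nonneg t0; apply mul_nonneg _ (sq_nonneg _); nlinarith
        nlinarith [sq_nonneg (v + B*u), mul_le_mul_of_nonneg_right hKB (sq_nonneg u), sq_nonneg v]
      nlinarith
  apply h.eq_zero_of_Icc (show (1/2:ℝ) < 1 by norm_num)
  intro x hx
  have := key x hx
  have h2 : 0 ≤ (1-x^2)*(deriv ψ x)^2 := mul_nonneg (by nlinarith [hx.1, hx.2]) (sq_nonneg _)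
  nlinarith [sq_nonneg (ψ x)]

/-- general uniqueness, contrapositive form -/
theorem ne_one (h : ProlSol c χ ψ) {z : ℝ} (hz : ψ z ≠ 0) : ψ 1 ≠ 0 := fun h0 => hz (h.unique_one h0 z)

theorem ne_neg_one (h : ProlSol c χ ψ) {z : ℝ} (hz : ψ z ≠ 0) : ψ (-1) ≠ 0 := by
  intro h0
  exact hz (by simpa using h.reflect.unique_one (by simpa using h0) (-z))

theorem deriv_ne (h : ProlSol c χ ψ) {z : ℝ} (hz : ψ z ≠ 0) {x : ℝ} (hx : ψ x = 0) : deriv ψ x ≠ 0 := by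
  intro h1
  by_cases hp : 1 - x^2 = 0
  · have : (x - 1) * (x + 1) = 0 := by linarith
    rcases mul_eq_zero.1 this with h2 | h2
    · have : x = 1 := by linarith
      subst this; exact h.ne_one hz hx
    · have : x = -1 := by linarith
      subst this; exact h.ne_neg_one hz hx
  · exact hz (h.unique_reg hp hx h1 z)

theorem parity (h : ProlSol c χ ψ) : (∀ x, ψ (-x) = ψ x) ∨ (∀ x, ψ (-x) = - ψ x) := by
  have hr := h.reflect
  -- Wronskian
  have hW : ψ 0 * deriv ψ 0 = 0 := by
    have e : ∀ x, HasDerivAt (fun x => ψ x * ((1-x^2) * deriv (fun y => ψ (-y)) x)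
        - ψ (-x) * ((1-x^2) * deriv ψ x)) 0 x := by
      intro x
      refine (((h.hd x).mul (hr.hp x)).sub ((hr.hd x).mul (h.hp x))).congr_deriv ?_
      ring
    have hc := is_const_of_deriv_eq_zero (fun x => (e x).differentiableAt) (fun x => (e x).deriv) 0 1
    simp only [(h.refl_deriv _).deriv] at hc
    norm_num at hc
    rw [mul_eq_zero]
    by_contra hcon
    push Not at hcon
    have := mul_ne_zero hcon.1 hcon.2
    apply this; linarith
  rcases mul_eq_zero.1 hW with h0 | h0
  · right
    have := (hr.add h).unique_reg (x0 := 0) (by norm_num) (by simp [h0]) (by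
      rw [((h.refl_deriv 0).fun_add (h.hd 0)).deriv]; simp)
    intro x; have := this x; linarith
  · left
    have := (hr.add h.neg).unique_reg (x0 := 0) (by norm_num) (by simp) (by
      rw [((h.refl_deriv 0).fun_add (h.hd 0).fun_neg).deriv]; simp [h0])
    intro x; have := this x; linarith

/-- Lagrange identity against a test function. -/
theorem lagrange (h : ProlSol c χ ψ) {k k1 k2 : ℝ → ℝ}
    (hk : ∀ x ∈ Icc (-1:ℝ) 1, HasDerivAt k (k1 x) x)
    (hk1 : ∀ x ∈ Icc (-1:ℝ) 1, HasDerivAt (fun x => (1-x^2) * k1 x) (k2 x) x)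
    (hk2 : ContinuousOn k2 (Icc (-1) 1)) :
    ∫ x in (-1:ℝ)..1, ψ x * (k2 x + (χ - c^2*x^2) * k x) = 0 := by
  have e : ∀ x ∈ uIcc (-1:ℝ) 1, HasDerivAt (fun x => ψ x * ((1-x^2) * k1 x) - k x * ((1-x^2) * deriv ψ x))
      (ψ x * (k2 x + (χ - c^2*x^2) * k x)) x := by
    intro x hx
    rw [uIcc_of_le (by norm_num)] at hx
    refine (((h.hd x).mul (hk1 x hx)).sub ((hk x hx).mul (h.hp x))).congr_deriv ?_
    ring
  have hkc : ContinuousOn k (Icc (-1) 1) := fun x hx => (hk x hx).continuousAt.continuousWithinAt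
  rw [intervalIntegral.integral_eq_sub_of_hasDerivAt e]
  · norm_num
  · apply ContinuousOn.intervalIntegrable
    rw [uIcc_of_le (by norm_num)]
    have := h.cont
    fun_prop

end ProlSol
end

section
theorem finset_gap (B : ℝ → ℝ) (P : ℝ) (F : Finset ℝ) :
    (∀ a ∈ F, ∀ b ∈ F, a < b → B a + P ≤ B b) → ∀ (hF : F.Nonempty),
    B (F.min' hF) + (F.card - 1 : ℝ) * P ≤ B (F.max' hF) := by
  induction F using Finset.induction_on_max with
  | empty => intro _ hF; exact absurd hF (by simp)
  | insert a s ha ih =>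
    intro h hF
    by_cases hs : s.Nonempty
    · have h1 := ih (fun x hx y hy hxy => h x (Finset.mem_insert_of_mem hx) y (Finset.mem_insert_of_mem hy) hxy) hs
      have hna : a ∉ s := fun hmem => lt_irrefl _ (ha a hmem)
      have hmax : (insert a s).max' hF = a := by
        apply le_antisymm
        · apply Finset.max'_le
          intro y hy
          rcases Finset.mem_insert.1 hy with rfl | hy
          · exact le_rfl
          · exact (ha y hy).le
        · exact Finset.le_max' _ _ (Finset.mem_insert_self a s)
      have hmin : (insert a s).min' hF = s.min' hs := by
        apply le_antisymm
        · exact Finset.min'_le _ _ (Finset.mem_insert_of_mem (s.min'_mem hs))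
        · apply Finset.le_min'
          intro y hy
          rcases Finset.mem_insert.1 hy with rfl | hy
          · exact (ha _ (s.min'_mem hs)).le
          · exact Finset.min'_le _ _ hy
      rw [hmax, hmin, Finset.card_insert_of_notMem hna]
      have h2 := h _ (Finset.mem_insert_of_mem (s.max'_mem hs)) a (Finset.mem_insert_self a s) (ha _ (s.max'_mem hs))
      push_cast
      linarith
    · rw [Finset.not_nonempty_iff_eq_empty] at hs
      subst hs
      simp

namespace ProlSol
variable {c χ : ℝ} {ψ φ : ℝ → ℝ}

/-- Prüfer-type estimate, positive solution between two zeros -/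
theorem phase_pos (h : ProlSol c χ ψ) {d : ℝ} (hc : 0 < c) (hd : 0 < d) (hχ : χ ≤ c^2*(1+d))
    {a b : ℝ} (ha : 0 ≤ a) (hab : a < b) (hb : b < 1) (h0a : ψ a = 0) (h0b : ψ b = 0)
    (hpos : ∀ x ∈ Ioo a b, 0 < ψ x) {B B' : ℝ → ℝ} (hBc : ContinuousOn B (Icc a b))
    (hB : ∀ x ∈ Ioo a b, HasDerivAt B (B' x) x)
    (hB' : ∀ x ∈ Ioo a b, √((1-x^2)*(c^2*(1+d)-c^2*x^2)) / (1-x^2)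
      + (2*x*(c^2*(1+d)-c^2*x^2) + 2*x*c^2*(1-x^2))/(4*((1-x^2)*(c^2*(1+d)-c^2*x^2))) ≤ B' x) :
    B a + π ≤ B b := by
  have hz : ψ ((a+b)/2) ≠ 0 := (hpos _ ⟨by linarith, by linarith⟩).ne'
  set Q : ℝ → ℝ := fun x => (1-x^2)*(c^2*(1+d)-c^2*x^2) with hQdef
  have hpp : ∀ x ∈ Icc a b, 0 < 1 - x^2 := fun x hx => by nlinarith [hx.1, hx.2]
  have hqp : ∀ x ∈ Icc a b, 0 < c^2*(1+d) - c^2*x^2 := fun x hx => by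
    have := hpp x hx
    have : 0 < c^2 * (d + (1-x^2)) := by positivity
    nlinarith
  have hQp : ∀ x ∈ Icc a b, 0 < Q x := fun x hx => mul_pos (hpp x hx) (hqp x hx)
  have hQc : Continuous Q := by rw [hQdef]; fun_prop
  set w : ℝ → ℝ := fun x => -((1-x^2)*deriv ψ x) / (√(Q x) * ψ x) with hw
  -- derivative positivity at ends
  have hda : 0 < deriv ψ a := by
    have h1 : 0 ≤ deriv ψ a := by
      have := (h.hd a).hasDerivWithinAt (s := Ioi a)
      rw [hasDerivWithinAt_iff_tendsto_slope' (by simp)] at this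
      refine ge_of_tendsto this ?_
      filter_upwards [Ioo_mem_nhdsGT hab] with x hx
      rw [slope_def_field, h0a, sub_zero]
      exact div_nonneg (hpos x hx).le (by linarith [hx.1])
    exact lt_of_le_of_ne h1 (h.deriv_ne hz h0a).symm
  have hdb : deriv ψ b < 0 := by
    have h1 : deriv ψ b ≤ 0 := by
      have := (h.hd b).hasDerivWithinAt (s := Iio b)
      rw [hasDerivWithinAt_iff_tendsto_slope' (by simp)] at this
      refine le_of_tendsto this ?_
      filter_upwards [Ioo_mem_nhdsLT hab] with x hx
      rw [slope_def_field, h0b, sub_zero]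
      exact div_nonpos_of_nonneg_of_nonpos (hpos x hx).le (by linarith [hx.2])
    exact lt_of_le_of_ne h1 (h.deriv_ne hz h0b)
  have hcont : Continuous (fun x => √(Q x) * ψ x) := by have := h.cont; fun_prop
  have hcont2 : Continuous (fun x => -((1-x^2)*deriv ψ x)) := by have := h.cont'; fun_prop
  have hlima : Filter.Tendsto w (nhdsWithin a (Ioi a)) Filter.atBot := by
    have t1 : Filter.Tendsto (fun x => √(Q x) * ψ x) (nhdsWithin a (Ioi a)) (nhdsWithin 0 (Ioi 0)) := by
      apply tendsto_nhdsWithin_of_tendsto_nhds_of_eventually_within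
      · have := hcont.tendsto a
        simp only [h0a, mul_zero] at this
        exact this.mono_left nhdsWithin_le_nhds
      · filter_upwards [Ioo_mem_nhdsGT hab] with x hx
        exact mul_pos (sqrt_pos.2 (hQp x (Ioo_subset_Icc_self hx))) (hpos x hx)
    have t2 := (tendsto_inv_nhdsGT_zero).comp t1
    have t3 := (hcont2.tendsto a).mono_left (nhdsWithin_le_nhds (s := Ioi a))
    have := Filter.Tendsto.neg_mul_atTop (C := -((1-a^2)*deriv ψ a)) (by
      have := mul_pos (hpp a ⟨le_rfl, hab.le⟩) hda
      linarith) t3 t2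
    refine this.congr fun x => ?_
    simp [hw, div_eq_mul_inv]
  have hlimb : Filter.Tendsto w (nhdsWithin b (Iio b)) Filter.atTop := by
    have t1 : Filter.Tendsto (fun x => √(Q x) * ψ x) (nhdsWithin b (Iio b)) (nhdsWithin 0 (Ioi 0)) := by
      apply tendsto_nhdsWithin_of_tendsto_nhds_of_eventually_within
      · have := hcont.tendsto b
        simp only [h0b, mul_zero] at this
        exact this.mono_left nhdsWithin_le_nhds
      · filter_upwards [Ioo_mem_nhdsLT hab] with x hx
        exact mul_pos (sqrt_pos.2 (hQp x (Ioo_subset_Icc_self hx))) (hpos x hx)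
    have t2 := (tendsto_inv_nhdsGT_zero).comp t1
    have t3 := (hcont2.tendsto b).mono_left (nhdsWithin_le_nhds (s := Iio b))
    have := Filter.Tendsto.pos_mul_atTop (C := -((1-b^2)*deriv ψ b)) (by
      have := mul_pos (hpp b ⟨hab.le, le_rfl⟩) (neg_pos.2 hdb)
      linarith) t3 t2
    refine this.congr fun x => ?_
    simp [hw, div_eq_mul_inv]
  have hwd : ∀ x ∈ Ioo a b, HasDerivAt w ((χ - c^2*x^2)/√(Q x) + w x ^2 * (√(Q x)/(1-x^2))
      + w x * ((2*x*(c^2*(1+d)-c^2*x^2) + 2*x*c^2*(1-x^2))/(2*Q x))) x := by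
    intro x hx
    have hxI := Ioo_subset_Icc_self hx
    have hQd : HasDerivAt Q (-(2*x*(c^2*(1+d)-c^2*x^2) + 2*x*c^2*(1-x^2))) x := by
      have h1 : HasDerivAt (fun x : ℝ => 1 - x^2) (-(2*x)) x := by
        simpa using ((hasDerivAt_id x).pow 2).const_sub 1
      have h2 : HasDerivAt (fun x : ℝ => c^2*(1+d) - c^2*x^2) (-(c^2*(2*x))) x := by
        simpa using (((hasDerivAt_id x).pow 2).const_mul (c^2)).const_sub (c^2*(1+d))
      refine (h1.mul h2).congr_deriv ?_
      ring
    have hS := hQd.sqrt (hQp x hxI).ne'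
    have hsp := sqrt_pos.2 (hQp x hxI)
    have hψ := hpos x hx
    have := ((h.hp x).fun_neg).fun_div (hS.fun_mul (h.hd x)) (mul_pos hsp hψ).ne'
    refine this.congr_deriv ?_
    simp only [hw]
    have hp0 := (hpp x hxI).ne'
    have hs2 : Q x = √(Q x)^2 := (sq_sqrt (hQp x hxI).le).symm
    generalize (c^2*(1+d)-c^2*x^2) = qh at *
    generalize deriv ψ x = ψ' at *
    generalize ψ x = u at *
    set s := √(Q x)
    rw [hs2]
    field_simp
    ring
  have hmono : ∀ x ∈ Ioo a b, ∀ y ∈ Ioo a b, x ≤ y → B x - arctan (w x) ≤ B y - arctan (w y) := by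
    intro x hx y hy hxy
    have hsub : Icc x y ⊆ Ioo a b := fun z hz => ⟨lt_of_lt_of_le hx.1 hz.1, lt_of_le_of_lt hz.2 hy.2⟩
    refine mono_help (f := fun x => B x - arctan (w x)) hxy ?_ (fun z hz =>
      (hB z (hsub (Ioo_subset_Icc_self hz))).sub (hwd z (hsub (Ioo_subset_Icc_self hz))).arctan) ?_
    · intro z hz
      exact ((hB z (hsub hz)).sub (hwd z (hsub hz)).arctan).continuousAt.continuousWithinAt
    · intro z hz
      have hz' := hsub (Ioo_subset_Icc_self hz)
      have hzI := Ioo_subset_Icc_self hz'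
      have hb := hB' z hz'
      have hp0 := hpp z hzI
      have hQ0 := hQp z hzI
      have hq0 := hqp z hzI
      have hsp := sqrt_pos.2 hQ0
      have hz0 : 0 ≤ z := ha.trans hz'.1.le
      have e1 : (χ - c^2*z^2)/√(Q z) ≤ √(Q z)/(1-z^2) := by
        rw [div_le_div_iff₀ hsp hp0, mul_self_sqrt hQ0.le]
        simp only [hQdef]
        nlinarith
      set W := w z
      set K := (2*z*(c^2*(1+d)-c^2*z^2) + 2*z*c^2*(1-z^2)) with hK
      have hK0 : 0 ≤ K := by rw [hK]; positivity
      set S := √(Q z)/(1-z^2)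
      have hW : 0 < 1 + W^2 := by positivity
      have hb2 : S + K/(4*Q z) ≤ B' z := hb
      have e2 : K/(2*Q z) = 2 * (K/(4*Q z)) := by field_simp; norm_num
      have e3 : 0 ≤ K/(4*Q z) := by positivity
      have : 1/(1+W^2) * ((χ - c^2*z^2)/√(Q z) + W^2*S + W*(K/(2*Q z))) ≤ S + K/(4*Q z) := by
        rw [one_div, inv_mul_le_iff₀ hW, e2]
        nlinarith [mul_nonneg e3 (sq_nonneg (W-1))]
      linarith
  have hmid : (a+b)/2 ∈ Ioo a b := ⟨by linarith, by linarith⟩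
  have L1 : B a + π/2 ≤ B ((a+b)/2) - arctan (w ((a+b)/2)) := by
    have t1 : Filter.Tendsto (fun x => B x - arctan (w x)) (nhdsWithin a (Ioi a)) (nhds (B a - (-(π/2)))) := by
      apply Filter.Tendsto.sub
      · have := hBc a ⟨le_rfl, hab.le⟩
        exact (this.mono_of_mem_nhdsWithin (Icc_mem_nhdsGT hab) : ContinuousWithinAt B (Ioi a) a)
      · exact (tendsto_nhds_of_tendsto_nhdsWithin tendsto_arctan_atBot).comp hlima
    have := le_of_tendsto t1 (b := B ((a+b)/2) - arctan (w ((a+b)/2))) (by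
      filter_upwards [Ioo_mem_nhdsGT hmid.1] with x hx
      exact hmono x ⟨hx.1, hx.2.trans hmid.2⟩ _ hmid hx.2.le)
    linarith
  have L2 : B ((a+b)/2) - arctan (w ((a+b)/2)) ≤ B b - π/2 := by
    have t1 : Filter.Tendsto (fun x => B x - arctan (w x)) (nhdsWithin b (Iio b)) (nhds (B b - π/2)) := by
      apply Filter.Tendsto.sub
      · have := hBc b ⟨hab.le, le_rfl⟩
        exact (this.mono_of_mem_nhdsWithin (Icc_mem_nhdsLT hab) : ContinuousWithinAt B (Iio b) b)
      · exact (tendsto_nhds_of_tendsto_nhdsWithin tendsto_arctan_atTop).comp hlimb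
    exact ge_of_tendsto t1 (by
      filter_upwards [Ioo_mem_nhdsLT hmid.2] with x hx
      exact hmono _ hmid x ⟨hmid.1.trans hx.1, hx.2⟩ hx.1.le)
  linarith

/-- sign is constant where there are no zeros -/
theorem sign_const (h : ProlSol c χ ψ) {s : Set ℝ} (hs : IsPreconnected s)
    (hne : ∀ x ∈ s, ψ x ≠ 0) : (∀ x ∈ s, 0 < ψ x) ∨ (∀ x ∈ s, ψ x < 0) := by
  by_contra hcon
  push Not at hcon
  obtain ⟨⟨x, hx, hx0⟩, y, hy, hy0⟩ := hcon
  obtain ⟨z, hz, hz0⟩ := hs.intermediate_value hx hy h.cont.continuousOn ⟨hx0, hy0⟩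
  exact hne z hz hz0

theorem last_zero (h : ProlSol c χ ψ) {d : ℝ} (hd : 0 < d) (hχ : χ ≤ c^2*(1+d))
    {b : ℝ} (hb0 : 0 ≤ b) (hb : b < 1) (h0 : ψ b = 0) (hpos : ∀ x ∈ Ioc b 1, 0 < ψ x) :
    1 ≤ (1-b^2)*(c^2*(1+d)-c^2*b^2) := by
  obtain ⟨xs, hxs, hmax⟩ := isCompact_Icc.exists_isMaxOn (nonempty_Icc.2 hb.le) (h.cont.continuousOn (s := Icc b 1))
  have hM : ∀ x ∈ Icc b 1, ψ x ≤ ψ xs := fun x hx => hmax hx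
  have hMp : 0 < ψ xs := lt_of_lt_of_le (hpos 1 ⟨hb, le_rfl⟩) (hM 1 ⟨hb.le, le_rfl⟩)
  set q := c^2*(1+d)-c^2*b^2 with hq
  have hq0 : 0 ≤ q := by rw [hq]; nlinarith [sq_nonneg c, mul_nonneg (sq_nonneg c) (show 0 ≤ 1 + d - b^2 by nlinarith)]
  have hnn : ∀ x ∈ Icc b 1, 0 ≤ ψ x := by
    intro x hx
    rcases hx.1.eq_or_lt with h1 | h1
    · rw [← h1, h0]
    · exact (hpos x ⟨h1, hx.2⟩).le
  have key : ∀ x ∈ Icc b 1, (1-x^2)*deriv ψ x ≤ q * ψ xs * (1-x) := by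
    intro x hx
    have := mono_help (f := fun y => (1-y^2)*deriv ψ y + q * ψ xs * y)
      (f' := fun y => -((χ - c^2*y^2) * ψ y) + q * ψ xs) hx.2
      (by have := h.cont'; fun_prop) (fun y _ => by
        have := (h.hp y).fun_add ((hasDerivAt_id y).const_mul (q * ψ xs))
        simpa using this) (fun y hy => by
        have hyI : y ∈ Icc b 1 := ⟨hx.1.trans hy.1.le, hy.2.le⟩
        have h1 : (χ - c^2*y^2) ≤ q := by
          rw [hq]
          have : b^2 ≤ y^2 := by nlinarith [hyI.1]
          nlinarith [mul_le_mul_of_nonneg_left this (sq_nonneg c)]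
        have h2 : (χ - c^2*y^2) * ψ y ≤ q * ψ y := mul_le_mul_of_nonneg_right h1 (hnn y hyI)
        have h3 : q * ψ y ≤ q * ψ xs := mul_le_mul_of_nonneg_left (hM y hyI) hq0
        linarith)
    norm_num at this
    linarith
  have h2 := anti_help (f := fun y => ψ y - q * ψ xs * y) (f' := fun y => deriv ψ y - q * ψ xs) hxs.1
      (by have := h.cont; fun_prop) (fun y _ => by
        have := (h.hd y).fun_sub ((hasDerivAt_id y).const_mul (q * ψ xs))
        simpa using this) (fun y hy => by
        have hyI : y ∈ Icc b 1 := ⟨hy.1.le, hy.2.le.trans hxs.2⟩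
        have hy1 : y < 1 := lt_of_lt_of_le hy.2 hxs.2
        have k := key y hyI
        have hy0 : 0 ≤ y := hb0.trans hy.1.le
        by_contra hcon
        push Not at hcon
        have h4 : (1-y) * (q * ψ xs) < (1-y)*((1+y)*deriv ψ y) := by
          apply mul_lt_mul_of_pos_left _ (by linarith)
          have : 0 ≤ q * ψ xs := by positivity
          nlinarith
        nlinarith)
  simp only [h0] at h2
  have h5 : ψ xs * 1 ≤ ψ xs * (q * (xs - b)) := by linarith
  have h6 : 1 ≤ q * (xs - b) := le_of_mul_le_mul_left h5 hMp
  have h7 : q * (xs - b) ≤ q * (1 - b^2) := by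
    apply mul_le_mul_of_nonneg_left _ hq0
    nlinarith [hxs.2]
  linarith

theorem half_count (h : ProlSol c χ ψ) {d : ℝ} (hc : 1 ≤ c) (hd : 0 < d) (hχ : χ ≤ c^2*(1+d))
    (hfin : {x | x ∈ Ioo (-1:ℝ) 1 ∧ ψ x = 0}.Finite)
    {J J' : ℝ → ℝ} (hJc : ContinuousOn J (Icc 0 1))
    (hJ : ∀ x ∈ Ioo (0:ℝ) 1, HasDerivAt J (J' x) x)
    (hJ' : ∀ x ∈ Ioo (0:ℝ) 1, √((1-x^2)*(c^2*(1+d)-c^2*x^2)) / (1-x^2) ≤ J' x)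
    (F : Finset ℝ) (hF : ∀ x, x ∈ F ↔ x ∈ Ioo (0:ℝ) 1 ∧ ψ x = 0) :
    ((F.card : ℝ) - 1) * π ≤ J 1 - J 0 + 1/4 * log (c^2*(1+d)) := by
  have hJmono : MonotoneOn J (Icc 0 1) := by
    intro x hx y hy hxy
    have hsub : Ioo x y ⊆ Ioo 0 1 := Ioo_subset_Ioo hx.1 hy.2
    exact mono_help hxy (hJc.mono (Icc_subset_Icc hx.1 hy.2)) (fun z hz => hJ z (hsub hz))
      (fun z hz => le_trans (div_nonneg (sqrt_nonneg _) (by nlinarith [(hsub hz).1, (hsub hz).2])) (hJ' z (hsub hz)))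
  have hlog : 0 ≤ log (c^2*(1+d)) := log_nonneg (by nlinarith)
  have hJ01 : J 0 ≤ J 1 := hJmono (by simp) (by simp) zero_le_one
  by_cases hne : F.Nonempty
  swap
  · rw [Finset.not_nonempty_iff_eq_empty] at hne
    subst hne
    simp
    have := pi_pos
    linarith
  -- nontriviality
  have hnz : ∃ z, ψ z ≠ 0 := by
    by_contra hcon
    push Not at hcon
    apply (Ioo_infinite (show (-1:ℝ) < 1 by norm_num))
    convert hfin using 1
    ext x; simp [hcon x]
  obtain ⟨z, hz⟩ := hnz
  set Q : ℝ → ℝ := fun x => (1-x^2)*(c^2*(1+d)-c^2*x^2) with hQdef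
  have hQp : ∀ x ∈ Ico (0:ℝ) 1, 0 < Q x := fun x hx => by
    have h1 : 0 < 1 - x^2 := by nlinarith [hx.1, hx.2]
    have : 0 < c^2 * (d + (1-x^2)) := by positivity
    simp only [hQdef]
    nlinarith
  set B : ℝ → ℝ := fun x => J x - 1/4 * log (Q x) with hBdef
  set B' : ℝ → ℝ := fun x => J' x + (2*x*(c^2*(1+d)-c^2*x^2) + 2*x*c^2*(1-x^2))/(4*Q x) with hB'def
  have hBd : ∀ x ∈ Ioo (0:ℝ) 1, HasDerivAt B (B' x) x := by
    intro x hx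
    have hQd : HasDerivAt Q (-(2*x*(c^2*(1+d)-c^2*x^2) + 2*x*c^2*(1-x^2))) x := by
      have h1 : HasDerivAt (fun x : ℝ => 1 - x^2) (-(2*x)) x := by
        simpa using ((hasDerivAt_id x).pow 2).const_sub 1
      have h2 : HasDerivAt (fun x : ℝ => c^2*(1+d) - c^2*x^2) (-(c^2*(2*x))) x := by
        simpa using (((hasDerivAt_id x).pow 2).const_mul (c^2)).const_sub (c^2*(1+d))
      refine (h1.mul h2).congr_deriv ?_
      ring
    have hq := hQp x ⟨hx.1.le, hx.2⟩
    refine ((hJ x hx).fun_sub ((hQd.log hq.ne').const_mul (1/4))).congr_deriv ?_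
    simp only [hB'def]
    field_simp
    ring
  have hB'pos : ∀ x ∈ Ioo (0:ℝ) 1, √((1-x^2)*(c^2*(1+d)-c^2*x^2)) / (1-x^2)
      + (2*x*(c^2*(1+d)-c^2*x^2) + 2*x*c^2*(1-x^2))/(4*((1-x^2)*(c^2*(1+d)-c^2*x^2))) ≤ B' x := by
    intro x hx
    have := hJ' x hx
    simp only [hB'def]
    linarith
  have hB'0 : ∀ x ∈ Ioo (0:ℝ) 1, 0 ≤ B' x := by
    intro x hx
    refine le_trans ?_ (hB'pos x hx)
    have hq := hQp x ⟨hx.1.le, hx.2⟩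
    have h1 : 0 < 1 - x^2 := by nlinarith [hx.1, hx.2]
    have h2 : 0 < c^2*(1+d)-c^2*x^2 := by
      have : 0 < c^2 * (d + (1-x^2)) := by positivity
      nlinarith
    have hx0 := hx.1
    positivity
  have hgap : ∀ a ∈ F, ∀ b ∈ F, a < b → B a + π ≤ B b := by
    intro a haF b hbF hab
    have ha := (hF a).1 haF
    have hb := (hF b).1 hbF
    have hG : (F.filter (fun x => a < x)).Nonempty := ⟨b, by simp [hbF, hab]⟩
    set e := (F.filter (fun x => a < x)).min' hG with he
    have hemem := Finset.min'_mem _ hG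
    rw [← he] at hemem
    simp only [Finset.mem_filter] at hemem
    have heb : e ≤ b := Finset.min'_le _ _ (by simp [hbF, hab])
    have heF := (hF e).1 hemem.1
    have hno : ∀ x ∈ Ioo a e, ψ x ≠ 0 := by
      intro x hx h0
      have : x ∈ F := (hF x).2 ⟨⟨ha.1.1.trans hx.1, hx.2.trans heF.1.2⟩, h0⟩
      have : e ≤ x := Finset.min'_le _ _ (by simp [this, hx.1])
      linarith [hx.2]
    have hsub : Icc a e ⊆ Ioo (0:ℝ) 1 := fun x hx => ⟨lt_of_lt_of_le ha.1.1 hx.1, lt_of_le_of_lt hx.2 heF.1.2⟩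
    have hsub2 : Icc e b ⊆ Ioo (0:ℝ) 1 := fun x hx => ⟨lt_of_lt_of_le heF.1.1 hx.1, lt_of_le_of_lt hx.2 hb.1.2⟩
    have hBe : B e ≤ B b := mono_help heb (fun x hx => (hBd x (hsub2 hx)).continuousAt.continuousWithinAt)
      (fun x hx => hBd x (hsub2 (Ioo_subset_Icc_self hx))) (fun x hx => hB'0 x (hsub2 (Ioo_subset_Icc_self hx)))
    have hBa : B a + π ≤ B e := by
      rcases h.sign_const isPreconnected_Ioo hno with hp | hp
      · exact h.phase_pos (by linarith) hd hχ ha.1.1.le hemem.2 heF.1.2 ha.2 heF.2 hp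
          (fun x hx => (hBd x (hsub hx)).continuousAt.continuousWithinAt)
          (fun x hx => hBd x (hsub (Ioo_subset_Icc_self hx))) (fun x hx => hB'pos x (hsub (Ioo_subset_Icc_self hx)))
      · exact h.neg.phase_pos (by linarith) hd hχ ha.1.1.le hemem.2 heF.1.2 (by simp [ha.2]) (by simp [heF.2])
          (fun x hx => by have := hp x hx; linarith)
          (fun x hx => (hBd x (hsub hx)).continuousAt.continuousWithinAt)
          (fun x hx => hBd x (hsub (Ioo_subset_Icc_self hx))) (fun x hx => hB'pos x (hsub (Ioo_subset_Icc_self hx)))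
    linarith
  have hg := finset_gap B π F hgap hne
  set b := F.max' hne with hbdef
  set a := F.min' hne with hadef
  have hb := (hF b).1 (F.max'_mem hne)
  have ha := (hF a).1 (F.min'_mem hne)
  have hnob : ∀ x ∈ Ioc b 1, ψ x ≠ 0 := by
    intro x hx h0
    rcases hx.2.eq_or_lt with h1 | h1
    · subst h1; exact h.ne_one hz h0
    · have : x ∈ F := (hF x).2 ⟨⟨hb.1.1.trans hx.1, h1⟩, h0⟩
      have := F.le_max' x this
      linarith [hx.1]
  have hQb : 1 ≤ Q b := by
    rcases h.sign_const isPreconnected_Ioc hnob with hp | hp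
    · exact h.last_zero hd hχ hb.1.1.le hb.1.2 hb.2 hp
    · exact h.neg.last_zero hd hχ hb.1.1.le hb.1.2 (by simp [hb.2]) (fun x hx => by have := hp x hx; linarith)
  have hQa : Q a ≤ c^2*(1+d) := by
    have h1 := ha.1.1
    have h2 := ha.1.2
    have h3 : 0 ≤ c^2*(1+d)-c^2*a^2 := by
      have : 0 ≤ c^2 * (1 + d - a^2) := mul_nonneg (sq_nonneg c) (by nlinarith)
      linarith
    have h4 : 0 ≤ c^2*a^2 := by positivity
    have h5 : 0 ≤ a^2 * (c^2*(1+d)-c^2*a^2) := by positivity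
    simp only [hQdef]
    linarith
  have hlb : 0 ≤ log (Q b) := log_nonneg hQb
  have hla : log (Q a) ≤ log (c^2*(1+d)) := log_le_log (hQp a ⟨ha.1.1.le, ha.1.2⟩) hQa
  have hj1 : J b ≤ J 1 := hJmono ⟨hb.1.1.le, hb.1.2.le⟩ (by simp) hb.1.2.le
  have hj0 : J 0 ≤ J a := hJmono (by simp) ⟨ha.1.1.le, ha.1.2.le⟩ ha.1.1.le
  simp only [hBdef] at hg
  linarith

theorem zero_count (h : ProlSol c χ ψ) {d : ℝ} (hc : 1 ≤ c) (hd : 0 < d) (hχ : χ ≤ c^2*(1+d))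
    {n : ℕ} (hcard : {x | x ∈ Ioo (-1:ℝ) 1 ∧ ψ x = 0}.encard = n)
    {J J' : ℝ → ℝ} (hJc : ContinuousOn J (Icc 0 1))
    (hJ : ∀ x ∈ Ioo (0:ℝ) 1, HasDerivAt J (J' x) x)
    (hJ' : ∀ x ∈ Ioo (0:ℝ) 1, √((1-x^2)*(c^2*(1+d)-c^2*x^2)) / (1-x^2) ≤ J' x) :
    ((n : ℝ) - 3) * π ≤ 2 * (J 1 - J 0 + 1/4 * log (c^2*(1+d))) := by
  have hfin : {x | x ∈ Ioo (-1:ℝ) 1 ∧ ψ x = 0}.Finite := finite_of_encard_eq_coe hcard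
  set A := hfin.toFinset with hA
  have hAm : ∀ x, x ∈ A ↔ x ∈ Ioo (-1:ℝ) 1 ∧ ψ x = 0 := fun x => by simp [hA]
  have hcA : A.card = n := by
    have := hfin.encard_eq_coe_toFinset_card
    rw [hcard] at this
    have h5 : (n : ℕ∞) = (A.card : ℕ∞) := this
    exact_mod_cast h5.symm
  have h1 := h.half_count hc hd hχ hfin hJc hJ hJ' (A.filter (fun x => 0 < x)) (fun x => by
    simp only [Finset.mem_filter, hAm, mem_Ioo]
    constructor
    · rintro ⟨⟨⟨_, h2⟩, h3⟩, h4⟩; exact ⟨⟨h4, h2⟩, h3⟩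
    · rintro ⟨⟨h1, h2⟩, h3⟩; exact ⟨⟨⟨by linarith, h2⟩, h3⟩, h1⟩)
  have hfin' : {x | x ∈ Ioo (-1:ℝ) 1 ∧ (fun x => ψ (-x)) x = 0}.Finite := by
    apply (hfin.image (fun x => -x)).subset
    rintro x ⟨hx1, hx2⟩
    exact ⟨-x, ⟨⟨by linarith [hx1.2], by linarith [hx1.1]⟩, hx2⟩, by simp⟩
  have h2 := h.reflect.half_count hc hd hχ hfin' hJc hJ hJ' ((A.filter (fun x => x < 0)).image (fun x => -x)) (fun x => by
    simp only [Finset.mem_image, Finset.mem_filter, hAm, mem_Ioo]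
    constructor
    · rintro ⟨y, ⟨⟨⟨h1, h2⟩, h3⟩, h4⟩, rfl⟩; exact ⟨⟨by linarith, by linarith⟩, by simpa using h3⟩
    · rintro ⟨⟨h1, h2⟩, h3⟩; exact ⟨-x, ⟨⟨⟨by linarith, by linarith⟩, h3⟩, by linarith⟩, by simp⟩)
  rw [Finset.card_image_of_injective _ neg_injective] at h2
  have h3 : A.card ≤ (A.filter (fun x => 0 < x)).card + (A.filter (fun x => x < 0)).card + 1 := by
    have : A ⊆ (A.filter (fun x => 0 < x)) ∪ (A.filter (fun x => x < 0)) ∪ {0} := by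
      intro x hx
      simp only [Finset.mem_union, Finset.mem_filter, Finset.mem_singleton]
      rcases lt_trichotomy x 0 with h | h | h <;> tauto
    refine (Finset.card_le_card this).trans ((Finset.card_union_le _ _).trans ?_)
    have := Finset.card_union_le (A.filter (fun x => 0 < x)) (A.filter (fun x => x < 0))
    simp
    omega
  rw [hcA] at h3
  have h4 : (n:ℝ) ≤ (A.filter (fun x => 0 < x)).card + (A.filter (fun x => x < 0)).card + 1 := by exact_mod_cast h3
  have := pi_pos
  nlinarith

end ProlSol
end

section
theorem J_case1 {c R : ℝ} (hc : 60 < c) (hR1 : 1 < R) {g : ℝ} (hg : g = c*(R-1/R)) :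
    ∃ J J' : ℝ → ℝ, ContinuousOn J (Icc 0 1) ∧ (∀ x ∈ Ioo (0:ℝ) 1, HasDerivAt J (J' x) x) ∧
    (∀ x ∈ Ioo (0:ℝ) 1, √((1-x^2)*(c^2*(1+(R^2-1))-c^2*x^2)) / (1-x^2) ≤ J' x) ∧
    J 1 - J 0 - c ≤ (c*(R^2-1)/4) * (1 + log (16*(1+(R^2-1)/8)^2/(R^2-1))) := by
  set d := R^2 - 1 with hd
  have hd0 : 0 < d := by rw [hd]; nlinarith
  set a := d/2 with ha
  have ha0 : 0 < a := by positivity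
  refine ⟨fun x => c*(-(√(1-x) * √(1-x+a)) - a * log (√(1-x) + √(1-x+a)) + (a/2) * log (1+x)),
    fun x => c*(√(1-x+a)/√(1-x) + (a/2) * (1/(1+x))), ?_, ?_, ?_, ?_⟩
  · have h1 : ∀ x ∈ Icc (0:ℝ) 1, √(1-x) + √(1-x+a) ≠ 0 := fun x hx => by
      have : 0 < √(1-x+a) := sqrt_pos.2 (by linarith [hx.2])
      positivity
    have h2 : ∀ x ∈ Icc (0:ℝ) 1, 1 + x ≠ 0 := fun x hx => by linarith [hx.1]
    have c1 : ContinuousOn (fun x : ℝ => log (√(1-x) + √(1-x+a))) (Icc 0 1) :=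
      ContinuousOn.log (by fun_prop) h1
    have c2 : ContinuousOn (fun x : ℝ => log (1+x)) (Icc 0 1) :=
      ContinuousOn.log (by fun_prop) h2
    fun_prop
  · intro x hx
    have hu : 0 < 1 - x := by linarith [hx.2]
    have hua : 0 < 1 - x + a := by linarith
    have d1 : HasDerivAt (fun x => √(1-x)) (-1/(2*√(1-x))) x := by
      have : HasDerivAt (fun x : ℝ => 1-x) (-1) x := by simpa using (hasDerivAt_id x).const_sub 1
      exact this.sqrt hu.ne'
    have d2 : HasDerivAt (fun x => √(1-x+a)) (-1/(2*√(1-x+a))) x := by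
      have : HasDerivAt (fun x : ℝ => 1-x+a) (-1) x := by simpa using ((hasDerivAt_id x).const_sub 1).add_const a
      exact this.sqrt hua.ne'
    have d3 : HasDerivAt (fun x => log (1+x)) (1/(1+x)) x := by
      have : HasDerivAt (fun x : ℝ => 1+x) 1 x := by simpa using (hasDerivAt_id x).const_add 1
      exact this.log (by linarith [hx.1])
    have p1 := sqrt_pos.2 hu
    have p2 := sqrt_pos.2 hua
    have e := ((((d1.fun_mul d2).fun_neg).fun_sub (((d1.fun_add d2).log (by positivity)).const_mul a)).fun_add
      (d3.const_mul (a/2))).const_mul c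
    refine e.congr_deriv ?_
    beta_reduce
    have s1 : √(1-x)^2 = 1-x := sq_sqrt hu.le
    have s2 : √(1-x+a)^2 = 1-x+a := sq_sqrt hua.le
    have s3 : a = √(1-x+a)^2 - √(1-x)^2 := by rw [s1, s2]; ring
    generalize √(1-x) = u at *
    generalize √(1-x+a) = v at *
    have hx1 : 1 + x ≠ 0 := by linarith [hx.1]
    congr 1
    congr 1
    rw [s3]
    field_simp
    ring
  · intro x hx
    have hu : 0 < 1 - x := by linarith [hx.2]
    have hv : 0 < 1 + x := by linarith [hx.1]
    have hua : 0 < 1 - x + a := by linarith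
    have hp : 0 < 1 - x^2 := by nlinarith
    have p1 := sqrt_pos.2 hu
    have p2 := sqrt_pos.2 hua
    have hc0 : 0 < c := by linarith
    beta_reduce
    rw [← sqrt_div hua.le, div_le_iff₀ hp]
    set T := √((1-x+a)/(1-x)) with hT
    have hTs : T^2 = (1-x+a)/(1-x) := sq_sqrt (by positivity)
    have hT1 : 1 ≤ T := by
      rw [hT]; apply one_le_sqrt.2; rw [le_div_iff₀ hu]; linarith
    rw [sqrt_le_left (by positivity)]
    have e1 : (1-x^2)*(c^2*(1+d)-c^2*x^2) = (c*(1-x^2))^2 * (T^2 + 2 * (a/2*(1/(1+x)))) := by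
      rw [hTs, ha]; field_simp; ring
    rw [e1]
    have : T^2 + 2 * (a/2*(1/(1+x))) ≤ (T + a/2*(1/(1+x)))^2 := by
      have : 0 < a/2*(1/(1+x)) := by positivity
      nlinarith
    have h2 := mul_le_mul_of_nonneg_left this (sq_nonneg (c*(1-x^2)))
    nlinarith
  · have s1 : √a ≠ 0 := (sqrt_pos.2 ha0).ne'
    have hl : log (√a) = log a / 2 := log_sqrt ha0.le
    have hsq : √(1+a) ≤ 1 + a/2 := by
      rw [sqrt_le_left (by positivity)]; nlinarith
    have hl2 : log (1 + √(1+a)) ≤ log (2*(1+d/8)) := by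
      apply log_le_log (by positivity)
      linarith
    have hl3 : log (16*(1+d/8)^2/d) = 2 * log (2*(1+d/8)) + log 2 - log a := by
      have : 16*(1+d/8)^2/d = (2*(1+d/8))^2 * 2 / a := by rw [ha]; field_simp; norm_num
      rw [this, log_div (by positivity) ha0.ne', log_mul (by positivity) (by norm_num), log_pow]
      norm_num
    rw [hl3]
    norm_num
    rw [hl]
    have hc0 : 0 < c := by linarith
    have : c * (√(1 + a) + a * log (1 + √(1+a)) - a * (log a / 2) + a/2*log 2 - 1) ≤
      c * (a/2 + a * log (2*(1+d/8)) - a * (log a/2) + a/2 * log 2) := by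
      apply mul_le_mul_of_nonneg_left _ hc0.le
      have := mul_le_mul_of_nonneg_left hl2 ha0.le
      linarith
    have hda : d = 2*a := by rw [ha]; ring
    rw [hda] at this ⊢
    norm_num at this ⊢
    nlinarith

theorem log60 {c : ℝ} (hc : 60 < c) : 4 ≤ log c := by
  rw [le_log_iff_exp_le (by linarith)]
  have h1 := exp_one_lt_d9
  have h2 : exp 4 = exp 1 ^ 4 := by rw [← exp_nat_mul]; norm_num
  rw [h2]
  have h3 : exp 1 ^ 4 ≤ 2.7182818286 ^ 4 := pow_le_pow_left₀ (exp_pos 1).le h1.le 4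
  norm_num at h3 ⊢
  linarith

theorem log48 {g : ℝ} (hg : 48 ≤ g) : 5.5 * log 2 ≤ log g := by
  have h1 : log ((2:ℝ)^11) ≤ log (g^2) := log_le_log (by positivity) (by nlinarith)
  rw [log_pow, log_pow] at h1
  norm_num at h1
  linarith

theorem log30 {x : ℝ} (hg : 30 ≤ x) : 4.9 * log 2 ≤ log x := by
  have h1 : log ((2:ℝ)^49) ≤ log (x^10) := log_le_log (by positivity) (by
    have := pow_le_pow_left₀ (by norm_num) hg 10
    refine le_trans ?_ this
    norm_num)
  rw [log_pow, log_pow] at h1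
  norm_num at h1
  linarith

set_option maxHeartbeats 1000000 in
theorem count_num {c R g : ℝ} (hc : 60 < c) (hR1 : 1 < R) (hg : g = c*(R-1/R))
    (hgl : 30 + 4.5*log c ≤ g) :
    ∃ J J' : ℝ → ℝ, ContinuousOn J (Icc 0 1) ∧ (∀ x ∈ Ioo (0:ℝ) 1, HasDerivAt J (J' x) x) ∧
    (∀ x ∈ Ioo (0:ℝ) 1, √((1-x^2)*(c^2*(1+(R^2-1))-c^2*x^2)) / (1-x^2) ≤ J' x) ∧
    2 * (J 1 - J 0 + 1/4 * log (c^2*(1+(R^2-1)))) ≤ 2*c + g/3 * log (c/2) * π - 3 * π := by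
  have hc0 : 0 < c := by linarith
  have hR0 : 0 < R := by linarith
  have hl := log60 hc
  have hg48 : 48 ≤ g := by linarith
  have hlg := log48 hg48
  have l2a := log_two_gt_d9
  have l2b := log_two_lt_d9
  have pia := pi_gt_d4
  have pib := pi_lt_d4
  have hlogχ : log (c^2*(1+(R^2-1))) = 2 * log c + 2 * log R := by
    rw [show c^2*(1+(R^2-1)) = (c*R)^2 by ring, log_pow, log_mul hc0.ne' hR0.ne']
    push_cast; ring
  have hlR : log R ≤ R - 1 := log_le_sub_one_of_pos hR0
  have hlc2 : log (c/2) = log c - log 2 := log_div hc0.ne' (by norm_num)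
  rw [hlogχ]
  by_cases hRs : R^2 ≤ 2.4
  · obtain ⟨J, J', h1, h2, h3, h4⟩ := J_case1 hc hR1 hg
    refine ⟨J, J', h1, h2, h3, ?_⟩
    set d := R^2-1 with hd
    have hd0 : 0 < d := by rw [hd]; nlinarith
    have hd1 : d ≤ 1.4 := by linarith
    have hcd : c * d = g * R := by rw [hg, hd]; field_simp
    have hRb : R ≤ 1.5492 := by nlinarith
    have hlog : log (16*(1+d/8)^2/d) ≤ 4*log 2 + log c - log g := by
      have : 4*log 2 + log c - log g = log (16 * c / g) := by
        rw [log_div (by positivity) (by linarith), log_mul (by norm_num) hc0.ne',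
          show (16:ℝ) = 2^4 by norm_num, log_pow]; norm_num
      rw [this]
      apply log_le_log (by positivity)
      have hde : d = g*R/c := by field_simp; linarith
      have : 16*(1+d/8)^2/d = 16*c/g * ((1+d/8)^2/R) := by
        rw [div_mul_div_comm, div_eq_div_iff hd0.ne' (by positivity)]
        nlinarith [hcd]
      rw [this]
      apply mul_le_of_le_one_right (by positivity)
      rw [div_le_one hR0]
      apply (sq_le_sq₀ (by positivity) hR0.le).1
      have : R^2 = 1 + d := by rw [hd]; ring
      rw [this]
      have e1 : (1+d/8)^2 ≤ 1 + 0.3*d := by nlinarith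
      have e2 : (1+0.3*d)^2 ≤ 1 + d := by nlinarith
      have e3 : ((1+d/8)^2)^2 ≤ (1+0.3*d)^2 := pow_le_pow_left₀ (by positivity) e1 2
      linarith
    rw [hcd] at h4
    have h5 : J 1 - J 0 - c ≤ g*R/4 * (log c - 0.03) := by
      refine h4.trans ?_
      apply mul_le_mul_of_nonneg_left _ (by positivity)
      linarith
    have h6 : g*R/4 * (log c - 0.03) ≤ g*0.3873*(log c - 0.03) := by
      apply mul_le_mul_of_nonneg_right _ (by linarith)
      nlinarith
    have h7 : g/3*(log c - 0.6932)*3.1415 ≤ g/3 * log (c/2) * π := by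
      rw [hlc2]
      apply mul_le_mul _ pia.le (by norm_num)
      · have : 0 ≤ log c - log 2 := by linarith
        positivity
      · apply mul_le_mul_of_nonneg_left _ (by positivity)
        linarith
    have h8 : 48 * (log c * 0.272 - 0.7) ≤ g * (log c * 0.272 - 0.7) :=
      mul_le_mul_of_nonneg_right hg48 (by linarith)
    nlinarith
  · push Not at hRs
    have hRb : 1.549 ≤ R := by nlinarith
    refine ⟨fun x => c*R*arcsin x, fun x => c*R*(1/√(1-x^2)), by fun_prop, ?_, ?_, ?_⟩
    · intro x hx
      exact (hasDerivAt_arcsin (by linarith [hx.1]) (by linarith [hx.2])).const_mul _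
    · intro x hx
      have hp : 0 < 1 - x^2 := by nlinarith [hx.1, hx.2]
      rw [div_le_iff₀ hp]
      have hs := sqrt_pos.2 hp
      have e : c*R*(1/√(1-x^2))*(1-x^2) = c*R*√(1-x^2) := by
        field_simp; rw [sq_sqrt hp.le]
      rw [e, sqrt_mul hp.le, mul_comm]
      apply mul_le_mul_of_nonneg_right _ hs.le
      rw [sqrt_le_left (by positivity)]
      have := sq_nonneg (c*x)
      rw [mul_pow] at this
      rw [mul_pow]
      linarith
    · simp only [arcsin_one, arcsin_zero]
      have hl30 := log30 (show 30 ≤ c/2 by linarith)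
      have hlc : log c ≤ c/64 + 3.16 := by
        have : log (c/64) ≤ c/64 - 1 := log_le_sub_one_of_pos (by positivity)
        rw [log_div hc0.ne' (by norm_num), show (64:ℝ) = 2^6 by norm_num, log_pow] at this
        norm_num at this ⊢
        linarith
      have hg0 : 0 ≤ g := by linarith
      have h1 : g * (1.132*π) ≤ g/3 * log (c/2) * π := by
        have : g*1.132 ≤ g/3*log (c/2) := by nlinarith
        have := mul_le_mul_of_nonneg_right this pi_pos.le
        linarith
      have hRi : 1/R ≤ 0.6456 := by rw [div_le_iff₀ hR0]; linarith
      have h2 : c * (1.132 * (R-1/R) - R + 2/3.1416) ≥ (c/64 + 3.16 + R-1)/3.1415 + 3 := by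
        have : 0.102 + 0.132*(R-1.549) ≤ (1.132 * (R-1/R) - R + 2/3.1416) := by
          linarith
        have h9 := mul_le_mul_of_nonneg_left this hc0.le
        refine ge_iff_le.2 (le_trans ?_ h9)
        have h10 : 60 * (R - 1.549) ≤ c * (R - 1.549) := mul_le_mul_of_nonneg_right hc.le (by linarith)
        have h11 : (c/64 + 3.16 + R-1)/3.1415 ≤ (c/64 + 3.16 + R-1)/3 := by
          apply div_le_div_of_nonneg_left _ (by norm_num) (by norm_num)
          linarith
        linarith
      have h3 : (log c + log R) ≤ π * ((c/64 + 3.16 + R-1)/3.1415) := by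
        have : 3.1415 * ((c/64 + 3.16 + R-1)/3.1415) ≤ π * ((c/64 + 3.16 + R-1)/3.1415) := by
          apply mul_le_mul_of_nonneg_right pia.le; apply div_nonneg <;> linarith
        rw [mul_div_cancel₀ _ (by norm_num)] at this
        linarith
      have h4 : π * (c * (2/3.1416)) ≤ 2*c := by
        have : π * (c * (2/3.1416)) ≤ 3.1416 * (c * (2/3.1416)) := by
          apply mul_le_mul_of_nonneg_right pib.le; positivity
        linarith
      have h5 := mul_le_mul_of_nonneg_left h2 pi_pos.le
      rw [hg] at h1 ⊢
      nlinarith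

/-- lower bound on the eigenvalue `χ` from the number of zeros -/
theorem ProlSol.chi_lower {c χ ε : ℝ} {ψ : ℝ → ℝ} (h : ProlSol c χ ψ) (hc : 60 < c) (hε0 : 0 < ε) (hε1 : ε < 1)
    {n : ℕ} (hcard : {x | x ∈ Ioo (-1:ℝ) 1 ∧ ψ x = 0}.encard = n)
    (hbig : (n : ℝ) > 2*c/π + (10 + (3/2) * log c + (1/2) * log (1/ε)) * log (c/2)) :
    ∃ R, 1 < R ∧ χ = c^2*R^2 ∧ 3 * (10 + (3/2) * log c + (1/2) * log (1/ε)) ≤ c*(R-1/R) := by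
  set A := 10 + (3/2) * log c + (1/2) * log (1/ε) with hA
  have hc0 : 0 < c := by linarith
  have hl := log60 hc
  have hle : 0 ≤ log (1/ε) := log_nonneg (by rw [le_div_iff₀ hε0]; linarith)
  have hA0 : 0 < A := by linarith
  set γ := 3*A/c with hγ
  have hγ0 : 0 < γ := by positivity
  set R0 := (γ + √(γ^2+4))/2 with hR0
  have hs : √(γ^2+4)^2 = γ^2+4 := sq_sqrt (by positivity)
  have hsp : 2 < √(γ^2+4) := by
    apply lt_sqrt_of_sq_lt; nlinarith
  have hR01 : 1 < R0 := by rw [hR0]; linarith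
  have hR0p : 0 < R0 := by linarith
  have hRi : R0 - 1/R0 = γ := by
    have : R0^2 - γ*R0 - 1 = 0 := by rw [hR0]; nlinarith
    field_simp; linarith
  have hg : 3*A = c*(R0-1/R0) := by rw [hRi, hγ]; field_simp
  obtain ⟨J, J', h1, h2, h3, h4⟩ := count_num hc hR01 hg (by linarith)
  have hχ : c^2*R0^2 < χ := by
    by_contra hcon
    push Not at hcon
    have := h.zero_count (by linarith) (d := R0^2-1) (by nlinarith) (by linarith) hcard h1 h2 h3
    have h5 := this.trans h4
    have h6 := mul_lt_mul_of_pos_right hbig pi_pos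
    have h7 : 2*c/π*π = 2*c := by field_simp
    nlinarith
  have hχ0 : 0 < χ := lt_trans (by positivity) hχ
  refine ⟨√χ/c, ?_, ?_, ?_⟩
  · rw [lt_div_iff₀ hc0]
    apply lt_sqrt_of_sq_lt
    have : c^2 * 1 ≤ c^2*R0^2 := mul_le_mul_of_nonneg_left (by nlinarith) (sq_nonneg c)
    linarith
  · rw [div_pow, sq_sqrt hχ0.le]; field_simp
  · rw [hg]
    apply mul_le_mul_of_nonneg_left _ hc0.le
    have : R0 ≤ √χ/c := by
      rw [le_div_iff₀ hc0]
      apply le_sqrt_of_sq_le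
      nlinarith
    have := one_div_le_one_div_of_le hR0p this
    linarith
end

section
namespace ProlSol
variable {c χ : ℝ} {ψ φ : ℝ → ℝ}

theorem deriv_nonneg_left (h : ProlSol c χ ψ) {a b : ℝ} (hab : a < b) (h0a : ψ a = 0)
    (hpos : ∀ x ∈ Ioo a b, 0 < ψ x) : 0 ≤ deriv ψ a := by
  have := (h.hd a).hasDerivWithinAt (s := Ioi a)
  rw [hasDerivWithinAt_iff_tendsto_slope' (by simp)] at this
  refine ge_of_tendsto this ?_
  filter_upwards [Ioo_mem_nhdsGT hab] with x hx
  rw [slope_def_field, h0a, sub_zero]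
  exact div_nonneg (hpos x hx).le (by linarith [hx.1])

theorem deriv_nonpos_right (h : ProlSol c χ ψ) {a b : ℝ} (hab : a < b) (h0b : ψ b = 0)
    (hpos : ∀ x ∈ Ioo a b, 0 < ψ x) : deriv ψ b ≤ 0 := by
  have := (h.hd b).hasDerivWithinAt (s := Iio b)
  rw [hasDerivWithinAt_iff_tendsto_slope' (by simp)] at this
  refine le_of_tendsto this ?_
  filter_upwards [Ioo_mem_nhdsLT hab] with x hx
  rw [slope_def_field, h0b, sub_zero]
  exact div_nonpos_of_nonneg_of_nonpos (hpos x hx).le (by linarith [hx.2])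

theorem sturm_pos {χ' : ℝ} (h : ProlSol c χ ψ) (k : ProlSol c χ' φ) (hle : χ ≤ χ')
    {a b : ℝ} (ha : -1 ≤ a) (hab : a < b) (hb : b < 1) (h0a : a = -1 ∨ ψ a = 0) (h0b : ψ b = 0)
    (hpos : ∀ x ∈ Ioo a b, 0 < ψ x) (hφ : ∀ x ∈ Ioc a b, 0 < φ x) : False := by
  have hz : ψ ((a+b)/2) ≠ 0 := (hpos _ ⟨by linarith, by linarith⟩).ne'
  have hpp : ∀ x ∈ Icc a b, 0 ≤ 1 - x^2 := fun x hx => by nlinarith [hx.1, hx.2]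
  have hpb : 0 < 1 - b^2 := by nlinarith
  have hV := mono_help (f := fun x => φ x * ((1-x^2) * deriv ψ x) - ψ x * ((1-x^2) * deriv φ x))
    (f' := fun x => (χ' - χ) * φ x * ψ x) hab.le
    (by have := h.cont; have := h.cont'; have := k.cont; have := k.cont'; fun_prop)
    (fun x _ => by
      refine (((k.hd x).fun_mul (h.hp x)).fun_sub ((h.hd x).fun_mul (k.hp x))).congr_deriv ?_
      ring)
    (fun x hx => mul_nonneg (mul_nonneg (by linarith) (hφ x ⟨hx.1, hx.2.le⟩).le) (hpos x hx).le)
  simp only [h0b] at hV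
  have hdb : deriv ψ b < 0 := lt_of_le_of_ne (h.deriv_nonpos_right hab h0b hpos) (h.deriv_ne hz h0b)
  have h1 : φ b * ((1-b^2) * deriv ψ b) < 0 :=
    mul_neg_of_pos_of_neg (hφ b ⟨hab, le_rfl⟩) (mul_neg_of_pos_of_neg hpb hdb)
  have h2 : 0 ≤ φ a * ((1-a^2) * deriv ψ a) - ψ a * ((1-a^2) * deriv φ a) := by
    rcases h0a with h3 | h3
    · subst h3; norm_num
    · rw [h3]
      have hφa : 0 ≤ φ a := by
        have := (k.cont.tendsto a).mono_left (nhdsWithin_le_nhds (s := Ioi a))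
        refine ge_of_tendsto this ?_
        filter_upwards [Ioo_mem_nhdsGT hab] with x hx
        exact (hφ x ⟨hx.1, hx.2.le⟩).le
      have := mul_nonneg hφa (mul_nonneg (hpp a ⟨le_rfl, hab.le⟩) (h.deriv_nonneg_left hab h3 hpos))
      linarith
  linarith

theorem sturm_exists {χ' : ℝ} (h : ProlSol c χ ψ) (k : ProlSol c χ' φ) (hle : χ ≤ χ')
    {a b : ℝ} (ha : -1 ≤ a) (hab : a < b) (hb : b < 1) (h0a : a = -1 ∨ ψ a = 0) (h0b : ψ b = 0)
    (hno : ∀ x ∈ Ioo a b, ψ x ≠ 0) : ∃ x ∈ Ioc a b, φ x = 0 := by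
  by_contra hcon
  push Not at hcon
  have h0a' : a = -1 ∨ (fun x => - ψ x) a = 0 := by simpa using h0a
  have h0b' : (fun x => - ψ x) b = 0 := by simpa using h0b
  rcases h.sign_const isPreconnected_Ioo hno with h1 | h1 <;>
    rcases k.sign_const isPreconnected_Ioc hcon with h2 | h2
  · exact h.sturm_pos k hle ha hab hb h0a h0b h1 h2
  · exact h.sturm_pos k.neg hle ha hab hb h0a h0b h1 (fun x hx => by have := h2 x hx; linarith)
  · exact h.neg.sturm_pos k hle ha hab hb h0a' h0b' (fun x hx => by have := h1 x hx; linarith) h2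
  · exact h.neg.sturm_pos k.neg hle ha hab hb h0a' h0b' (fun x hx => by have := h1 x hx; linarith)
      (fun x hx => by have := h2 x hx; linarith)

theorem chi_lt {χ' : ℝ} {m n : ℕ} (h : ProlSol c χ ψ) (k : ProlSol c χ' φ)
    (hn : {x | x ∈ Ioo (-1:ℝ) 1 ∧ ψ x = 0}.encard = n)
    (hm : {x | x ∈ Ioo (-1:ℝ) 1 ∧ φ x = 0}.encard = m) (hmn : m < n) : χ' < χ := by
  by_contra hle
  push Not at hle
  have hfin : {x | x ∈ Ioo (-1:ℝ) 1 ∧ ψ x = 0}.Finite := finite_of_encard_eq_coe hn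
  have key : ∀ b : {x | x ∈ Ioo (-1:ℝ) 1 ∧ ψ x = 0}, ∃ s, (s ∈ Ioo (-1:ℝ) 1 ∧ φ s = 0) ∧ s ≤ b ∧
      ∀ a, a ∈ Ioo (-1:ℝ) 1 → ψ a = 0 → a < b → a < s := by
    rintro ⟨b, hbI, hb0⟩
    obtain ⟨a, ha1, ha2, ha3, ha4⟩ : ∃ a, -1 ≤ a ∧ a < b ∧ (a = -1 ∨ ψ a = 0) ∧
        ∀ x ∈ Ioo (-1:ℝ) 1, ψ x = 0 → x < b → x ≤ a := by
      by_cases hne : (hfin.toFinset.filter (fun x => x < b)).Nonempty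
      · have hm := Finset.max'_mem _ hne
        simp only [Finset.mem_filter, Set.Finite.mem_toFinset, mem_ofPred_eq] at hm
        refine ⟨_, hm.1.1.1.le, hm.2, Or.inr hm.1.2, fun x hx hx0 hxb => ?_⟩
        exact Finset.le_max' _ _ (by simp [hx.1, hx.2, hx0, hxb])
      · refine ⟨-1, le_rfl, hbI.1, Or.inl rfl, fun x hx hx0 hxb => ?_⟩
        exact absurd ⟨x, by simp [hx.1, hx.2, hx0, hxb]⟩ hne
    obtain ⟨s, hs, hs0⟩ := h.sturm_exists k hle ha1 ha2 hbI.2 ha3 hb0 (fun x hx h0 => by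
      have := ha4 x ⟨lt_of_le_of_lt ha1 hx.1, hx.2.trans hbI.2⟩ h0 hx.2
      linarith [hx.1])
    exact ⟨s, ⟨⟨lt_of_le_of_lt ha1 hs.1, lt_of_le_of_lt hs.2 hbI.2⟩, hs0⟩, hs.2, fun x hx hx0 hxb =>
      lt_of_le_of_lt (ha4 x hx hx0 hxb) hs.1⟩
  choose f hf1 hf2 hf3 using key
  have hinj : Function.Injective (fun b => (⟨f b, hf1 b⟩ : {x | x ∈ Ioo (-1:ℝ) 1 ∧ φ x = 0})) := by
    intro b1 b2 he
    simp only [Subtype.mk.injEq] at he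
    rcases lt_trichotomy b1.1 b2.1 with h1 | h1 | h1
    · have := hf3 b2 b1 b1.2.1 b1.2.2 h1
      have := hf2 b1
      linarith
    · exact Subtype.ext h1
    · have := hf3 b1 b2 b2.2.1 b2.2.2 h1
      have := hf2 b2
      linarith
  have := (Function.Embedding.mk _ hinj).encard_le
  rw [hn, hm] at this
  have : n ≤ m := by exact_mod_cast this
  omega

theorem chi_nonneg (h : ProlSol c χ ψ) (hnorm : ∫ t in (-1:ℝ)..1, (ψ t)^2 = 1) : 0 ≤ χ := by
  have hc := h.cont
  have hc' := h.cont'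
  have e : ∀ x ∈ uIcc (-1:ℝ) 1, HasDerivAt (fun x => ψ x * ((1-x^2) * deriv ψ x))
      (((1-x^2) * (deriv ψ x)^2 + c^2*x^2*(ψ x)^2) - χ * (ψ x)^2) x := by
    intro x hx
    refine ((h.hd x).fun_mul (h.hp x)).congr_deriv ?_
    ring
  have := intervalIntegral.integral_eq_sub_of_hasDerivAt e (by
    apply Continuous.intervalIntegrable; fun_prop)
  norm_num at this
  rw [intervalIntegral.integral_sub (by apply Continuous.intervalIntegrable; fun_prop)
    (by apply Continuous.intervalIntegrable; fun_prop), intervalIntegral.integral_const_mul, hnorm] at this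
  have h2 : 0 ≤ ∫ x in (-1:ℝ)..1, ((1-x^2) * (deriv ψ x)^2 + c^2*x^2*(ψ x)^2) := by
    apply intervalIntegral.integral_nonneg (by norm_num)
    intro x hx
    have : 0 ≤ 1 - x^2 := by nlinarith [hx.1, hx.2]
    positivity
  linarith

theorem sup_aux (h : ProlSol c χ ψ) (hnorm : ∫ t in (-1:ℝ)..1, (ψ t)^2 = 1) {X : ℝ} (hX : 1 ≤ X)
    (hq : ∀ x ∈ Icc (-1:ℝ) 1, |χ - c^2*x^2| ≤ X) {x0 : ℝ} (hx0 : x0 ∈ Icc (0:ℝ) 1)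
    (hmax : ∀ x ∈ Icc (-1:ℝ) 1, |ψ x| ≤ |ψ x0|) : (ψ x0)^2 ≤ 8*X := by
  set M := |ψ x0| with hM
  have hM0 : 0 ≤ M := abs_nonneg _
  have hqψ : ∀ x ∈ Icc (-1:ℝ) 1, |(χ - c^2*x^2) * ψ x| ≤ X*M := fun x hx => by
    rw [abs_mul]
    exact mul_le_mul (hq x hx) (hmax x hx) (abs_nonneg _) (by linarith)
  have hder : ∀ x ∈ Ioo (-1:ℝ) 1, |deriv ψ x| ≤ X*M := by
    intro x hx
    have hc' := h.cont'
    have hp : 0 < 1 - x^2 := by nlinarith [hx.1, hx.2]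
    have hXM : 0 ≤ X*M := by positivity
    have up : |(1-x^2)*deriv ψ x| ≤ X*M*(1-x) := by
      have u1 := mono_help (f := fun y => (1-y^2)*deriv ψ y + X*M*y)
        (f' := fun y => -((χ - c^2*y^2) * ψ y) + X*M) hx.2.le (by fun_prop)
        (fun y _ => by simpa using (h.hp y).fun_add ((hasDerivAt_id y).const_mul (X*M)))
        (fun y hy => by
          have := (abs_le.1 (hqψ y ⟨by linarith [hx.1, hy.1], hy.2.le⟩)).2
          linarith)
      have u2 := anti_help (f := fun y => (1-y^2)*deriv ψ y - X*M*y)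
        (f' := fun y => -((χ - c^2*y^2) * ψ y) - X*M) hx.2.le (by fun_prop)
        (fun y _ => by simpa using (h.hp y).fun_sub ((hasDerivAt_id y).const_mul (X*M)))
        (fun y hy => by
          have := (abs_le.1 (hqψ y ⟨by linarith [hx.1, hy.1], hy.2.le⟩)).1
          linarith)
      norm_num at u1 u2
      rw [abs_le]; constructor <;> linarith
    have dn : |(1-x^2)*deriv ψ x| ≤ X*M*(1+x) := by
      have u1 := mono_help (f := fun y => (1-y^2)*deriv ψ y + X*M*y)
        (f' := fun y => -((χ - c^2*y^2) * ψ y) + X*M) hx.1.le (by fun_prop)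
        (fun y _ => by simpa using (h.hp y).fun_add ((hasDerivAt_id y).const_mul (X*M)))
        (fun y hy => by
          have := (abs_le.1 (hqψ y ⟨hy.1.le, by linarith [hx.2, hy.2]⟩)).2
          linarith)
      have u2 := anti_help (f := fun y => (1-y^2)*deriv ψ y - X*M*y)
        (f' := fun y => -((χ - c^2*y^2) * ψ y) - X*M) hx.1.le (by fun_prop)
        (fun y _ => by simpa using (h.hp y).fun_sub ((hasDerivAt_id y).const_mul (X*M)))
        (fun y hy => by
          have := (abs_le.1 (hqψ y ⟨hy.1.le, by linarith [hx.2, hy.2]⟩)).1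
          linarith)
      norm_num at u1 u2
      rw [abs_le]; constructor <;> linarith
    rw [abs_mul, abs_of_pos hp] at up dn
    have : (1-x^2) * |deriv ψ x| ≤ (1-x^2) * (X*M) := by
      rcases le_total 0 x with h0 | h0
      · refine up.trans ?_
        have : (1-x) ≤ 1 - x^2 := by nlinarith [hx.2]
        nlinarith
      · refine dn.trans ?_
        have : (1+x) ≤ 1 - x^2 := by nlinarith [hx.1]
        nlinarith
    exact le_of_mul_le_mul_left this hp
  set w := 1/(2*X) with hw
  have hw0 : 0 < w := by positivity
  have hw1 : w ≤ 1/2 := by rw [hw]; apply one_div_le_one_div_of_le <;> linarith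
  have hXw : X*w = 1/2 := by rw [hw]; field_simp
  have hlow : ∀ x ∈ Icc (x0-w) x0, M/2 ≤ |ψ x| := by
    intro x hx
    have hsub : Ioo x x0 ⊆ Ioo (-1) 1 := fun y hy => ⟨by linarith [hx.1, hy.1, hx0.1], by linarith [hy.2, hx0.2]⟩
    have hc := h.cont
    have u1 := mono_help (f := fun y => ψ y + X*M*y) (f' := fun y => deriv ψ y + X*M) hx.2 (by fun_prop)
      (fun y _ => by simpa using (h.hd y).fun_add ((hasDerivAt_id y).const_mul (X*M)))
      (fun y hy => by have := (abs_le.1 (hder y (hsub hy))).1; linarith)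
    have u2 := anti_help (f := fun y => ψ y - X*M*y) (f' := fun y => deriv ψ y - X*M) hx.2 (by fun_prop)
      (fun y _ => by simpa using (h.hd y).fun_sub ((hasDerivAt_id y).const_mul (X*M)))
      (fun y hy => by have := (abs_le.1 (hder y (hsub hy))).2; linarith)
    have h3 : |ψ x0 - ψ x| ≤ X*M*(x0-x) := by rw [abs_le]; constructor <;> linarith
    have h4 : X*M*(x0-x) ≤ M/2 := by
      have : X*M*(x0-x) ≤ X*M*w := mul_le_mul_of_nonneg_left (by linarith [hx.1]) (by positivity)
      have e : X*M*w = M*(X*w) := by ring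
      rw [e, hXw] at this
      linarith
    have := abs_sub_abs_le_abs_sub (ψ x0) (ψ x)
    linarith
  have hint : (M/2)^2 * w ≤ ∫ t in (-1:ℝ)..1, (ψ t)^2 := by
    have hc := h.cont
    have h1 : ∫ t in (x0-w)..x0, (M/2)^2 ≤ ∫ t in (x0-w)..x0, (ψ t)^2 := by
      apply intervalIntegral.integral_mono_on (by linarith) (by simp) (by apply Continuous.intervalIntegrable; fun_prop)
      intro x hx
      rw [← sq_abs (ψ x)]
      exact pow_le_pow_left₀ (by positivity) (hlow x hx) 2
    have h2 : ∫ t in (x0-w)..x0, (ψ t)^2 ≤ ∫ t in (-1:ℝ)..1, (ψ t)^2 := by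
      apply intervalIntegral.integral_mono_interval (by linarith [hx0.1]) (by linarith) hx0.2
      · filter_upwards with x using sq_nonneg _
      · apply Continuous.intervalIntegrable; fun_prop
    simp at h1
    refine le_trans ?_ h2
    linarith
  rw [hnorm] at hint
  have : (ψ x0)^2 = M^2 := by rw [hM, sq_abs]
  rw [this]
  have e : M^2 = 8*X*((M/2)^2*w) := by
    have : 8*X*((M/2)^2*w) = 2*M^2*(X*w) := by ring
    rw [this, hXw]; ring
  rw [e]
  nlinarith

theorem sup_bound (h : ProlSol c χ ψ) (hnorm : ∫ t in (-1:ℝ)..1, (ψ t)^2 = 1) {X : ℝ} (hX : 1 ≤ X)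
    (hq : ∀ x ∈ Icc (-1:ℝ) 1, |χ - c^2*x^2| ≤ X) : ∀ x ∈ Icc (-1:ℝ) 1, (ψ x)^2 ≤ 8*X := by
  have hc := h.cont
  obtain ⟨x0, hx0, hmax⟩ := isCompact_Icc.exists_isMaxOn (nonempty_Icc.2 (show (-1:ℝ) ≤ 1 by norm_num))
    (by fun_prop : ContinuousOn (fun x => |ψ x|) (Icc (-1) 1))
  have hmax' : ∀ x ∈ Icc (-1:ℝ) 1, |ψ x| ≤ |ψ x0| := fun x hx => hmax hx
  have key : (ψ x0)^2 ≤ 8*X := by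
    rcases le_total 0 x0 with h0 | h0
    · exact h.sup_aux hnorm hX hq ⟨h0, hx0.2⟩ hmax'
    · have := h.reflect.sup_aux (x0 := -x0) (X := X) (by
        have := intervalIntegral.integral_comp_neg (a := -1) (b := 1) (fun x => (ψ x)^2)
        rw [neg_neg, hnorm] at this
        exact this) hX hq ⟨by linarith, by linarith [hx0.1]⟩ (fun x hx => by
          simpa using hmax' (-x) ⟨by linarith [hx.2], by linarith [hx.1]⟩)
      simpa using this
  intro x hx
  refine le_trans ?_ key
  rw [← sq_abs (ψ x), ← sq_abs (ψ x0)]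
  exact pow_le_pow_left₀ (abs_nonneg _) (hmax' x hx) 2

theorem abs_symm (h : ProlSol c χ ψ) (x : ℝ) : (ψ (-x))^2 = (ψ x)^2 := by
  rcases h.parity with hp | hp <;> rw [hp x]; ring

theorem deriv_symm (h : ProlSol c χ ψ) (x : ℝ) : (deriv ψ (-x))^2 = (deriv ψ x)^2 := by
  have e := (h.refl_deriv x).deriv
  rcases h.parity with hp | hp
  · have : (fun x => ψ (-x)) = ψ := funext hp
    rw [this] at e; rw [e]; ring
  · have : (fun x => ψ (-x)) = fun x => - ψ x := funext hp
    rw [this, (h.hd x).fun_neg.deriv] at e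
    have : deriv ψ (-x) = deriv ψ x := by linarith
    rw [this]

theorem E1_mono (h : ProlSol c χ ψ) {R : ℝ} (hc : 0 < c) (hR : 1 < R) (hχ : χ = c^2*R^2) {x y : ℝ}
    (hx : 0 ≤ x) (hxy : x ≤ y) (hy : y ≤ 1) :
    (ψ x)^2 + (1-x^2)*(deriv ψ x)^2/(χ-c^2*x^2) ≤ (ψ y)^2 + (1-y^2)*(deriv ψ y)^2/(χ-c^2*y^2) := by
  have hq : ∀ z ∈ Icc x y, 0 < χ - c^2*z^2 := fun z hz => by
    rw [hχ, ← mul_sub]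
    have : z^2 ≤ 1 := by nlinarith [hz.1, hz.2]
    have : 0 < R^2 - z^2 := by nlinarith
    positivity
  have hd : ∀ z ∈ Icc x y, HasDerivAt (fun z => (ψ z)^2 + (1-z^2)*(deriv ψ z)^2/(χ-c^2*z^2))
    ((deriv ψ z)^2*(2*z*(χ-c^2*z^2) + 2*c^2*z*(1-z^2))/(χ-c^2*z^2)^2) z := by
    intro z hz
    have hqz := hq z hz
    have d1 : HasDerivAt (fun x => χ - c^2*x^2) (-(c^2*(2*z))) z := by
      simpa using (((hasDerivAt_id z).pow 2).const_mul (c^2)).const_sub χ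
    have e := (((h.hd z).fun_pow 2)).fun_add ((((h.hp z).fun_mul (h.hd2 z))).fun_div d1 hqz.ne')
    have e2 : (fun z => (ψ z)^2 + (1-z^2)*(deriv ψ z)^2/(χ-c^2*z^2)) =
        fun z => (ψ z)^2 + ((1-z^2)*(deriv ψ z) * deriv ψ z)/(χ-c^2*z^2) := by funext; ring
    rw [e2]
    refine e.congr_deriv ?_
    have ho := h.ode z
    have hs : (1 - z^2) * deriv (deriv ψ) z = 2*z*deriv ψ z - (χ - c^2*z^2) * ψ z := by linarith
    rw [show (1 - z^2) * deriv ψ z * deriv (deriv ψ) z = deriv ψ z * ((1 - z^2) * deriv (deriv ψ) z) by ring, hs]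
    generalize (χ-c^2*z^2) = q at *
    norm_num
    field_simp
    ring
  exact mono_help hxy (fun z hz => (hd z hz).continuousAt.continuousWithinAt)
    (fun z hz => hd z (Ioo_subset_Icc_self hz)) (fun z hz => by
      have hz' := Ioo_subset_Icc_self hz
      have := hq z hz'
      have hz0 : 0 ≤ z := hx.trans hz'.1
      have : 0 ≤ 1 - z^2 := by nlinarith [hz'.2]
      positivity)

theorem le_one (h : ProlSol c χ ψ) {R : ℝ} (hc : 0 < c) (hR : 1 < R) (hχ : χ = c^2*R^2) {x : ℝ}
    (hx : x ∈ Icc (-1:ℝ) 1) : (ψ x)^2 ≤ (ψ 1)^2 := by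
  have key : ∀ x ∈ Icc (0:ℝ) 1, (ψ x)^2 ≤ (ψ 1)^2 := by
    intro x hx
    have := h.E1_mono hc hR hχ hx.1 hx.2 le_rfl
    norm_num at this
    refine le_trans ?_ this
    have hq : 0 < χ - c^2*x^2 := by
      rw [hχ, ← mul_sub]
      have : x^2 ≤ 1 := by nlinarith [hx.1, hx.2]
      have : 0 < R^2 - x^2 := by nlinarith
      positivity
    have : 0 ≤ (1-x^2)*(deriv ψ x)^2/(χ-c^2*x^2) := by
      have : 0 ≤ 1 - x^2 := by nlinarith [hx.1, hx.2]
      positivity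
    linarith
  rcases le_total 0 x with h0 | h0
  · exact key x ⟨h0, hx.2⟩
  · rw [← h.abs_symm]; exact key (-x) ⟨by linarith, by linarith [hx.1]⟩

theorem one_ge (h : ProlSol c χ ψ) {R : ℝ} (hc : 0 < c) (hR : 1 < R) (hχ : χ = c^2*R^2)
    (hnorm : ∫ t in (-1:ℝ)..1, (ψ t)^2 = 1) : 1/2 ≤ (ψ 1)^2 := by
  have hcont := h.cont
  have : ∫ t in (-1:ℝ)..1, (ψ t)^2 ≤ ∫ t in (-1:ℝ)..1, (ψ 1)^2 := by
    apply intervalIntegral.integral_mono_on (by norm_num) (by apply Continuous.intervalIntegrable; fun_prop) (by simp)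
    intro x hx; exact h.le_one hc hR hχ hx
  rw [hnorm] at this
  norm_num at this
  linarith

theorem deriv_zero_ge (h : ProlSol c χ ψ) {R : ℝ} (hc : 0 < c) (hR : 1 < R) (hχ : χ = c^2*R^2) {x : ℝ}
    (hx : x ∈ Ioo (-1:ℝ) 1) (h0 : ψ x = 0) : χ * (ψ 0)^2 ≤ (deriv ψ x)^2 := by
  have key : ∀ x ∈ Ico (0:ℝ) 1, ψ x = 0 → χ * (ψ 0)^2 ≤ (deriv ψ x)^2 := by
    intro x hx hx0
    have := h.E1_mono hc hR hχ le_rfl hx.1 hx.2.le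
    rw [hx0] at this
    have hq : 0 < χ - c^2*x^2 := by
      rw [hχ, ← mul_sub]
      have : x^2 ≤ 1 := by nlinarith [hx.1, hx.2]
      have : 0 < R^2 - x^2 := by nlinarith
      positivity
    have hp : 0 < 1 - x^2 := by nlinarith [hx.1, hx.2]
    have hχ0 : 0 < χ := by rw [hχ]; positivity
    norm_num at this
    have h3 : 0 ≤ (deriv ψ 0)^2/χ := by positivity
    have h4 : (ψ 0)^2 ≤ (1-x^2)*(deriv ψ x)^2/(χ-c^2*x^2) := by linarith
    rw [le_div_iff₀ hq] at h4
    have h5 : χ*(1-x^2) ≤ χ - c^2*x^2 := by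
      have : c^2*x^2*1 ≤ c^2*x^2*R^2 := mul_le_mul_of_nonneg_left (by nlinarith) (by positivity)
      rw [hχ]; linarith
    have h6 : (1-x^2) * (χ * (ψ 0)^2) ≤ (1-x^2)*(deriv ψ x)^2 := by
      refine le_trans ?_ h4
      have := mul_le_mul_of_nonneg_left h5 (sq_nonneg (ψ 0))
      linarith
    exact le_of_mul_le_mul_left h6 hp
  rcases le_total 0 x with h1 | h1
  · exact key x ⟨h1, hx.2⟩ h0
  · rw [← h.deriv_symm]
    apply key (-x) ⟨by linarith, by linarith [hx.1]⟩
    have := h.abs_symm x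
    rw [h0] at this
    simpa using this

theorem psi0_ge (h : ProlSol c χ ψ) {R : ℝ} (hc : 0 < c) (hR : 1 < R) (hχ : χ = c^2*R^2)
    (hnorm : ∫ t in (-1:ℝ)..1, (ψ t)^2 = 1) (hev : ∀ x, ψ (-x) = ψ x) :
    (R^2-1)/(4*R^2) ≤ (ψ 0)^2 := by
  by_contra hcon
  push Not at hcon
  have hR0 : 0 < R := by linarith
  have hψ4 : (ψ 0)^2 < 1/4 := by
    refine hcon.trans ?_
    rw [div_lt_div_iff₀ (by positivity) (by norm_num)]
    linarith
  have hcont := h.cont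
  have hcont' := h.cont'
  have hd0 : deriv ψ 0 = 0 := by
    have e := (h.refl_deriv 0).deriv
    have : (fun x => ψ (-x)) = ψ := funext hev
    rw [this] at e
    norm_num at e
    linarith
  have hE2 : ∀ z, HasDerivAt (fun z => ((1-z^2)*deriv ψ z)^2 + (1-z^2)*(χ-c^2*z^2)*(ψ z)^2)
      (-(2*z*((χ-c^2*z^2)+c^2*(1-z^2))*(ψ z)^2)) z := by
    intro z
    have d1 : HasDerivAt (fun x => χ - c^2*x^2) (-(c^2*(2*z))) z := by
      simpa using (((hasDerivAt_id z).pow 2).const_mul (c^2)).const_sub χ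
    have d0 : HasDerivAt (fun x : ℝ => 1 - x^2) (-(2*z)) z := by
      simpa using ((hasDerivAt_id z).pow 2).const_sub 1
    refine (((h.hp z).fun_pow 2).fun_add ((d0.fun_mul d1).fun_mul ((h.hd z).fun_pow 2))).congr_deriv ?_
    norm_num
    ring
  have hqlow : ∀ z ∈ Icc (0:ℝ) 1, c^2*(R^2-1) ≤ χ - c^2*z^2 := fun z hz => by
    have : z^2 ≤ 1 := by nlinarith [hz.1, hz.2]
    rw [hχ]; nlinarith [mul_le_mul_of_nonneg_left this (sq_nonneg c)]
  have hcR : 0 < c^2*(R^2-1) := by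
    have : 0 < R^2-1 := by nlinarith
    positivity
  have hχ0 : 0 < χ := by rw [hχ]; positivity
  have hI := intervalIntegral.integral_eq_sub_of_hasDerivAt (a := 0) (b := 1) (fun z _ => hE2 z) (by
    apply Continuous.intervalIntegrable; fun_prop)
  norm_num [hd0] at hI
  -- bound near zero
  have hnear : ∀ z ∈ Icc (0:ℝ) (1/2), (ψ z)^2 ≤ 0.4445 := by
    intro z hz
    have hz1 : z ∈ Icc (0:ℝ) 1 := ⟨hz.1, by linarith [hz.2]⟩
    have := anti_help (f' := fun z => (-(2*z*((χ-c^2*z^2)+c^2*(1-z^2))*(ψ z)^2))) hz.1 (by fun_prop)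
      (fun y _ => hE2 y) (fun y hy => by
        have hy1 : y ∈ Icc (0:ℝ) 1 := ⟨hy.1.le, by linarith [hy.2, hz.2]⟩
        have := hqlow y hy1
        have h3 : 0 ≤ 1 - y^2 := by nlinarith [hy1.1, hy1.2]
        have h4 : 0 ≤ (χ-c^2*y^2)+c^2*(1-y^2) := by
          have : 0 ≤ c^2*(1-y^2) := by positivity
          linarith
        have := mul_nonneg (mul_nonneg (mul_nonneg (by norm_num : (0:ℝ) ≤ 2) hy1.1) h4) (sq_nonneg (ψ y))
        linarith)
    norm_num [hd0] at this
    have hz2 : z^2 ≤ 1/4 := by nlinarith [hz.1, hz.2]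
    have h5 : χ*(3/4) ≤ χ - c^2*z^2 := by
      have h6 : c^2*z^2*1 ≤ c^2*z^2*R^2 := mul_le_mul_of_nonneg_left (by nlinarith) (by positivity)
      have h7 : c^2*R^2*z^2 ≤ c^2*R^2*(1/4) := mul_le_mul_of_nonneg_left hz2 (by positivity)
      rw [hχ]; linarith
    have h8 : (3/4)*(χ*(3/4)) ≤ (1-z^2)*(χ-c^2*z^2) :=
      mul_le_mul (by linarith) h5 (by positivity) (by linarith)
    have h9 : (3/4)*(χ*(3/4))*(ψ z)^2 ≤ χ*(ψ 0)^2 := by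
      have := mul_le_mul_of_nonneg_right h8 (sq_nonneg (ψ z))
      have := sq_nonneg ((1-z^2)*deriv ψ z)
      linarith
    have h10 : χ * ((9/16)*(ψ z)^2) ≤ χ * (1/4) := by
      have : χ*(ψ 0)^2 ≤ χ*(1/4) := mul_le_mul_of_nonneg_left hψ4.le hχ0.le
      linarith
    have h11 := le_of_mul_le_mul_left h10 hχ0
    norm_num
    linarith
  have hhalf : ∫ z in (0:ℝ)..1, (ψ z)^2 = 1/2 := by
    have h1 : ∫ z in (-1:ℝ)..0, (ψ z)^2 = ∫ z in (0:ℝ)..1, (ψ z)^2 := by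
      have := intervalIntegral.integral_comp_neg (a := 0) (b := 1) (fun x => (ψ x)^2)
      simp only [hev] at this
      simpa using this.symm
    have h2 := intervalIntegral.integral_add_adjacent_intervals (a := (-1:ℝ)) (b := 0) (c := 1) (f := fun z => (ψ z)^2)
      (μ := volume) (by apply Continuous.intervalIntegrable; fun_prop) (by apply Continuous.intervalIntegrable; fun_prop)
    rw [h1, hnorm] at h2
    linarith
  have hsplit := intervalIntegral.integral_add_adjacent_intervals (a := (0:ℝ)) (b := 1/2) (c := 1) (f := fun z => (ψ z)^2)
      (μ := volume) (by apply Continuous.intervalIntegrable; fun_prop) (by apply Continuous.intervalIntegrable; fun_prop)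
  have hn2 : ∫ z in (0:ℝ)..(1/2), (ψ z)^2 ≤ ∫ z in (0:ℝ)..(1/2), (0.4445:ℝ) := by
    apply intervalIntegral.integral_mono_on (by norm_num) (by apply Continuous.intervalIntegrable; fun_prop) (by simp)
    exact hnear
  rw [hhalf] at hsplit
  norm_num at hn2
  have hout : (1/4:ℝ) ≤ ∫ z in (1/2:ℝ)..1, (ψ z)^2 := by linarith
  have hfinal : c^2*(R^2-1) * ∫ z in (1/2:ℝ)..1, (ψ z)^2 ≤ ∫ z in (0:ℝ)..1, 2*z*((χ-c^2*z^2)+c^2*(1-z^2))*(ψ z)^2 := by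
    have h2 := intervalIntegral.integral_add_adjacent_intervals (a := (0:ℝ)) (b := 1/2) (c := 1)
      (f := fun z => 2*z*((χ-c^2*z^2)+c^2*(1-z^2))*(ψ z)^2)
      (μ := volume) (by apply Continuous.intervalIntegrable; fun_prop) (by apply Continuous.intervalIntegrable; fun_prop)
    rw [← h2, ← intervalIntegral.integral_const_mul]
    have hge : ∀ z ∈ Icc (0:ℝ) 1, c^2*(R^2-1) ≤ (χ-c^2*z^2)+c^2*(1-z^2) := fun z hz => by
      have := hqlow z hz
      have h3 : 0 ≤ 1 - z^2 := by nlinarith [hz.1, hz.2]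
      have : 0 ≤ c^2*(1-z^2) := by positivity
      linarith
    have h3 : 0 ≤ ∫ z in (0:ℝ)..(1/2), 2*z*((χ-c^2*z^2)+c^2*(1-z^2))*(ψ z)^2 := by
      apply intervalIntegral.integral_nonneg (by norm_num)
      intro z hz
      have := hge z ⟨hz.1, by linarith [hz.2]⟩
      exact mul_nonneg (mul_nonneg (by linarith [hz.1]) (by linarith)) (sq_nonneg _)
    have h4 : ∫ z in (1/2:ℝ)..1, c^2*(R^2-1)*(ψ z)^2 ≤ ∫ z in (1/2:ℝ)..1, 2*z*((χ-c^2*z^2)+c^2*(1-z^2))*(ψ z)^2 := by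
      apply intervalIntegral.integral_mono_on (by norm_num) (by apply Continuous.intervalIntegrable; fun_prop)
        (by apply Continuous.intervalIntegrable; fun_prop)
      intro z hz
      apply mul_le_mul_of_nonneg_right _ (sq_nonneg _)
      have := hge z ⟨by linarith [hz.1], hz.2⟩
      nlinarith [hz.1]
    linarith
  have h12 : χ*(ψ 0)^2 < χ * ((R^2-1)/(4*R^2)) := mul_lt_mul_of_pos_left hcon hχ0
  have h13 : χ * ((R^2-1)/(4*R^2)) = c^2*(R^2-1)/4 := by rw [hχ]; field_simp
  have h14 := mul_le_mul_of_nonneg_left hout hcR.le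
  rw [h13] at h12
  linarith

end ProlSol
end

section
theorem Lam_deriv {u : ℝ} (h1 : -1 < u) (h2 : u < 1) :
    HasDerivAt (fun u => 1/2 * (u * √(1-u^2) + arcsin u)) (√(1-u^2)) u := by
  have hp : 0 < 1 - u^2 := by nlinarith
  have d0 : HasDerivAt (fun x : ℝ => 1 - x^2) (-(2*u)) u := by
    simpa using ((hasDerivAt_id u).pow 2).const_sub 1
  have := (((hasDerivAt_id u).fun_mul (d0.sqrt hp.ne')).fun_add (hasDerivAt_arcsin h1.ne' h2.ne)).const_mul (1/2)
  refine this.congr_deriv ?_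
  have hs := sqrt_pos.2 hp
  have hs2 : u^2 = 1 - √(1-u^2)^2 := by rw [sq_sqrt hp.le]; ring
  generalize √(1-u^2) = s at *
  simp only [id]
  field_simp
  rw [hs2]; ring

theorem Lam_le {u : ℝ} (h1 : 0 ≤ u) (h2 : u ≤ 1) : 1/2 * (u * √(1-u^2) + arcsin u) ≤ u := by
  have := mono_help (f := fun u => u - 1/2 * (u * √(1-u^2) + arcsin u)) (f' := fun u => 1 - √(1-u^2)) h1
    (by fun_prop) (fun x hx => (hasDerivAt_id x).fun_sub (Lam_deriv (by linarith [hx.1]) (by linarith [hx.2])))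
    (fun x hx => by
      have : √(1-x^2) ≤ 1 := Real.sqrt_le_iff.2 ⟨by norm_num, by nlinarith [sq_nonneg x]⟩
      linarith)
  norm_num at this
  linarith

namespace ProlSol
variable {c χ : ℝ} {ψ φ : ℝ → ℝ}

theorem hP (h : ProlSol c χ ψ) (x : ℝ) :
    HasDerivAt (fun x => (x^2-1) * deriv ψ x) ((χ - c^2*x^2) * ψ x) x := by
  have := (h.hp x).fun_neg
  have e : (fun x => (x^2-1) * deriv ψ x) = fun x => -((1-x^2) * deriv ψ x) := by funext; ring
  rw [e]
  simpa using this

theorem barrier_pos (h : ProlSol c χ ψ) {R : ℝ} (hR : 1 < R) (hχ : χ = c^2*R^2) (h1 : 0 < ψ 1) :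
    ∀ x ∈ Icc 1 R, ψ 1 ≤ ψ x ∧ 0 ≤ (x^2-1) * deriv ψ x := by
  have hcont := h.cont
  have hcont' := h.cont'
  have step : ∀ z ∈ Icc 1 R, (∀ x ∈ Ico 1 z, 0 < ψ x) → ψ 1 ≤ ψ z ∧ 0 ≤ (z^2-1) * deriv ψ z := by
    intro z hz hpos
    have hder : ∀ y ∈ Icc 1 z, 0 ≤ (y^2-1) * deriv ψ y := by
      intro y hy
      have := mono_help (f := fun x => (x^2-1) * deriv ψ x) hy.1 (by fun_prop) (fun x _ => h.hP x) (fun x hx => by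
        apply mul_nonneg _ (hpos x ⟨hx.1.le, lt_of_lt_of_le hx.2 hy.2⟩).le
        rw [hχ, ← mul_sub]
        have : x < R := lt_of_lt_of_le hx.2 (hy.2.trans hz.2)
        exact mul_nonneg (sq_nonneg c) (by nlinarith [hx.1]))
      norm_num at this
      exact this
    refine ⟨mono_help hz.1 hcont.continuousOn (fun x _ => h.hd x) (fun x hx => ?_), hder z ⟨hz.1, le_rfl⟩⟩
    have := hder x (Ioo_subset_Icc_self hx)
    exact nonneg_of_mul_nonneg_right this (by nlinarith [hx.1])
  have hall : ∀ x ∈ Icc 1 R, 0 < ψ x := by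
    by_contra hcon
    push Not at hcon
    obtain ⟨x, hx, hx0⟩ := hcon
    have hne : (Icc 1 R ∩ ψ ⁻¹' (Iic 0)).Nonempty := ⟨x, hx, hx0⟩
    have hcomp : IsCompact (Icc 1 R ∩ ψ ⁻¹' (Iic 0)) := isCompact_Icc.inter_right (isClosed_Iic.preimage hcont)
    obtain ⟨z, hz, hmin⟩ := hcomp.exists_isLeast hne
    have := (step z hz.1 (fun y hy => by
      by_contra hy0
      push Not at hy0
      have := hmin ⟨⟨hy.1, hy.2.le.trans hz.1.2⟩, hy0⟩
      linarith [hy.2])).1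
    have h3 : ψ z ≤ 0 := hz.2
    linarith
  intro x hx
  exact step x hx (fun y hy => hall y ⟨hy.1, hy.2.le.trans hx.2⟩)

theorem barrier_deriv (h : ProlSol c χ ψ) {R : ℝ} (hR : 1 < R) (hχ : χ = c^2*R^2) (h1 : 0 < ψ 1) :
    ∀ x ∈ Icc 1 R, 0 ≤ deriv ψ x := by
  have key : ∀ x ∈ Ioc 1 R, 0 ≤ deriv ψ x := fun x hx =>
    nonneg_of_mul_nonneg_right (h.barrier_pos hR hχ h1 x ⟨hx.1.le, hx.2⟩).2 (by nlinarith [hx.1])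
  intro x hx
  rcases hx.1.eq_or_lt with h2 | h2
  · rw [← h2]
    have := (h.cont'.tendsto 1).mono_left (nhdsWithin_le_nhds (s := Ioi 1))
    refine ge_of_tendsto this ?_
    filter_upwards [Ioo_mem_nhdsGT hR] with y hy
    exact key y ⟨hy.1, hy.2.le⟩
  · exact key x ⟨h2, hx.2⟩

theorem N_deriv (h : ProlSol c χ ψ) (x : ℝ) :
    HasDerivAt (fun x => x * ψ x + (x^2-1) * deriv ψ x) (ψ x + x * deriv ψ x + (χ - c^2*x^2)*ψ x) x := by
  refine (((hasDerivAt_id x).fun_mul (h.hd x)).fun_add (h.hP x)).congr_deriv ?_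
  simp

theorem D_mono (h : ProlSol c χ ψ) {R : ℝ} (hR : 1 < R) (hχ : χ = c^2*R^2) (h1 : 0 < ψ 1)
    {x : ℝ} (hx : x ∈ Icc 1 R) :
    (χ - c^2*x^2)*(x^2-1)*(ψ x)^2 ≤ (x * ψ x + (x^2-1) * deriv ψ x)^2 := by
  have hcont := h.cont
  have hcont' := h.cont'
  have := mono_help (f := fun x => (x * ψ x + (x^2-1) * deriv ψ x)^2 - (χ - c^2*x^2)*(x^2-1)*(ψ x)^2)
    (f' := fun x => 2*x*(ψ x)^2 + 2*x^2*ψ x*deriv ψ x + 2*(x^2-1)*ψ x*deriv ψ x + 2*x*(x^2-1)*(deriv ψ x)^2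
      + 2*c^2*x*(x^2-1)*(ψ x)^2) hx.1 (by fun_prop) (fun z _ => by
      have d1 : HasDerivAt (fun x => χ - c^2*x^2) (-(c^2*(2*z))) z := by
        simpa using (((hasDerivAt_id z).pow 2).const_mul (c^2)).const_sub χ
      have d0 : HasDerivAt (fun x : ℝ => x^2-1) (2*z) z := by
        simpa using ((hasDerivAt_id z).pow 2).sub_const 1
      refine (((h.N_deriv z).fun_pow 2).fun_sub ((d1.fun_mul d0).fun_mul ((h.hd z).fun_pow 2))).congr_deriv ?_
      norm_num
      ring) (fun z hz => by
      have hz' : z ∈ Icc 1 R := ⟨hz.1.le, hz.2.le.trans hx.2⟩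
      have p1 : 0 ≤ ψ z := h1.le.trans (h.barrier_pos hR hχ h1 z hz').1
      have p2 := h.barrier_deriv hR hχ h1 z hz'
      have p3 : 0 ≤ z^2-1 := by nlinarith [hz.1]
      have p4 : 0 ≤ z := by linarith [hz.1]
      positivity)
  norm_num at this
  have := sq_nonneg (ψ 1)
  linarith

theorem growth (h : ProlSol c χ ψ) {R : ℝ} (hc : 0 < c) (hR : 1 < R) (hχ : χ = c^2*R^2) (h1 : 0 < ψ 1)
    {g : ℝ} (hg : g = c*(R-1/R)) (hg1 : 1 < g) :
    ψ 1 * exp (π*g/4 - 1) / g ≤ ψ R := by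
  have hR0 : 0 < R := by linarith
  set δ := R^2 - 1 with hδ
  have hδ0 : 0 < δ := by rw [hδ]; nlinarith
  have hgR : g * R = c * δ := by rw [hg, hδ]; field_simp
  have hg0 : 0 < g := by linarith
  set x1 := √(1 + δ/g^2) with hx1
  have hx1s : x1^2 = 1 + δ/g^2 := sq_sqrt (by positivity)
  have hx1p : 0 ≤ x1 := sqrt_nonneg _
  have hdg : 0 < δ/g^2 := by positivity
  have hx11 : 1 < x1 := by nlinarith
  have hx1R : x1 ≤ R := by
    have : δ/g^2 ≤ δ := div_le_self hδ0.le (by nlinarith)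
    apply (sq_le_sq₀ hx1p hR0.le).1
    rw [hx1s]; linarith
  set u : ℝ → ℝ := fun x => √((x^2-1)/δ) with hu
  have hposψ : ∀ x ∈ Icc x1 R, 0 < ψ x := fun x hx =>
    lt_of_lt_of_le h1 (h.barrier_pos hR hχ h1 x ⟨hx11.le.trans hx.1, hx.2⟩).1
  have hPpos : ∀ x ∈ Icc x1 R, 0 < x^2 - 1 := fun x hx => by nlinarith [hx.1]
  have hcont := h.cont
  have key := mono_help (f := fun x => 1/2 * log (x^2-1) + log (ψ x) - g * (1/2 * (u x * √(1-(u x)^2) + arcsin (u x))))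
    (f' := fun x => 1/2 * (2*x/(x^2-1)) + deriv ψ x / ψ x - g * (√(1-(u x)^2) * (2*x/δ/(2*u x)))) hx1R
    (by
      have c1 : ContinuousOn (fun x : ℝ => log (x^2-1)) (Icc x1 R) :=
        ContinuousOn.log (by fun_prop) (fun x hx => (hPpos x hx).ne')
      have c2 : ContinuousOn (fun x : ℝ => log (ψ x)) (Icc x1 R) :=
        ContinuousOn.log (by fun_prop) (fun x hx => (hposψ x hx).ne')
      have c3 : Continuous u := by rw [hu]; fun_prop
      have c4 : Continuous (fun x => g * (1/2 * (u x * √(1-(u x)^2) + arcsin (u x)))) := by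
        have : Continuous (fun u => g * (1/2 * (u * √(1-u^2) + arcsin u))) := by fun_prop
        exact this.comp c3
      exact ((c1.const_smul (1/2:ℝ)).add c2).sub c4.continuousOn) ?_ ?_
  · have uR : u R = 1 := by simp [hu, ← hδ, hδ0.ne']
    have ux1 : u x1 = 1/g := by
      simp only [hu, hx1s]
      rw [show (1 + δ/g^2 - 1)/δ = (1/g)^2 by field_simp; ring]
      exact sqrt_sq (by positivity)
    simp only [uR, ux1] at key
    have hL := Lam_le (u := 1/g) (by positivity) (by rw [div_le_one hg0]; linarith)
    have hL2 := mul_le_mul_of_nonneg_left hL hg0.le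
    rw [mul_one_div_cancel hg0.ne'] at hL2
    rw [hx1s, ← hδ] at key
    norm_num at key hL2
    have hψx1 := (h.barrier_pos hR hχ h1 x1 ⟨hx11.le, hx1R⟩).1
    have hl1 := log_le_log h1 hψx1
    have hlog : log (δ/g^2) = log δ - 2 * log g := by
      rw [log_div hδ0.ne' (by positivity), log_pow]; norm_num
    rw [hlog] at key
    have hfin : log (ψ 1 * exp (π*g/4 - 1) / g) ≤ log (ψ R) := by
      rw [log_div (by positivity) hg0.ne', log_mul h1.ne' (exp_pos _).ne', log_exp]
      linarith
    exact (log_le_log_iff (by positivity) (hposψ R ⟨hx1R, le_rfl⟩)).1 hfin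
  · intro x hx
    have hx' := Ioo_subset_Icc_self hx
    have hP := hPpos x hx'
    have d0 : HasDerivAt (fun x : ℝ => x^2-1) (2*x) x := by
      simpa using ((hasDerivAt_id x).pow 2).sub_const 1
    have du : HasDerivAt u (2*x/δ/(2*u x)) x := (d0.div_const δ).sqrt (by positivity)
    have hu1 : u x < 1 := by
      simp only [hu]
      rw [sqrt_lt' one_pos, one_pow, div_lt_one hδ0]
      nlinarith [hx.1, hx.2]
    have hu0 : 0 ≤ u x := sqrt_nonneg _
    have dL := (Lam_deriv (by linarith) hu1).comp x du
    exact (((d0.log hP.ne').const_mul (1/2)).fun_add ((h.hd x).log (hposψ x hx').ne')).fun_sub (dL.const_mul g)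
  · intro x hx
    have hx' := Ioo_subset_Icc_self hx
    have hP := hPpos x hx'
    have hψ := hposψ x hx'
    have hx1 : 1 < x := hx11.trans hx.1
    have hD := h.D_mono hR hχ h1 (x := x) ⟨hx1.le, hx.2.le⟩
    have hder := h.barrier_deriv hR hχ h1 x ⟨hx1.le, hx.2.le⟩
    have hu0 : 0 < u x := sqrt_pos.2 (by positivity)
    have hus : (u x)^2 = (x^2-1)/δ := sq_sqrt (by positivity)
    have hus' : x^2-1 = δ*(u x)^2 := by rw [hus]; field_simp
    set s := √(1-(u x)^2) with hs
    have hs0 : 0 ≤ s := sqrt_nonneg _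
    have hu1 : (u x)^2 ≤ 1 := by
      rw [hus, div_le_one hδ0]; nlinarith [hx.2]
    have hss : s^2 = 1 - (u x)^2 := sq_sqrt (by linarith)
    -- N ≥ c δ u s ψ
    have hN : c*δ*u x*s*ψ x ≤ x * ψ x + (x^2-1) * deriv ψ x := by
      apply (sq_le_sq₀ (by positivity) (by positivity)).1
      refine le_trans (le_of_eq ?_) hD
      have : χ - c^2*x^2 = c^2*δ*s^2 := by
        rw [hss, hχ]
        have : R^2 = δ + 1 := by rw [hδ]; ring
        have h5 : x^2 = 1 + δ*(u x)^2 := by linarith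
        rw [this, h5]; ring
      rw [this, hus']; ring
    have e1 : 1/2 * (2*x/(x^2-1)) + deriv ψ x / ψ x = (x * ψ x + (x^2-1) * deriv ψ x)/((x^2-1)*ψ x) := by
      field_simp
    rw [e1, sub_nonneg, le_div_iff₀ (by positivity)]
    refine le_trans ?_ hN
    rw [hus']
    have e2 : g * (s * (2*x/δ/(2*u x))) * (δ * u x^2 * ψ x) = (g*x)*(u x*s*ψ x) := by
      field_simp
    have e3 : c*δ*u x*s*ψ x = (g*R)*(u x*s*ψ x) := by rw [hgR]; ring
    rw [e2, e3]
    apply mul_le_mul_of_nonneg_right _ (by positivity)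
    exact mul_le_mul_of_nonneg_left hx.2.le hg0.le

/-- ratio bound across the barrier -/
theorem ratio_bound {χ' : ℝ} (h : ProlSol c χ ψ) (k : ProlSol c χ' φ) {R : ℝ} (hR : 1 < R)
    (hχ : χ = c^2*R^2) (h1 : 0 < ψ 1) (hlt : χ' < χ) :
    (φ R / ψ R)^2 + (R^2-1)*((deriv φ R * ψ R - φ R * deriv ψ R)/(ψ R)^2)^2/(χ-χ') ≤ (φ 1 / ψ 1)^2 := by
  have hΔ : 0 < χ - χ' := by linarith
  have hψ : ∀ x ∈ Icc 1 R, 0 < ψ x := fun x hx => lt_of_lt_of_le h1 (h.barrier_pos hR hχ h1 x hx).1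
  have hd : ∀ x ∈ Icc 1 R, HasDerivAt
    (fun x => (φ x / ψ x)^2 + (x^2-1)*((deriv φ x * ψ x - φ x * deriv ψ x)/(ψ x)^2)^2/(χ-χ'))
    (((-(2*x) - 4*(x^2-1)*(deriv ψ x/ψ x)) * ((deriv φ x * ψ x - φ x * deriv ψ x)/(ψ x)^2)^2)/(χ-χ')) x := by
    intro x hx
    have hp := (hψ x hx).ne'
    have d0 : HasDerivAt (fun x : ℝ => x^2-1) (2*x) x := by
      simpa using ((hasDerivAt_id x).pow 2).sub_const 1
    have dr := (k.hd x).fun_div (h.hd x) hp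
    have dr' := (((k.hd2 x).fun_mul (h.hd x)).fun_sub ((k.hd x).fun_mul (h.hd2 x))).fun_div ((h.hd x).fun_pow 2)
      (pow_ne_zero 2 hp)
    have e := (dr.fun_pow 2).fun_add (((d0.fun_mul (dr'.fun_pow 2))).div_const (χ-χ'))
    refine e.congr_deriv ?_
    have o1 := h.ode x
    have o2 := k.ode x
    have o1' : (x^2-1) * deriv (deriv ψ) x = (χ - c^2*x^2)*ψ x - 2*x*deriv ψ x := by linarith
    have o2' : (x^2-1) * deriv (deriv φ) x = (χ' - c^2*x^2)*φ x - 2*x*deriv φ x := by linarith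
    norm_num
    generalize deriv (deriv ψ) x = p2 at *
    generalize deriv (deriv φ) x = f2 at *
    generalize deriv ψ x = p1 at *
    generalize deriv φ x = f1 at *
    generalize ψ x = p at *
    generalize φ x = f at *
    have hΔ' := hΔ.ne'
    rw [← sub_eq_zero]
    have : ∀ A B : ℝ, (x^2-1)*p2 = A → (x^2-1)*f2 = B →
      2 * (f / p) * ((f1 * p - f * p1) / p ^ 2) +
      (2 * x * ((f1 * p - f * p1) / p ^ 2) ^ 2 +
          (x ^ 2 - 1) *
            (2 * ((f1 * p - f * p1) / p ^ 2) *
              (((f2 * p + f1 * p1 - (f1 * p1 + f * p2)) * p ^ 2 - (f1 * p - f * p1) * (2 * p * p1)) / (p ^ 2) ^ 2))) /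
        (χ - χ') = 2 * (f / p) * ((f1 * p - f * p1) / p ^ 2) +
      (2 * x * ((f1 * p - f * p1) / p ^ 2) ^ 2 +
            (2 * ((f1 * p - f * p1) / p ^ 2) *
              (((B * p - f * A) * p ^ 2 - (x^2-1) * ((f1 * p - f * p1) * (2 * p * p1))) / (p ^ 2) ^ 2))) /
        (χ - χ') := by
      rintro A B rfl rfl
      ring
    rw [this _ _ o1' o2']
    field_simp
    ring
  have := anti_help hR.le (fun x hx => (hd x hx).continuousAt.continuousWithinAt)
    (fun x hx => hd x (Ioo_subset_Icc_self hx)) (fun x hx => by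
      have hx' := Ioo_subset_Icc_self hx
      have q1 := hψ x hx'
      have q2 := h.barrier_deriv hR hχ h1 x hx'
      have q3 : 0 ≤ x^2-1 := by nlinarith [hx.1]
      have q4 : 0 ≤ 4*(x^2-1)*(deriv ψ x/ψ x) := by positivity
      apply div_nonpos_of_nonpos_of_nonneg _ hΔ.le
      apply mul_nonpos_of_nonpos_of_nonneg _ (sq_nonneg _)
      linarith [hx.1])
  norm_num at this
  norm_num
  linarith

theorem Z_deriv (h : ProlSol c χ ψ) {x : ℝ} (hx : 1 < x) :
    HasDerivAt (fun x => ((x * ψ x + (x^2-1) * deriv ψ x)^2 + (ψ x)^2)/(x^2-1) + (c^2*x^2-χ)*(ψ x)^2)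
      (2*x*((χ-c^2)/(x^2-1) - 2/(x^2-1)^2)*(ψ x)^2) x := by
  have hP : 0 < x^2-1 := by nlinarith
  have d0 : HasDerivAt (fun x : ℝ => x^2-1) (2*x) x := by
    simpa using ((hasDerivAt_id x).pow 2).sub_const 1
  have d1 : HasDerivAt (fun x => c^2*x^2 - χ) (c^2*(2*x)) x := by
    simpa using (((hasDerivAt_id x).pow 2).const_mul (c^2)).sub_const χ
  have e := ((((h.N_deriv x).fun_pow 2).fun_add ((h.hd x).fun_pow 2)).fun_div d0 hP.ne').fun_add
    (d1.fun_mul ((h.hd x).fun_pow 2))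
  refine e.congr_deriv ?_
  norm_num
  have hP' := hP.ne'
  field_simp
  ring

theorem Z_mono (h : ProlSol c χ ψ) {R : ℝ} (hc : 0 < c) (hR : 1 < R) (hχ : χ = c^2*R^2)
    (hcd : 2 ≤ c^2*(R^2-1)^2) {t : ℝ} (ht : R ≤ t) :
    ((R * ψ R + (R^2-1) * deriv ψ R)^2 + (ψ R)^2)/(R^2-1) ≤
    ((t * ψ t + (t^2-1) * deriv ψ t)^2 + (ψ t)^2)/(t^2-1) + (c^2*t^2-χ)*(ψ t)^2 := by
  have := mono_help (f := fun x => ((x * ψ x + (x^2-1) * deriv ψ x)^2 + (ψ x)^2)/(x^2-1) + (c^2*x^2-χ)*(ψ x)^2) ht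
    (fun x hx => (h.Z_deriv (by linarith [hx.1])).continuousAt.continuousWithinAt)
    (fun x hx => h.Z_deriv (by linarith [hx.1])) (fun x hx => by
      have hx1 : R < x := hx.1
      have hP : 0 < x^2-1 := by nlinarith
      have hle : R^2-1 ≤ x^2-1 := by nlinarith
      have hR1 : 0 < R^2-1 := by nlinarith
      apply mul_nonneg _ (sq_nonneg _)
      apply mul_nonneg (by linarith)
      rw [sub_nonneg, div_le_div_iff₀ (by positivity) hP]
      have : c^2*(R^2-1)*(R^2-1) ≤ c^2*(R^2-1)*(x^2-1) := mul_le_mul_of_nonneg_left hle (by positivity)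
      have h2 : 2 * (x^2-1) ≤ (c^2*(R^2-1)*(x^2-1)) * (x^2-1) := mul_le_mul_of_nonneg_right (by nlinarith) hP.le
      rw [hχ]; nlinarith)
  simp only [hχ] at this ⊢
  linarith

theorem Zm_bound {χ' : ℝ} (k : ProlSol c χ' φ) {R : ℝ} (hc : 0 < c) (hR : 1 < R)
    (hχ : χ = c^2*R^2) (hlt : χ' < χ)
    (hcd : 2 ≤ c^2*(R^2-1)^2) {t : ℝ} (ht : R ≤ t) :
    (t^2-1) * (φ t)^2 ≤ (R^2-1)^2 *
    (((R * φ R + (R^2-1) * deriv φ R)^2 + (φ R)^2)/(R^2-1) + (c^2*R^2-χ')*(φ R)^2) := by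
  have hR1 : 0 < R^2-1 := by nlinarith
  have hPx : ∀ x ∈ Icc R t, R^2-1 ≤ x^2-1 := fun x hx => by nlinarith [hx.1]
  have hI : ∀ x ∈ Icc R t, 0 < (c^2*x^2-χ)/(x^2-1) + 1/(x^2-1)^2 := fun x hx => by
    have := hPx x hx
    have h2 : 0 < x^2-1 := by linarith
    have h3 : 0 ≤ c^2*x^2-χ := by
      rw [hχ, ← mul_sub]; apply mul_nonneg (sq_nonneg c); linarith
    positivity
  have hd : ∀ x ∈ Icc R t, HasDerivAt (fun x => (c^2*x^2-χ)/(x^2-1) + 1/(x^2-1)^2)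
      (2*x*((χ-c^2)/(x^2-1)^2 - 2/(x^2-1)^3)) x := by
    intro x hx
    have hP : 0 < x^2-1 := by linarith [hPx x hx]
    have d0 : HasDerivAt (fun x : ℝ => x^2-1) (2*x) x := by
      simpa using ((hasDerivAt_id x).pow 2).sub_const 1
    have d1 : HasDerivAt (fun x => c^2*x^2 - χ) (c^2*(2*x)) x := by
      simpa using (((hasDerivAt_id x).pow 2).const_mul (c^2)).sub_const χ
    refine ((d1.fun_div d0 hP.ne').fun_add ((hasDerivAt_const x 1).fun_div (d0.fun_pow 2) (by positivity))).congr_deriv ?_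
    norm_num
    have hP' := hP.ne'
    field_simp
    ring
  have key := anti_help (f := fun x => (((x * φ x + (x^2-1) * deriv φ x)^2 + (φ x)^2)/(x^2-1) + (c^2*x^2-χ')*(φ x)^2)
    / ((c^2*x^2-χ)/(x^2-1) + 1/(x^2-1)^2)) ht
    (fun x hx => ((k.Z_deriv (by linarith [hx.1])).fun_div (hd x hx) (hI x hx).ne').continuousAt.continuousWithinAt)
    (fun x hx => ((k.Z_deriv (by linarith [hx.1])).fun_div (hd x (Ioo_subset_Icc_self hx)) (hI x (Ioo_subset_Icc_self hx)).ne'))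
    (fun x hx => by
      have hx' := Ioo_subset_Icc_self hx
      have hle := hPx x hx'
      have hP : 0 < x^2-1 := by linarith
      have hIx := hI x hx'
      apply div_nonpos_of_nonpos_of_nonneg _ (sq_nonneg _)
      rw [sub_nonpos]
      have hx0 : 0 < x := by linarith [hx.1]
      set P := x^2-1
      set I := (c^2*x^2-χ)/P + 1/P^2 with hIdef
      set N := x * φ x + P * deriv φ x
      have hcd2 : 2 ≤ (χ - c^2)*P := by
        have : c^2*(R^2-1)*(R^2-1) ≤ c^2*(R^2-1)*P := mul_le_mul_of_nonneg_left hle (by positivity)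
        rw [hχ]; nlinarith
      -- derivative is nonnegative
      have hI' : 0 ≤ 2*x*((χ-c^2)/P^2 - 2/P^3) := by
        apply mul_nonneg (by positivity)
        rw [sub_nonneg, div_le_div_iff₀ (by positivity) (by positivity)]
        have := mul_le_mul_of_nonneg_right hcd2 (sq_nonneg P)
        nlinarith
      have hZ : P * I * (φ x)^2 ≤ (N^2 + (φ x)^2)/P + (c^2*x^2-χ')*(φ x)^2 := by
        have e1 : P * I * (φ x)^2 = (c^2*x^2-χ)*(φ x)^2 + (φ x)^2/P := by
          rw [hIdef]; field_simp
        have e2 : (N^2 + (φ x)^2)/P = N^2/P + (φ x)^2/P := add_div _ _ _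
        rw [e1, e2]
        have : 0 ≤ N^2/P := by positivity
        have : (c^2*x^2-χ)*(φ x)^2 ≤ (c^2*x^2-χ')*(φ x)^2 :=
          mul_le_mul_of_nonneg_right (by linarith) (sq_nonneg _)
        linarith
      have hstep : 2*x*((χ'-c^2)/P - 2/P^2)*(φ x)^2 ≤ P * (2*x*((χ-c^2)/P^2 - 2/P^3)) * (φ x)^2 := by
        apply mul_le_mul_of_nonneg_right _ (sq_nonneg _)
        have e : P * (2*x*((χ-c^2)/P^2 - 2/P^3)) = 2*x*((χ-c^2)/P - 2/P^2) := by field_simp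
        rw [e]
        apply mul_le_mul_of_nonneg_left _ (by positivity)
        have : (χ'-c^2)/P ≤ (χ-c^2)/P := div_le_div_of_nonneg_right (by linarith) hP.le
        linarith
      calc 2*x*((χ'-c^2)/P - 2/P^2)*(φ x)^2 * I ≤ P * (2*x*((χ-c^2)/P^2 - 2/P^3)) * (φ x)^2 * I :=
            mul_le_mul_of_nonneg_right hstep hIx.le
        _ = (P * I * (φ x)^2) * (2*x*((χ-c^2)/P^2 - 2/P^3)) := by ring
        _ ≤ _ := mul_le_mul_of_nonneg_right hZ hI')
  have hPt : 0 < t^2-1 := by linarith [hPx t ⟨ht, le_rfl⟩]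
  have hIt := hI t ⟨ht, le_rfl⟩
  have eR : (c^2*R^2-χ)/(R^2-1) + 1/(R^2-1)^2 = 1/(R^2-1)^2 := by rw [hχ]; simp
  simp only [eR] at key
  have hge : (t^2-1)*(φ t)^2 ≤ (((t * φ t + (t^2-1) * deriv φ t)^2 + (φ t)^2)/(t^2-1) + (c^2*t^2-χ')*(φ t)^2)
    / ((c^2*t^2-χ)/(t^2-1) + 1/(t^2-1)^2) := by
    rw [le_div_iff₀ hIt]
    have e1 : (t^2-1)*(φ t)^2*((c^2*t^2-χ)/(t^2-1) + 1/(t^2-1)^2) = (c^2*t^2-χ)*(φ t)^2 + (φ t)^2/(t^2-1) := by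
      field_simp
    rw [e1, add_div]
    have : 0 ≤ (t * φ t + (t^2-1) * deriv φ t)^2/(t^2-1) := by positivity
    have : (c^2*t^2-χ)*(φ t)^2 ≤ (c^2*t^2-χ')*(φ t)^2 :=
      mul_le_mul_of_nonneg_right (by linarith) (sq_nonneg _)
    linarith
  refine hge.trans (key.trans (le_of_eq ?_))
  field_simp

theorem residue_alg {r N δ s p r1 Δ : ℝ} (hδ : 0 < δ) (hΔ0 : 0 < Δ) (a3' : δ * s^2 ≤ Δ * (r1^2 - r^2)) (hrr : r^2 ≤ r1^2) :
    ((r*N + δ*s*p)^2 + (r*p)^2)/δ + Δ*(r*p)^2 ≤ r1^2*(2 + 2*Δ*δ) * ((N^2 + p^2)/δ) := by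
  have e1 : ((r*N + δ*s*p)^2 + (r*p)^2)/δ + Δ*(r*p)^2 = ((r*N + δ*s*p)^2 + (r*p)^2 + Δ*(r*p)^2*δ)/δ := by
    field_simp
  rw [e1, mul_div_assoc', div_le_div_iff_of_pos_right hδ]
  have t1 : (r*N + δ*s*p)^2 ≤ 2*r^2*N^2 + 2*δ^2*s^2*p^2 := by nlinarith [sq_nonneg (r*N - δ*s*p)]
  have t2 : 2*δ^2*s^2*p^2 ≤ 2*δ*Δ*(r1^2-r^2)*p^2 := by
    have := mul_le_mul_of_nonneg_left a3' (show 0 ≤ 2*δ*p^2 by positivity)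
    linarith
  have t3 : r^2*N^2 ≤ r1^2*N^2 := mul_le_mul_of_nonneg_right hrr (sq_nonneg _)
  have t4 : r^2*p^2 ≤ r1^2*p^2 := mul_le_mul_of_nonneg_right hrr (sq_nonneg _)
  have t5 : 0 ≤ δ*Δ*(r^2*p^2) := by positivity
  have t6 : 0 ≤ δ*Δ*(r1^2*N^2) := by positivity
  have t7 : 0 ≤ r1^2*p^2 := by positivity
  linarith

/-- residues at outer zeros -/
theorem residue_bound {χ' : ℝ} (h : ProlSol c χ ψ) (k : ProlSol c χ' φ) {R : ℝ} (hc : 0 < c) (hR : 1 < R)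
    (hχ : χ = c^2*R^2) (h1 : 0 < ψ 1) (hlt : χ' < χ) (hχ' : 0 ≤ χ')
    (hcd : 2 ≤ c^2*(R^2-1)^2) {t : ℝ} (ht : R ≤ t) (h0 : ψ t = 0) :
    (φ t)^2 ≤ (deriv ψ t)^2 * ((φ 1/ψ 1)^2 * (R^2-1)^2 * (2 + 2*c^2*(R^2-1)*R^2)) := by
  have hR1 : 0 < R^2-1 := by nlinarith
  have hP : 0 < t^2-1 := by nlinarith
  have a1 := h.Z_mono hc hR hχ hcd ht
  have a2 := k.Zm_bound hc hR hχ hlt hcd ht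
  have a3 := h.ratio_bound k hR hχ h1 hlt
  have hψR : 0 < ψ R := lt_of_lt_of_le h1 (h.barrier_pos hR hχ h1 R ⟨hR.le, le_rfl⟩).1
  rw [h0] at a1
  have e1 : ((t * 0 + (t^2-1) * deriv ψ t)^2 + (0:ℝ)^2)/(t^2-1) + (c^2*t^2-χ)*(0:ℝ)^2 = (t^2-1)*(deriv ψ t)^2 := by
    field_simp; ring
  rw [e1] at a1
  set δ := R^2-1 with hδ
  set r := φ R/ψ R with hr
  set s := (deriv φ R * ψ R - φ R * deriv ψ R)/(ψ R)^2 with hs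
  set r1 := φ 1/ψ 1 with hr1
  have hφR : φ R = r * ψ R := by rw [hr]; field_simp
  have hφR' : deriv φ R = s * ψ R + r * deriv ψ R := by rw [hs, hr]; field_simp; ring
  set N := R * ψ R + δ * deriv ψ R with hN
  have hNm : R * φ R + δ * deriv φ R = r * N + δ * s * ψ R := by rw [hφR, hφR', hN]; ring
  rw [hNm, hφR] at a2
  set Δ := χ - χ' with hΔ
  have hΔ0 : 0 < Δ := by rw [hΔ]; linarith
  have hΔ1 : Δ ≤ c^2*R^2 := by rw [hΔ, ← hχ]; linarith
  have e2 : c^2*R^2-χ' = Δ := by rw [hΔ, hχ]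
  rw [e2] at a2
  have a3' : δ * s^2 ≤ Δ * (r1^2 - r^2) := by
    have : δ * s^2/Δ ≤ r1^2 - r^2 := by linarith
    rw [div_le_iff₀ hΔ0] at this
    linarith
  have hrr : r^2 ≤ r1^2 := by
    have : 0 ≤ δ*s^2/Δ := by positivity
    linarith
  -- Z_m(R) bound
  have b1 : ((r*N + δ*s*ψ R)^2 + (r*ψ R)^2)/δ + Δ*(r*ψ R)^2 ≤ r1^2*(2 + 2*Δ*δ) * ((N^2 + (ψ R)^2)/δ) := residue_alg hR1 hΔ0 a3' hrr
  have b2 : r1^2*(2 + 2*Δ*δ) * ((N^2 + (ψ R)^2)/δ) ≤ r1^2*(2+2*c^2*δ*R^2) * ((t^2-1)*(deriv ψ t)^2) := by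
    apply mul_le_mul _ a1 (by positivity) (by positivity)
    apply mul_le_mul_of_nonneg_left _ (sq_nonneg _)
    have := mul_le_mul_of_nonneg_right hΔ1 hR1.le
    linarith
  have b3 : (t^2-1) * (φ t)^2 ≤ (t^2-1) * ((deriv ψ t)^2 * (r1^2 * δ^2 * (2 + 2*c^2*δ*R^2))) := by
    refine a2.trans ?_
    have := mul_le_mul_of_nonneg_left (b1.trans b2) (sq_nonneg δ)
    linarith
  exact le_of_mul_le_mul_left b3 hP

end ProlSol
end

section
theorem gap_sin {y y1 I : ℝ → ℝ} {a b k : ℝ} (hab : a < b) (hk : 0 < k)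
    (hy : ∀ x ∈ Icc a b, HasDerivAt y (y1 x) x) (hy1 : ∀ x ∈ Icc a b, HasDerivAt y1 (-(I x * y x)) x)
    (hI : ∀ x ∈ Ioo a b, I x ≤ k^2) (hpos : ∀ x ∈ Ioo a b, 0 < y x) (h0a : y a = 0) (h0b : y b = 0)
    (h1a : 0 ≤ y1 a) (h1b : y1 b < 0) : π / k ≤ b - a := by
  by_contra hcon
  push Not at hcon
  rw [lt_div_iff₀ hk] at hcon
  set η := (π - k*(b-a))/2 with hη
  have hη0 : 0 < η := by rw [hη]; linarith
  have hηπ : η < π := by rw [hη]; nlinarith [pi_pos]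
  have hs : ∀ x, HasDerivAt (fun x => sin (k*(x-a)+η)) (k * cos (k*(x-a)+η)) x := fun x => by
    have : HasDerivAt (fun x : ℝ => k*(x-a)+η) k x := by
      simpa using (((hasDerivAt_id x).sub_const a).const_mul k).add_const η
    simpa [mul_comm] using this.sin
  have hc : ∀ x, HasDerivAt (fun x => cos (k*(x-a)+η)) (-(k * sin (k*(x-a)+η))) x := fun x => by
    have : HasDerivAt (fun x : ℝ => k*(x-a)+η) k x := by
      simpa using (((hasDerivAt_id x).sub_const a).const_mul k).add_const η
    simpa [mul_comm] using this.cos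
  have hW : ∀ x ∈ Icc a b, HasDerivAt (fun x => y1 x * sin (k*(x-a)+η) - y x * (k * cos (k*(x-a)+η)))
      ((k^2 - I x) * y x * sin (k*(x-a)+η)) x := fun x hx => by
    refine (((hy1 x hx).fun_mul (hs x)).fun_sub ((hy x hx).fun_mul ((hc x).const_mul k))).congr_deriv ?_
    ring
  have := mono_help hab.le (fun x hx => (hW x hx).continuousAt.continuousWithinAt)
    (fun x hx => hW x ⟨hx.1.le, hx.2.le⟩) (fun x hx => by
      have h1 := hI x hx
      have h2 := hpos x hx
      have h3 : 0 < sin (k*(x-a)+η) := by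
        apply sin_pos_of_pos_of_lt_pi
        · have := mul_pos hk (sub_pos.2 hx.1); linarith
        · have : k*(x-a) < k*(b-a) := mul_lt_mul_of_pos_left (by linarith [hx.2]) hk
          rw [hη] at *; linarith
      have : 0 ≤ k^2 - I x := by linarith
      positivity)
  rw [h0a, h0b] at this
  have e : k*(b-a)+η = π - η := by rw [hη]; ring
  rw [e, sin_pi_sub] at this
  simp at this
  have hsη := sin_pos_of_pos_of_lt_pi hη0 hηπ
  nlinarith [mul_nonneg h1a hsη.le]

theorem sum_gap {g Γ : ℝ → ℝ} {a0 h : ℝ} (hh : 0 < h) (hg0 : ∀ x, a0 ≤ x → 0 ≤ g x)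
    (hga : ∀ x, a0 ≤ x → g x ≤ g a0) (hΓ : ∀ x y, a0 ≤ x → x ≤ y → g y * (y - x) ≤ Γ y - Γ x)
    (F : Finset ℝ) : (∀ x ∈ F, a0 ≤ x) → (∀ x ∈ F, ∀ y ∈ F, x < y → h ≤ y - x) →
    ∀ b0, a0 ≤ b0 → (∀ x ∈ F, x ≤ b0) → ∑ x ∈ F, g x ≤ g a0 + (Γ b0 - Γ a0)/h := by
  have hmono : ∀ x y, a0 ≤ x → x ≤ y → Γ x ≤ Γ y := fun x y h1 h2 => by
    have := hΓ x y h1 h2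
    have h3 := mul_nonneg (hg0 y (h1.trans h2)) (sub_nonneg.2 h2)
    linarith
  induction F using Finset.induction_on_max with
  | empty =>
    intro _ _ b0 hb _
    have := hmono a0 b0 le_rfl hb
    have h2 : 0 ≤ (Γ b0 - Γ a0)/h := div_nonneg (by linarith) hh.le
    simp; linarith [hg0 a0 le_rfl]
  | insert a s ha ih =>
    intro h1 h2 b0 hb h3
    have ham : a ∈ insert a s := Finset.mem_insert_self _ _
    rw [Finset.sum_insert (fun hm => lt_irrefl _ (ha a hm))]
    have hab := h3 a ham
    have ha0 := h1 a ham
    rcases s.eq_empty_or_nonempty with hs | ⟨z, hz⟩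
    · have h2 : 0 ≤ (Γ b0 - Γ a0)/h := div_nonneg (by linarith [hmono a0 b0 le_rfl hb]) hh.le
      simp [hs]; linarith [hga a ha0]
    · have hgap : ∀ x ∈ s, x ≤ a - h := fun x hx => by
        have := h2 x (Finset.mem_insert_of_mem hx) a ham (ha x hx); linarith
      have haz : a0 ≤ a - h := (h1 z (Finset.mem_insert_of_mem hz)).trans (hgap z hz)
      have := ih (fun x hx => h1 x (Finset.mem_insert_of_mem hx))
        (fun x hx y hy => h2 x (Finset.mem_insert_of_mem hx) y (Finset.mem_insert_of_mem hy)) (a-h) haz hgap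
      have h4 := hΓ (a-h) a haz (by linarith)
      have h5 : g a ≤ (Γ a - Γ (a-h))/h := by rw [le_div_iff₀ hh]; linarith
      have h6 : (Γ a - Γ a0)/h ≤ (Γ b0 - Γ a0)/h := div_le_div_of_nonneg_right (by linarith [hmono a b0 ha0 hab]) hh.le
      have h7 : (Γ a - Γ (a-h))/h + (Γ (a-h) - Γ a0)/h = (Γ a - Γ a0)/h := by ring
      linarith

namespace ProlSol
variable {c χ : ℝ} {ψ φ : ℝ → ℝ}

theorem next_zero (h : ProlSol c χ ψ) {z : ℝ} (hz : ψ z ≠ 0) {a b : ℝ} (hab : a < b) (ha : ψ a = 0) (hb : ψ b = 0) :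
    ∃ y, a < y ∧ y ≤ b ∧ ψ y = 0 ∧ ∀ x ∈ Ioo a y, ψ x ≠ 0 := by
  have hd := h.deriv_ne hz ha
  have := (h.hd a).eventually_ne hd (c := 0)
  rw [eventually_nhdsWithin_iff, Metric.eventually_nhds_iff] at this
  obtain ⟨e, he, hE⟩ := this
  have hne : ∀ x ∈ Ioo a (a+e), ψ x ≠ 0 := fun x hx =>
    hE (by rw [Real.dist_eq, abs_of_pos (by linarith [hx.1])]; linarith [hx.2]) (by simp; exact hx.1.ne')
  have hbe : a + e ≤ b := by
    by_contra hc
    exact hne b ⟨hab, by linarith⟩ hb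
  have hK : IsCompact (Icc (a+e) b ∩ ψ ⁻¹' {0}) := isCompact_Icc.inter_right (isClosed_singleton.preimage h.cont)
  obtain ⟨y, hy, hmin⟩ := hK.exists_isLeast ⟨b, ⟨hbe, le_rfl⟩, hb⟩
  refine ⟨y, by linarith [hy.1.1], hy.1.2, hy.2, fun x hx h0 => ?_⟩
  by_cases hxe : x < a + e
  · exact hne x ⟨hx.1, hxe⟩ h0
  · have := hmin ⟨⟨not_lt.1 hxe, by linarith [hx.2, hy.1.2]⟩, h0⟩
    linarith [hx.2]

theorem gap_gen (h : ProlSol c χ ψ) {z σ k : ℝ} (hz : ψ z ≠ 0) (hσ : σ^2 = 1) (hk : 0 < k)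
    {a b : ℝ} (hab : a < b) (ha : ψ a = 0) (hb : ψ b = 0) (hP : ∀ x ∈ Icc a b, 0 < σ*(x^2-1))
    (hI : ∀ x ∈ Ioo a b, -(σ*(1+χ-c^2*x^2)/(σ*(x^2-1)) - x^2/(σ*(x^2-1))^2) ≤ k^2) : π / k ≤ b - a := by
  obtain ⟨y, hay, hyb, hy0, hyn⟩ := h.next_zero hz hab ha hb
  suffices π / k ≤ y - a by linarith
  clear hb
  wlog hpos : ∀ x ∈ Ioo a y, 0 < ψ x generalizing ψ
  · have hneg : ∀ x ∈ Ioo a y, ψ x < 0 := by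
      rcases h.sign_const isPreconnected_Ioo hyn with h1 | h1
      · exact absurd h1 hpos
      · exact h1
    exact this h.neg (by simpa using hz) (by simpa using ha) (by simpa using hy0) (by simpa using hyn)
      (fun x hx => by have := hneg x hx; simpa using this)
  have hPy : ∀ x ∈ Icc a y, 0 < σ*(x^2-1) := fun x hx => hP x ⟨hx.1, hx.2.trans hyb⟩
  have hPd : ∀ x, HasDerivAt (fun x : ℝ => σ*(x^2-1)) (σ*(2*x)) x := fun x => by
    simpa using (((hasDerivAt_id x).pow 2).sub_const 1).const_mul σ
  have hs : ∀ x ∈ Icc a y, HasDerivAt (fun x : ℝ => √(σ*(x^2-1))) (σ*(2*x)/(2*√(σ*(x^2-1)))) x :=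
    fun x hx => (hPd x).sqrt (hPy x hx).ne'
  have hv : ∀ x, HasDerivAt (fun x : ℝ => σ*((x^2-1)*deriv ψ x)) (σ*((χ - c^2*x^2) * ψ x)) x :=
    fun x => (h.hP x).const_mul σ
  have da := h.deriv_nonneg_left hay ha hpos
  have db := h.deriv_nonpos_right hay hy0 hpos
  have db' : deriv ψ y < 0 := lt_of_le_of_ne db (h.deriv_ne hz hy0)
  refine gap_sin (y := fun x => √(σ*(x^2-1)) * ψ x)
    (y1 := fun x => (σ*x*ψ x + σ*((x^2-1)*deriv ψ x))/√(σ*(x^2-1)))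
    (I := fun x => -(σ*(1+χ-c^2*x^2)/(σ*(x^2-1)) - x^2/(σ*(x^2-1))^2)) hay hk ?_ ?_
    (fun x hx => hI x ⟨hx.1, hx.2.trans_le hyb⟩) ?_ (by simp [ha]) (by simp [hy0]) ?_ ?_
  · intro x hx
    refine ((hs x hx).fun_mul (h.hd x)).congr_deriv ?_
    have hp := hPy x hx
    have h1 := sqrt_pos.2 hp
    have h2 : σ*((x^2-1)*deriv ψ x) = √(σ*(x^2-1))^2 * deriv ψ x := by rw [sq_sqrt hp.le]; ring
    beta_reduce
    rw [h2]
    generalize √(σ*(x^2-1)) = s at *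
    field_simp
  · intro x hx
    have hσx : HasDerivAt (fun x : ℝ => σ*x*ψ x) (σ*ψ x + σ*x*deriv ψ x) x := by
      have := (((hasDerivAt_id x).const_mul σ).fun_mul (h.hd x))
      simpa using this
    have hp := hPy x hx
    have h1 := sqrt_pos.2 hp
    refine ((hσx.fun_add (hv x)).fun_div (hs x hx) h1.ne').congr_deriv ?_
    beta_reduce
    have h2 : σ*(x^2-1) = √(σ*(x^2-1))^2 := by rw [sq_sqrt hp.le]
    have h3 : σ*((x^2-1)*deriv ψ x) = √(σ*(x^2-1))^2 * deriv ψ x := by rw [← h2]; ring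
    rw [h3]
    generalize √(σ*(x^2-1)) = s at *
    rw [h2]
    field_simp
    linear_combination (-(x^2 * ψ x)) * hσ
  · intro x hx
    exact mul_pos (sqrt_pos.2 (hPy x ⟨hx.1.le, hx.2.le⟩)) (hpos x hx)
  · have := hPy a ⟨le_rfl, hay.le⟩
    beta_reduce
    rw [ha]
    apply div_nonneg _ (sqrt_nonneg _)
    have := mul_nonneg this.le da
    linarith
  · have := hPy y ⟨hay.le, le_rfl⟩
    beta_reduce
    rw [hy0]
    apply div_neg_of_neg_of_pos _ (sqrt_pos.2 this)
    have := mul_neg_of_pos_of_neg this db'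
    linarith

theorem gap_outer (h : ProlSol c χ ψ) {z R : ℝ} (hz : ψ z ≠ 0) (hc : 0 < c) (hR : 1 < R) (hχ : χ = c^2*R^2)
    (hcd : 2 ≤ c^2*(R^2-1)^2) {a b : ℝ} (hRa : R ≤ a) (hab : a < b) (ha : ψ a = 0) (hb : ψ b = 0) :
    π / c ≤ b - a := by
  have hpos : ∀ x ∈ Icc a b, R^2 - 1 ≤ x^2-1 := fun x hx => by nlinarith [hx.1]
  have hR1 : 0 < R^2-1 := by nlinarith
  refine h.gap_gen (σ := 1) hz (by norm_num) hc hab ha hb (fun x hx => by linarith [hpos x hx]) ?_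
  intro x hx
  have h1 := hpos x ⟨hx.1.le, hx.2.le⟩
  have h2 : 0 < x^2-1 := by linarith
  simp only [one_mul]
  have e : -((1+χ-c^2*x^2)/(x^2-1) - x^2/(x^2-1)^2) = (1 + (c^2*x^2-χ)*(x^2-1))/(x^2-1)^2 := by
    field_simp; ring
  rw [e, div_le_iff₀ (by positivity), hχ]
  have h3 : c^2*(R^2-1)*(R^2-1) ≤ c^2*(R^2-1)*(x^2-1) := mul_le_mul_of_nonneg_left h1 (by positivity)
  nlinarith

theorem gap_inner (h : ProlSol c χ ψ) {z : ℝ} (hz : ψ z ≠ 0) (hχ : 2 ≤ χ)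
    {a b : ℝ} (hRa : -(1/2) ≤ a) (hab : a < b) (hbh : b ≤ 1/2) (ha : ψ a = 0) (hb : ψ b = 0) :
    2 / √χ ≤ b - a := by
  have hs : 0 < √χ := sqrt_pos.2 (by linarith)
  have hpos : ∀ x ∈ Icc a b, x^2 ≤ 1/4 := fun x hx => by nlinarith [hx.1, hx.2]
  have := h.gap_gen (σ := -1) (k := 3/2*√χ) hz (by norm_num) (by positivity) hab ha hb (fun x hx => by linarith [hpos x hx]) ?_
  · refine le_trans ?_ this
    rw [div_le_div_iff₀ hs (by positivity)]
    nlinarith [pi_gt_three]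
  · intro x hx
    have h1 := hpos x ⟨hx.1.le, hx.2.le⟩
    have e : -(-1*(1+χ-c^2*x^2)/(-1*(x^2-1)) - x^2/(-1*(x^2-1))^2) = (1 + (χ-c^2*x^2)*(1-x^2))/(1-x^2)^2 := by
      have : x^2-1 ≠ 0 := by linarith
      have h2 : 1 - x^2 ≠ 0 := by linarith
      field_simp
      ring
    rw [e, mul_pow, sq_sqrt (by linarith), div_le_iff₀ (by nlinarith)]
    have h2 : (χ-c^2*x^2)*(1-x^2) ≤ χ*(1-x^2) := mul_le_mul_of_nonneg_right (by nlinarith [mul_nonneg (sq_nonneg c) (sq_nonneg x)]) (by linarith)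
    have h3 : 9/16 ≤ (1-x^2)^2 := by nlinarith
    nlinarith

end ProlSol
end

section
namespace ProlSol
variable {c χ : ℝ} {ψ φ : ℝ → ℝ}

theorem outer_sum (h : ProlSol c χ ψ) {z R : ℝ} (hz : ψ z ≠ 0) (hc : 0 < c) (hR : 1 < R) (hχ : χ = c^2*R^2)
    (hcd : 2 ≤ c^2*(R^2-1)^2) (F : Finset ℝ) (hF : ∀ x ∈ F, R ≤ x ∧ ψ x = 0) :
    ∑ x ∈ F, 1/x^2 ≤ 1/R^2 + c/(π*R) := by
  have hR0 : 0 < R := by linarith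
  obtain ⟨b, hb⟩ := F.bddAbove
  have := sum_gap (g := fun x => 1/x^2) (Γ := fun x => -(1/x)) (a0 := R) (h := π/c) (by positivity)
    (fun x _ => by positivity)
    (fun x hx => one_div_le_one_div_of_le (by positivity) (by gcongr))
    (fun x y hx hxy => by
      have hx0 : 0 < x := by linarith
      have hy0 : 0 < y := by linarith
      have e1 : -(1/y) - -(1/x) = (y-x)/(x*y) := by field_simp; ring
      rw [e1, div_mul_eq_mul_div, one_mul]
      exact div_le_div_of_nonneg_left (by linarith) (by positivity) (by nlinarith))
    F (fun x hx => (hF x hx).1)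
    (fun x hx y hy hxy => h.gap_outer hz hc hR hχ hcd (hF x hx).1 hxy (hF x hx).2 (hF y hy).2)
    (max R b) (le_max_left _ _) (fun x hx => (hb hx).trans (le_max_right _ _))
  refine this.trans ?_
  have hb0 : 0 < max R b := lt_of_lt_of_le hR0 (le_max_left _ _)
  have h2 : -(1/max R b) - -(1/R) ≤ 1/R := by
    have : 0 < 1/max R b := by positivity
    linarith
  have h3 : (-(1/max R b) - -(1/R))/(π/c) ≤ (1/R)/(π/c) := div_le_div_of_nonneg_right h2 (by positivity)
  have h4 : (1/R)/(π/c) = c/(π*R) := by field_simp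
  linarith

theorem inner_count (h : ProlSol c χ ψ) {R : ℝ} (hc : 60 < c) (hR : 1 < R) (hχ : χ = c^2*R^2) {n : ℕ}
    (hcard : {x | x ∈ Ioo (-1:ℝ) 1 ∧ ψ x = 0}.encard = n) : (n:ℝ) ≤ c*R + log (c*R)/π + 3 := by
  have hc0 : 0 < c := by linarith
  have := h.zero_count (d := R^2-1) (by linarith) (by nlinarith) (by rw [hχ]; linarith) hcard
    (J := fun x => c*R*arcsin x) (J' := fun x => c*R*(1/√(1-x^2))) (by fun_prop)
    (fun x hx => (hasDerivAt_arcsin (by linarith [hx.1]) (by linarith [hx.2])).const_mul _) (fun x hx => by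
      have hp : 0 < 1-x^2 := by nlinarith [hx.1, hx.2]
      have hs := sqrt_pos.2 hp
      rw [sqrt_mul hp.le]
      have h1 : √(c^2*(1+(R^2-1)) - c^2*x^2) ≤ c*R := by
        apply Real.sqrt_le_iff.2 ⟨by positivity, ?_⟩
        nlinarith [mul_nonneg (sq_nonneg c) (sq_nonneg x)]
      have h2 : (1-x^2) = √(1-x^2)*√(1-x^2) := (mul_self_sqrt hp.le).symm
      calc √(1-x^2) * √(c^2*(1+(R^2-1)) - c^2*x^2)/(1-x^2) ≤ √(1-x^2) * (c*R)/(1-x^2) := by gcongr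
        _ = c*R*(1/√(1-x^2)) := by
          field_simp
          rw [sq, ← h2])
  have e : c^2*(1+(R^2-1)) = (c*R)^2 := by ring
  rw [e, log_pow, arcsin_one, arcsin_zero] at this
  have hp := pi_pos
  have h3 : ((n:ℝ)-3) ≤ c*R + log (c*R)/π := by
    rw [← mul_le_mul_iff_left₀ hp]
    have : log (c*R)/π*π = log (c*R) := by field_simp
    push_cast at *
    linarith
  linarith

theorem inner_sum (h : ProlSol c χ ψ) {z R : ℝ} (hz : ψ z ≠ 0) (hc : 60 < c) (hR : 1 < R) (hχ : χ = c^2*R^2)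
    (hev : ∀ x, ψ (-x) = ψ x) {n : ℕ}
    (hcard : {x | x ∈ Ioo (-1:ℝ) 1 ∧ ψ x = 0}.encard = n) (F : Finset ℝ)
    (hF : ∀ x ∈ F, x ∈ Ioo (-1:ℝ) 1 ∧ ψ x = 0) :
    ∑ x ∈ F, 1/|x| ≤ c*R*(4 + log (c*R)) := by
  have hcR : 60 < c*R := by nlinarith
  set D := c*R with hD
  have hs : √χ = D := by rw [hχ, ← mul_pow, sqrt_sq (by positivity)]
  have hχ2 : 2 ≤ χ := by rw [hχ, ← mul_pow, ← hD]; nlinarith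
  have h0 : ψ 0 ≠ 0 := by
    intro h0
    apply h.deriv_ne hz h0
    have h1 := (h.hd 0)
    have h2 : HasDerivAt (fun x => ψ (-x)) (-(deriv ψ 0)) 0 := by
      have : HasDerivAt ψ (deriv ψ 0) (-(0:ℝ)) := by simpa using h.hd 0
      simpa [Function.comp_def] using this.comp (0:ℝ) (hasDerivAt_neg (0:ℝ))
    have e : (fun x => ψ (-x)) = ψ := funext hev
    rw [e] at h2
    have := h1.unique h2
    linarith
  -- half sum
  have half : ∀ G : Finset ℝ, (∀ x ∈ G, 0 < x ∧ x ≤ 1/2 ∧ ψ x = 0) → ∑ x ∈ G, 1/x ≤ D*(1 + 1/2*log (D/2)) := by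
    intro G hG
    have h1 : ∀ x ∈ G, 1/D ≤ x := fun x hx => by
      obtain ⟨a, b, e⟩ := hG x hx
      have := h.gap_inner hz hχ2 (a := -x) (b := x) (by linarith) (by linarith) b (by rw [hev, e]) e
      rw [hs] at this
      have e2 : 2/D = 2*(1/D) := by ring
      linarith
    have hD0 : (0:ℝ) < 1/D := by positivity
    have := sum_gap (g := fun x => 1/x) (Γ := log) (a0 := 1/D) (h := 2/D) (by positivity)
      (fun x hx => by have : 0 < x := by linarith
                      positivity) (fun x hx => one_div_le_one_div_of_le hD0 hx)
      (fun x y hx hxy => by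
        have hx0 : 0 < x := by linarith
        have hy0 : 0 < y := by linarith
        have := one_sub_inv_le_log_of_pos (div_pos hy0 hx0)
        rw [log_div hy0.ne' hx0.ne', inv_div] at this
        have e : 1/y*(y-x) = 1 - x/y := by field_simp
        rw [e]; exact this) G h1
      (fun x hx y hy hxy => by
        have := h.gap_inner hz hχ2 (a := x) (b := y) (by linarith [(hG x hx).1]) hxy (hG y hy).2.1 (hG x hx).2.2 (hG y hy).2.2
        rwa [hs] at this) (1/2) (one_div_le_one_div_of_le (by norm_num) (by linarith)) (fun x hx => (hG x hx).2.1)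
    refine this.trans (le_of_eq ?_)
    rw [← log_div (by norm_num) hD0.ne']
    have e3 : (1/2:ℝ)/(1/D) = D/2 := by field_simp
    rw [e3]
    field_simp
  -- splitting
  set A := F.filter (fun x => 0 < x ∧ x ≤ 1/2) with hA
  set B := F.filter (fun x => x < 0 ∧ -(1/2) ≤ x) with hB
  set C := F.filter (fun x => 1/2 < |x|) with hC
  have hsplit : ∑ x ∈ F, 1/|x| ≤ ∑ x ∈ A, 1/|x| + ∑ x ∈ B, 1/|x| + ∑ x ∈ C, 1/|x| := by
    rw [hA, hB, hC, Finset.sum_filter, Finset.sum_filter, Finset.sum_filter, ← Finset.sum_add_distrib, ← Finset.sum_add_distrib]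
    apply Finset.sum_le_sum
    intro x hx
    have hpos : 0 ≤ 1/|x| := by positivity
    have n1 : 0 ≤ if 0 < x ∧ x ≤ 1/2 then 1/|x| else 0 := by split_ifs <;> simp
    have n2 : 0 ≤ if x < 0 ∧ -(1/2) ≤ x then 1/|x| else 0 := by split_ifs <;> simp
    have n3 : 0 ≤ if 1/2 < |x| then 1/|x| else 0 := by split_ifs <;> simp
    have hx0 : x ≠ 0 := fun e => h0 (e ▸ (hF x hx).2)
    by_cases h3 : 1/2 < |x|
    · rw [if_pos h3]; linarith
    · rcases lt_or_gt_of_ne hx0 with h4 | h4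
      · rw [abs_of_neg h4] at h3
        have : x < 0 ∧ -(1/2) ≤ x := ⟨h4, by linarith⟩
        rw [if_pos this]; linarith
      · rw [abs_of_pos h4] at h3
        have : 0 < x ∧ x ≤ 1/2 := ⟨h4, by linarith⟩
        rw [if_pos this]; linarith
  have sA : ∑ x ∈ A, 1/|x| ≤ D*(1 + 1/2*log (D/2)) := by
    have : ∑ x ∈ A, 1/|x| = ∑ x ∈ A, 1/x := Finset.sum_congr rfl fun x hx => by
      rw [abs_of_pos (Finset.mem_filter.1 hx).2.1]
    rw [this]
    exact half A fun x hx => ⟨(Finset.mem_filter.1 hx).2.1, (Finset.mem_filter.1 hx).2.2, (hF x (Finset.mem_filter.1 hx).1).2⟩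
  have sB : ∑ x ∈ B, 1/|x| ≤ D*(1 + 1/2*log (D/2)) := by
    have : ∑ x ∈ B, 1/|x| = ∑ x ∈ B.image (fun x => -x), 1/x := by
      rw [Finset.sum_image (fun x _ y _ e => neg_injective e)]
      exact Finset.sum_congr rfl fun x hx => by
        rw [abs_of_neg (Finset.mem_filter.1 hx).2.1]
    rw [this]
    refine half _ fun x hx => ?_
    obtain ⟨y, hy, rfl⟩ := Finset.mem_image.1 hx
    have := Finset.mem_filter.1 hy
    exact ⟨by linarith [this.2.1], by linarith [this.2.2], by rw [hev]; exact (hF y this.1).2⟩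
  have sC : ∑ x ∈ C, 1/|x| ≤ 2 * n := by
    have h1 : ∑ x ∈ C, 1/|x| ≤ ∑ x ∈ C, (2:ℝ) := Finset.sum_le_sum fun x hx => by
      have := (Finset.mem_filter.1 hx).2
      rw [div_le_iff₀ (by linarith)]; linarith
    have h2 : C.card ≤ n := by
      have : (C : Set ℝ).encard ≤ n := by
        rw [← hcard]
        exact Set.encard_le_encard fun x hx => hF x (Finset.mem_filter.1 hx).1
      rw [Set.encard_coe_eq_coe_finsetCard] at this
      exact_mod_cast this
    rw [Finset.sum_const, nsmul_eq_mul] at h1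
    have : (C.card:ℝ) ≤ n := by exact_mod_cast h2
    linarith
  have hn := h.inner_count hc hR hχ hcard
  rw [← hD] at hn
  have hl : log (D/2) = log D - log 2 := log_div (by positivity) (by norm_num)
  have hl2 := log_two_gt_d9
  have hlD : log D ≤ D/2 := by
    have := log_le_sub_one_of_pos (show 0 < D/2 by positivity)
    rw [hl] at this
    have := log_two_lt_d9
    linarith
  have hlp : log D/π ≤ D/6 := by
    rw [div_le_iff₀ pi_pos]
    nlinarith [pi_gt_three]
  have : D*log D ≤ D*log D := le_rfl
  have e : D*(1+1/2*log (D/2)) = D + 1/2*(D*log D) - 1/2*(D*log 2) := by rw [hl]; ring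
  have : D*0.69 ≤ D*log 2 := mul_le_mul_of_nonneg_left (by linarith) (by positivity)
  have : D*(4+log D) = 4*D + D*log D := by ring
  linarith

end ProlSol
end

section
/-- sign propagation for three-term recursions -/
theorem rec_pos {a κ μ : ℕ → ℝ} {C χ : ℝ} (hC : 0 < C) (hμ : ∀ i, 0 < μ i) (hκ : Monotone κ)
    (hrec : ∀ i, C * a (i+2) = (χ - κ (i+1)) * a (i+1) + μ i * a i) (h0 : C * a 1 = (χ - κ 0) * a 0)
    (hκ0 : κ 0 < χ) (hev : ∃ N, ∀ i, N ≤ i → 0 < a i) : ∀ i, 0 < a i := by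
  classical
  set m := Nat.find hev with hm
  have hms : ∀ i, m ≤ i → 0 < a i := Nat.find_spec hev
  have hmz : m = 0 := by
    by_contra hne
    obtain ⟨l, hl⟩ : ∃ l, m = l + 1 := Nat.exists_eq_succ_of_ne_zero hne
    have hal : a l ≤ 0 := by
      by_contra hpos
      push Not at hpos
      refine Nat.find_min hev (m := l) (by omega) fun i hi => ?_
      rcases Nat.eq_or_lt_of_le hi with h | h
      · rw [← h]; exact hpos
      · exact hms i (by omega)
    have h1 := hms (l+1) (by omega)
    have h2 := hms (l+2) (by omega)
    have h3 := hrec l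
    have hκl : κ (l+1) < χ := by
      by_contra hc
      push Not at hc
      have := mul_nonneg (sub_nonneg.2 hc) h1.le
      have := mul_pos hC h2
      have := mul_nonneg (hμ l).le (neg_nonneg.2 hal)
      linarith
    have hκi : ∀ i, i ≤ l+1 → 0 < χ - κ i := fun i hi => by linarith [hκ hi]
    rcases le_or_gt (a 0) 0 with ha | ha
    · have : ∀ i, i ≤ l → a i ≤ 0 ∧ a (i+1) ≤ 0 := by
        intro i
        induction i with
        | zero =>
          intro _
          refine ⟨ha, ?_⟩
          have : C * a 1 ≤ 0 := by rw [h0]; exact mul_nonpos_of_nonneg_of_nonpos (by linarith) ha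
          by_contra hc; push Not at hc
          have := mul_pos hC hc; linarith
        | succ i ih =>
          intro hi
          obtain ⟨i1, i2⟩ := ih (by omega)
          refine ⟨i2, ?_⟩
          have e := hrec i
          have := mul_nonpos_of_nonneg_of_nonpos (hκi (i+1) (by omega)).le i2
          have := mul_nonpos_of_nonneg_of_nonpos (hμ i).le i1
          by_contra hc; push Not at hc
          have := mul_pos hC hc; linarith
      have := (this l le_rfl).2
      linarith
    · have : ∀ i, i ≤ l → 0 < a i ∧ 0 < a (i+1) := by
        intro i
        induction i with
        | zero =>
          intro _
          refine ⟨ha, ?_⟩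
          have : 0 < C * a 1 := by rw [h0]; exact mul_pos (by linarith) ha
          exact (pos_iff_pos_of_mul_pos this).1 hC
        | succ i ih =>
          intro hi
          obtain ⟨i1, i2⟩ := ih (by omega)
          refine ⟨i2, ?_⟩
          have e := hrec i
          have := mul_pos (hκi (i+1) (by omega)) i2
          have := mul_pos (hμ i) i1
          have : 0 < C * a (i+2) := by linarith
          exact (pos_iff_pos_of_mul_pos this).1 hC
      have := (this l le_rfl).1
      linarith
  intro i; exact hms i (by omega)

/-- moments -/
noncomputable def mom (ψ : ℝ → ℝ) (j : ℕ) : ℝ := ∫ s in (-1:ℝ)..1, ψ s * s^j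

theorem mom_odd_zero {ψ : ℝ → ℝ} {j : ℕ} (h : ∀ x, ψ (-x) * (-x)^j = -(ψ x * x^j)) : mom ψ j = 0 := by
  have := intervalIntegral.integral_comp_neg (a := -1) (b := 1) (fun x => ψ x * x^j)
  simp only [h, neg_neg] at this
  rw [intervalIntegral.integral_neg] at this
  unfold mom
  linarith

namespace ProlSol
variable {c χ : ℝ} {ψ φ : ℝ → ℝ}

theorem ii (hc : Continuous ψ) (j : ℕ) (a b : ℝ) : IntervalIntegrable (fun s => ψ s * s^j) volume a b :=
  (by fun_prop : Continuous fun s => ψ s * s^j).intervalIntegrable _ _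

theorem mom_rec (h : ProlSol c χ ψ) (j : ℕ) :
    c^2 * mom ψ (j+4) = (χ - (j+2)*(j+3)) * mom ψ (j+2) + (j+2)*(j+1) * mom ψ j := by
  have hc := h.cont
  have := h.lagrange (k := fun s => s^(j+2)) (k1 := fun s => (j+2)*s^(j+1))
    (k2 := fun s => (j+2)*((j+1)*s^j - (j+3)*s^(j+2)))
    (fun x _ => by simpa using hasDerivAt_pow (j+2) x)
    (fun x _ => by
      have h1 := ((hasDerivAt_pow (j+1) x).sub (hasDerivAt_pow (j+3) x)).const_mul ((j:ℝ)+2)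
      have e : (fun x : ℝ => (1-x^2)*((j+2)*x^(j+1))) = fun x => ((j:ℝ)+2)*(x^(j+1) - x^(j+3)) := by
        funext x; ring
      rw [e]
      refine h1.congr_deriv ?_
      simp)
    (by fun_prop)
  have e : ∀ x : ℝ, ψ x * ((j+2)*((j+1)*x^j - (j+3)*x^(j+2)) + (χ - c^2*x^2)*x^(j+2))
      = ((j:ℝ)+2)*(j+1) * (ψ x * x^j) + (χ - (j+2)*(j+3)) * (ψ x * x^(j+2)) - c^2*(ψ x * x^(j+4)) := fun x => by ring
  simp only [e] at this
  rw [intervalIntegral.integral_sub, intervalIntegral.integral_add, intervalIntegral.integral_const_mul,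
    intervalIntegral.integral_const_mul, intervalIntegral.integral_const_mul] at this
  · unfold mom; linarith
  all_goals (apply Continuous.intervalIntegrable; fun_prop)

theorem mom_rec0 (h : ProlSol c χ ψ) : c^2 * mom ψ 2 = χ * mom ψ 0 := by
  have hc := h.cont
  have := h.lagrange (k := fun s => 1) (k1 := fun s => 0) (k2 := fun s => 0)
    (fun x _ => hasDerivAt_const _ _) (fun x _ => by simpa using hasDerivAt_const x (0:ℝ)) (by fun_prop)
  have e : ∀ x : ℝ, ψ x * (0 + (χ - c^2*x^2)*1) = χ * (ψ x * x^0) - c^2*(ψ x * x^2) := fun x => by ring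
  simp only [e] at this
  rw [intervalIntegral.integral_sub, intervalIntegral.integral_const_mul, intervalIntegral.integral_const_mul] at this
  · unfold mom; linarith
  all_goals (apply Continuous.intervalIntegrable; fun_prop)

theorem mom_rec1 (h : ProlSol c χ ψ) : c^2 * mom ψ 3 = (χ-2) * mom ψ 1 := by
  have hc := h.cont
  have := h.lagrange (k := fun s => s) (k1 := fun s => 1) (k2 := fun s => -(2*s))
    (fun x _ => hasDerivAt_id _) (fun x _ => by
      simpa using ((hasDerivAt_id x).pow 2).const_sub 1) (by fun_prop)
  have e : ∀ x : ℝ, ψ x * (-(2*x) + (χ - c^2*x^2)*x) = (χ-2) * (ψ x * x^1) - c^2*(ψ x * x^3) := fun x => by ring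
  simp only [e] at this
  rw [intervalIntegral.integral_sub, intervalIntegral.integral_const_mul, intervalIntegral.integral_const_mul] at this
  · unfold mom; linarith
  all_goals (apply Continuous.intervalIntegrable; fun_prop)

theorem mom_large (hc : Continuous ψ) (h1 : 0 < ψ 1) : ∃ N, ∀ j, N ≤ j →
    (∀ x, ψ (-x) * (-x)^j = ψ x * x^j) → 0 < mom ψ j := by
  obtain ⟨S, hS⟩ := (isCompact_Icc (a := (0:ℝ)) (b := 1)).exists_bound_of_continuousOn hc.continuousOn
  have hev : ∀ᶠ x in nhds (1:ℝ), ψ 1/2 < ψ x := hc.continuousAt.eventually_const_lt (by linarith)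
  rw [Metric.eventually_nhds_iff] at hev
  obtain ⟨e, he, hE⟩ := hev
  set q := max 0 (1 - e/2) with hq
  have hq0 : 0 ≤ q := le_max_left _ _
  have hq1 : q < 1 := max_lt (by norm_num) (by linarith)
  have hS0 : 0 ≤ S := le_trans (norm_nonneg _) (hS 0 ⟨le_rfl, by norm_num⟩)
  have ht := tendsto_self_mul_const_pow_of_lt_one hq0 hq1
  have ht2 := tendsto_pow_atTop_nhds_zero_of_lt_one hq0 hq1
  have ht3 := (ht.add ht2).mul_const (S + ψ 1/2)
  simp only [add_zero, zero_mul] at ht3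
  obtain ⟨N, hN⟩ := Filter.eventually_atTop.1 (ht3.eventually_lt_const (show 0 < ψ 1/2 by linarith))
  refine ⟨N, fun j hj hpar => ?_⟩
  have hNj := hN j hj
  have hii := fun a b => ii hc j a b
  have hm : mom ψ j = 2 * ∫ s in (0:ℝ)..1, ψ s * s^j := by
    unfold mom
    rw [← intervalIntegral.integral_add_adjacent_intervals (hii (-1) 0) (hii 0 1)]
    have := intervalIntegral.integral_comp_neg (a := 0) (b := 1) (fun x => ψ x * x^j)
    simp only [hpar, neg_zero] at this
    linarith
  have hlow : ∫ s in (0:ℝ)..1, (ψ 1/2 * s^j - (S + ψ 1/2) * q^j) ≤ ∫ s in (0:ℝ)..1, ψ s * s^j := by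
    apply intervalIntegral.integral_mono_on (by norm_num) _ (hii 0 1)
    · intro x hx
      have hx0 := pow_nonneg hx.1 j
      by_cases hxq : q ≤ x
      · have : ψ 1/2 < ψ x := by
          apply hE
          have : 1 - e/2 ≤ x := (le_max_right _ _).trans hxq
          rw [Real.dist_eq, abs_of_nonpos (by linarith [hx.2])]; linarith
        have := mul_le_mul_of_nonneg_right this.le hx0
        have : 0 ≤ (S + ψ 1/2)*q^j := by positivity
        linarith
      · push Not at hxq
        have h2 : x^j ≤ q^j := pow_le_pow_left₀ hx.1 hxq.le j
        have h3 : -S ≤ ψ x := by have := hS x hx; rw [norm_eq_abs, abs_le] at this; exact this.1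
        have := mul_le_mul_of_nonneg_right h3 hx0
        have := mul_le_mul_of_nonneg_left h2 (show 0 ≤ S + ψ 1/2 by positivity)
        linarith
    · apply Continuous.intervalIntegrable; fun_prop
  rw [intervalIntegral.integral_sub (by apply Continuous.intervalIntegrable; fun_prop) (by simp),
    intervalIntegral.integral_const_mul, integral_pow] at hlow
  simp at hlow
  rw [hm]
  have hj0 : (0:ℝ) < j + 1 := by positivity
  have : 0 < ψ 1/2 * ((j:ℝ)+1)⁻¹ - (S+ψ 1/2)*q^j := by
    rw [← mul_pos_iff_of_pos_left hj0]
    have : ((j:ℝ)+1) * (ψ 1/2 * ((j:ℝ)+1)⁻¹ - (S+ψ 1/2)*q^j) = ψ 1/2 - (j*q^j+q^j)*(S+ψ 1/2) := by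
      field_simp
    rw [this]; linarith
  linarith

theorem mom_even (h : ProlSol c χ ψ) (hc : 0 < c) (hχ : 2 < χ) (h1 : 0 < ψ 1) (hev : ∀ x, ψ (-x) = ψ x) (i : ℕ) :
    0 < mom ψ (2*i) := by
  obtain ⟨N, hN⟩ := mom_large h.cont h1
  refine rec_pos (a := fun i => mom ψ (2*i)) (C := c^2) (χ := χ) (κ := fun i => (2*i)*(2*i+1)) (μ := fun i => (2*i+2)*(2*i+1))
    (by positivity) (fun i => by positivity) (fun i j hij => ?_) (fun i => ?_) ?_ (by simp; linarith) ⟨N, fun i hi => ?_⟩ i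
  · have : (i:ℝ) ≤ j := by exact_mod_cast hij
    beta_reduce; gcongr
  · have := h.mom_rec (2*i)
    push_cast at *
    rw [show 2*(i+2) = 2*i+4 by ring, show 2*(i+1) = 2*i+2 by ring]
    linarith
  · simpa using h.mom_rec0
  · apply hN _ (by omega)
    intro x; rw [hev, neg_pow, pow_mul]; simp

theorem mom_odd (h : ProlSol c χ ψ) (hc : 0 < c) (hχ : 2 < χ) (h1 : 0 < ψ 1) (hod : ∀ x, ψ (-x) = - ψ x) (i : ℕ) :
    0 < mom ψ (2*i+1) := by
  obtain ⟨N, hN⟩ := mom_large h.cont h1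
  refine rec_pos (a := fun i => mom ψ (2*i+1)) (C := c^2) (χ := χ) (κ := fun i => (2*i+1)*(2*i+2)) (μ := fun i => (2*i+3)*(2*i+2))
    (by positivity) (fun i => by positivity) (fun i j hij => ?_) (fun i => ?_) ?_ (by simp; linarith) ⟨N, fun i hi => ?_⟩ i
  · have : (i:ℝ) ≤ j := by exact_mod_cast hij
    beta_reduce; gcongr
  · have := h.mom_rec (2*i+1)
    push_cast at *
    rw [show 2*(i+2)+1 = 2*i+1+4 by ring, show 2*(i+1)+1 = 2*i+1+2 by ring]
    linarith
  · simpa using h.mom_rec1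
  · apply hN _ (by omega)
    intro x; rw [hod, neg_pow, pow_succ, pow_mul]; simp

theorem mom_nonneg (h : ProlSol c χ ψ) (hc : 0 < c) (hχ : 2 < χ) (h1 : 0 < ψ 1) (j : ℕ) : 0 ≤ mom ψ j := by
  rcases h.parity with hp | hp <;> rcases Nat.even_or_odd' j with ⟨i, rfl | rfl⟩
  · exact (h.mom_even hc hχ h1 hp i).le
  · refine (mom_odd_zero fun x => ?_).ge
    rw [hp, neg_pow, pow_succ, pow_mul]; simp
  · refine (mom_odd_zero fun x => ?_).ge
    rw [hp, neg_pow, pow_mul]; simp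
  · exact (h.mom_odd hc hχ h1 hp i).le

theorem mom_hasSum (hcψ : Continuous ψ) {a : ℕ → ℝ} {f : ℝ → ℝ} (ha : ∀ j, 0 ≤ a j) (hs : Summable a)
    (hf : ∀ s ∈ Icc (-1:ℝ) 1, HasSum (fun j => a j * s^j) (f s)) :
    HasSum (fun j => a j * mom ψ j) (∫ s in (-1:ℝ)..1, ψ s * f s) := by
  obtain ⟨S, hS⟩ := (isCompact_Icc (a := (-1:ℝ)) (b := 1)).exists_bound_of_continuousOn hcψ.continuousOn
  have := intervalIntegral.hasSum_integral_of_dominated_convergence (μ := volume) (a := -1) (b := 1)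
    (F := fun j s => ψ s * (a j * s^j)) (f := fun s => ψ s * f s) (fun j _ => S * a j)
    (fun j => (by fun_prop : Continuous fun s => ψ s * (a j * s^j)).aestronglyMeasurable)
    (fun j => Filter.Eventually.of_forall fun s hs => ?_)
    (Filter.Eventually.of_forall fun s hs' => hs.mul_left S) (by simp)
    (Filter.Eventually.of_forall fun s hs => ?_)
  · have e : (fun j => a j * mom ψ j) = fun j => ∫ s in (-1:ℝ)..1, ψ s * (a j * s^j) := by
      funext j
      unfold mom
      rw [← intervalIntegral.integral_const_mul]
      congr 1; funext s; ring
    rw [e]; exact this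
  · rw [uIoc_of_le (by norm_num)] at hs
    have h1 := hS s ⟨hs.1.le, hs.2⟩
    have h2 : |s| ≤ 1 := abs_le.2 ⟨hs.1.le, hs.2⟩
    rw [norm_mul, norm_mul, norm_pow, norm_eq_abs (a j), norm_eq_abs s, abs_of_nonneg (ha j)]
    have h3 : |s|^j ≤ 1 := pow_le_one₀ (abs_nonneg _) h2
    have h4 : a j * |s|^j ≤ a j := mul_le_of_le_one_right (ha j) h3
    exact mul_le_mul h1 h4 (by have := ha j; positivity) ((norm_nonneg _).trans h1)
  · rw [uIoc_of_le (by norm_num)] at hs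
    exact (hf s ⟨hs.1.le, hs.2⟩).mul_left _

end ProlSol
end

section
/-- Cauchy-type transforms -/
noncomputable def Qk (ψ : ℝ → ℝ) (k : ℕ) (z : ℝ) : ℝ := ∫ s in (-1:ℝ)..1, ψ s * (1/(z-s)^k)

theorem Qk_cont {ψ : ℝ → ℝ} (hc : Continuous ψ) (k : ℕ) {z : ℝ} (hz : 1 < z) :
    ContinuousOn (fun s => ψ s * (1/(z-s)^k)) (Icc (-1) 1) := by
  apply hc.continuousOn.mul
  apply ContinuousOn.div continuousOn_const (by fun_prop)
  intro s hs; exact pow_ne_zero _ (by linarith [hs.2])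

theorem Qk_ii {ψ : ℝ → ℝ} (hc : Continuous ψ) (k : ℕ) {z : ℝ} (hz : 1 < z) :
    IntervalIntegrable (fun s => ψ s * (1/(z-s)^k)) volume (-1) 1 := by
  apply ContinuousOn.intervalIntegrable
  rw [uIcc_of_le (by norm_num)]; exact Qk_cont hc k hz

theorem Qk_deriv {ψ : ℝ → ℝ} (hc : Continuous ψ) (k : ℕ) {z : ℝ} (hz : 1 < z) :
    HasDerivAt (Qk ψ k) (-(k * Qk ψ (k+1) z)) z := by
  obtain ⟨S, hS⟩ := (isCompact_Icc (a := (-1:ℝ)) (b := 1)).exists_bound_of_continuousOn hc.continuousOn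
  set d := (z-1)/2 with hd
  have hd0 : 0 < d := by rw [hd]; linarith
  have key := (intervalIntegral.hasDerivAt_integral_of_dominated_loc_of_deriv_le (μ := volume) (a := -1) (b := 1)
    (F := fun z s => ψ s * (1/(z-s)^k)) (F' := fun z s => ψ s * (-(k * (1/(z-s)^(k+1))))) (x₀ := z)
    (s := Ioi (1+d)) (bound := fun _ => S * (k * (1/d^(k+1))))
    (Ioi_mem_nhds (by rw [hd]; linarith)) ?_ (Qk_ii hc k hz) ?_ ?_ (by simp) ?_).2
  · refine key.congr_deriv ?_
    unfold Qk
    rw [← intervalIntegral.integral_const_mul, ← intervalIntegral.integral_neg]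
    congr 1; funext s; ring
  · filter_upwards [Ioi_mem_nhds hz] with x hx
    exact (intervalIntegrable_iff.1 (Qk_ii hc k hx)).aestronglyMeasurable
  · have : IntervalIntegrable (fun s => ψ s * (-(k * (1/(z-s)^(k+1))))) volume (-1) 1 := by
      have := (Qk_ii hc (k+1) hz).const_mul (-(k:ℝ))
      refine this.congr ?_
      intro s _
      beta_reduce; ring
    exact (intervalIntegrable_iff.1 this).aestronglyMeasurable
  · refine Filter.Eventually.of_forall fun s hs x hx => ?_
    rw [uIoc_of_le (by norm_num)] at hs
    have h1 := hS s ⟨hs.1.le, hs.2⟩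
    have hx : 1 + d < x := hx
    have h2 : d ≤ x - s := by linarith [hs.2]
    rw [norm_mul, norm_neg]
    apply mul_le_mul h1 _ (norm_nonneg _) ((norm_nonneg _).trans h1)
    have : 0 < x - s := by linarith
    rw [norm_of_nonneg (by positivity)]
    gcongr
  · refine Filter.Eventually.of_forall fun s hs x hx => ?_
    rw [uIoc_of_le (by norm_num)] at hs
    have hx : 1 + d < x := hx
    have h2 : x - s ≠ 0 := by linarith [hs.2]
    have h3 : HasDerivAt (fun x => (x-s)^k) (k*(x-s)^(k-1)) x := by
      simpa using ((hasDerivAt_id x).sub_const s).fun_pow k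
    have h4 : HasDerivAt (fun x => 1/(x-s)^k) (-(k * (1/(x-s)^(k+1)))) x := by
      have := h3.fun_inv (pow_ne_zero k h2)
      simp only [one_div]
      refine this.congr_deriv ?_
      rcases k with _ | k
      · simp
      · simp only [Nat.add_sub_cancel]
        field_simp
        try ring
    exact h4.const_mul _

namespace ProlSol
variable {c χ : ℝ} {ψ φ : ℝ → ℝ}

theorem Q_split (hc : Continuous ψ) {z : ℝ} (hz : 1 < z) :
    ∫ s in (-1:ℝ)..1, ψ s * (s^2 * (1/(z-s))) = z^2 * Qk ψ 1 z - z * mom ψ 0 - mom ψ 1 := by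
  have h1 := Qk_ii hc 1 hz
  unfold Qk mom
  rw [← intervalIntegral.integral_const_mul, ← intervalIntegral.integral_const_mul,
    ← intervalIntegral.integral_sub (h1.const_mul _) ((ii hc 0 _ _).const_mul _),
    ← intervalIntegral.integral_sub ((h1.const_mul _).sub ((ii hc 0 _ _).const_mul _)) (ii hc 1 _ _)]
  apply intervalIntegral.integral_congr
  intro s hs
  rw [uIcc_of_le (by norm_num)] at hs
  have : z - s ≠ 0 := by linarith [hs.2]
  beta_reduce
  field_simp
  ring

theorem Q_ode (h : ProlSol c χ ψ) {z : ℝ} (hz : 1 < z) :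
    HasDerivAt (fun z => (z^2-1) * (-(Qk ψ 2 z)))
      ((χ - c^2*z^2) * Qk ψ 1 z + c^2*(z * mom ψ 0 + mom ψ 1)) z := by
  have hc := h.cont
  have d1 : HasDerivAt (fun z : ℝ => z^2-1) (2*z) z := by
    simpa using ((hasDerivAt_id z).pow 2).sub_const 1
  have hd := d1.fun_mul (Qk_deriv hc 2 hz).fun_neg
  refine hd.congr_deriv ?_
  have hne : ∀ x ∈ Icc (-1:ℝ) 1, z - x ≠ 0 := fun x hx => by linarith [hx.2]
  have hL := h.lagrange (k := fun s => 1/(z-s)) (k1 := fun s => 1/(z-s)^2)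
    (k2 := fun s => -(2*s)*(1/(z-s)^2) + 2*(1-s^2)*(1/(z-s)^3))
    (fun x hx => by
      have h1 : HasDerivAt (fun s : ℝ => z - s) (-1) x := by simpa using (hasDerivAt_id x).const_sub z
      have := h1.fun_inv (hne x hx)
      simp only [one_div]
      refine this.congr_deriv ?_
      field_simp)
    (fun x hx => by
      have h1 : HasDerivAt (fun s : ℝ => z - s) (-1) x := by simpa using (hasDerivAt_id x).const_sub z
      have h2 := (h1.fun_pow 2).fun_inv (pow_ne_zero 2 (hne x hx))
      have h3 : HasDerivAt (fun s : ℝ => 1 - s^2) (-(2*x)) x := by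
        simpa using ((hasDerivAt_id x).pow 2).const_sub 1
      simp only [one_div]
      refine (h3.fun_mul h2).congr_deriv ?_
      have := hne x hx
      field_simp
      ring)
    (by
      have hne' : ∀ x ∈ Icc (-1:ℝ) 1, (z - x)^2 ≠ 0 := fun x hx => pow_ne_zero _ (hne x hx)
      have hne3 : ∀ x ∈ Icc (-1:ℝ) 1, (z - x)^3 ≠ 0 := fun x hx => pow_ne_zero _ (hne x hx)
      exact ((by fun_prop : ContinuousOn (fun s : ℝ => -(2*s)) (Icc (-1) 1)).mul
        (continuousOn_const.div (by fun_prop) hne')).add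
        ((by fun_prop : ContinuousOn (fun s : ℝ => 2*(1-s^2)) (Icc (-1) 1)).mul
        (continuousOn_const.div (by fun_prop) hne3)))
  have hsp := Q_split hc hz
  have i1 := Qk_ii hc 1 hz
  have i2 := Qk_ii hc 2 hz
  have i3 := Qk_ii hc 3 hz
  have i4 : IntervalIntegrable (fun s => ψ s * (s^2 * (1/(z-s)))) volume (-1) 1 := by
    apply ContinuousOn.intervalIntegrable
    rw [uIcc_of_le (by norm_num)]
    have := ((hc.continuousOn (s := Icc (-1:ℝ) 1)).mul ((by fun_prop : ContinuousOn (fun s : ℝ => s^2) (Icc (-1) 1)).mul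
      ((continuousOn_const (c := (1:ℝ))).div (by fun_prop : ContinuousOn (fun s : ℝ => z - s) (Icc (-1) 1)) hne)))
    exact this
  have hL2 : ∫ x in (-1:ℝ)..1, (2*z*(ψ x * (1/(z-x)^2)) - 2*(z^2-1)*(ψ x * (1/(z-x)^3)) + χ*(ψ x * (1/(z-x)^1))
      - c^2*(ψ x * (x^2 * (1/(z-x))))) = 0 := by
    rw [← hL]
    apply intervalIntegral.integral_congr
    intro s hs
    rw [uIcc_of_le (by norm_num)] at hs
    have := hne s hs
    beta_reduce
    field_simp
    ring
  rw [intervalIntegral.integral_sub (((i2.const_mul _).sub (i3.const_mul _)).add (i1.const_mul _)) (i4.const_mul _),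
    intervalIntegral.integral_add ((i2.const_mul _).sub (i3.const_mul _)) (i1.const_mul _),
    intervalIntegral.integral_sub (i2.const_mul _) (i3.const_mul _)] at hL2
  simp only [intervalIntegral.integral_const_mul] at hL2
  rw [hsp] at hL2
  unfold Qk at *
  push_cast
  linarith

theorem Q_hasSum (hcψ : Continuous ψ) {z : ℝ} (hz : 1 < z) :
    HasSum (fun j => (1/z)^j * mom ψ j) (z * Qk ψ 1 z) := by
  have hz0 : 0 < z := by linarith
  have hz1 : 1/z < 1 := by rw [div_lt_one hz0]; exact hz
  have := mom_hasSum hcψ (a := fun j => (1/z)^j) (f := fun s => z * (1/(z-s)^1)) (fun j => by positivity)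
    (summable_geometric_of_lt_one (by positivity) hz1) (fun s hs => by
      have h1 : ‖s/z‖ < 1 := by
        rw [norm_eq_abs, abs_div, abs_of_pos hz0, div_lt_one hz0]
        exact lt_of_le_of_lt (abs_le.2 hs) hz
      have := hasSum_geometric_of_norm_lt_one h1
      have hne : z - s ≠ 0 := by linarith [hs.2]
      have e1 : (fun j => (1/z)^j * s^j) = fun n => (s/z)^n := by funext j; rw [← mul_pow]; congr 1; ring
      have e2 : z * (1/(z-s)^1) = (1 - s/z)⁻¹ := by
        have e : 1 - s/z = (z-s)/z := by field_simp
        rw [e, inv_div]; ring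
      rw [e1, e2]; exact this)
  convert this using 1
  unfold Qk
  rw [← intervalIntegral.integral_const_mul]
  congr 1; funext s; ring

theorem Q_facts (h : ProlSol c χ ψ) (hc : 0 < c) (hχ : 2 < χ) (h1 : 0 < ψ 1) {z : ℝ} (hz : 1 < z) :
    0 ≤ Qk ψ 1 z ∧ mom ψ 0 ≤ z * Qk ψ 1 z ∧ Qk ψ 1 z ≤ z * Qk ψ 2 z := by
  have hcψ := h.cont
  have hz0 : 0 < z := by linarith
  have hM := h.mom_nonneg hc hχ h1
  have hS := Q_hasSum hcψ hz
  have a2 : mom ψ 0 ≤ z * Qk ψ 1 z := by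
    have := le_hasSum hS 0 (fun j _ => mul_nonneg (by positivity) (hM j))
    simpa using this
  have a1 : 0 ≤ Qk ψ 1 z := by
    have : 0 ≤ z * Qk ψ 1 z := (hM 0).trans a2
    exact nonneg_of_mul_nonneg_right this hz0
  refine ⟨a1, a2, ?_⟩
  have hz1 : 1/z < 1 := by rw [div_lt_one hz0]; exact hz
  have hn : ‖(1/z : ℝ)‖ < 1 := by rw [norm_of_nonneg (by positivity)]; exact hz1
  have hsm : Summable (fun n : ℕ => (n:ℝ) * (1/z)^n) := (hasSum_coe_mul_geometric_of_norm_lt_one hn).summable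
  have := mom_hasSum hcψ (a := fun j : ℕ => 1/z*((j:ℝ)*(1/z)^j)) (f := fun s => z*(1/(z-s)^2) - 1/(z-s)^1) (fun j => by positivity)
    (hsm.mul_left _)
    (fun s hs => by
      have h1 : ‖s/z‖ < 1 := by
        rw [norm_eq_abs, abs_div, abs_of_pos hz0, div_lt_one hz0]
        exact lt_of_le_of_lt (abs_le.2 hs) hz
      have := (hasSum_coe_mul_geometric_of_norm_lt_one h1).mul_left (1/z)
      have hne : z - s ≠ 0 := by linarith [hs.2]
      have e1 : (fun j : ℕ => 1/z*(j*(1/z)^j) * s^j) = fun n : ℕ => 1/z * (n * (s/z)^n) := by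
        funext j
        have : (s/z)^j = (1/z)^j * s^j := by rw [← mul_pow]; congr 1; ring
        rw [this]; ring
      have e2 : z * (1/(z-s)^2) - 1/(z-s)^1 = 1/z * (s/z/(1 - s/z)^2) := by
        have e : 1 - s/z = (z-s)/z := by field_simp
        rw [e]
        field_simp
        ring
      rw [e1, e2]; exact this)
  have h2 := this.nonneg (fun j => mul_nonneg (by positivity) (hM j))
  have e : ∫ s in (-1:ℝ)..1, ψ s * (z*(1/(z-s)^2) - 1/(z-s)^1) = z * Qk ψ 2 z - Qk ψ 1 z := by
    unfold Qk
    rw [← intervalIntegral.integral_const_mul, ← intervalIntegral.integral_sub ((Qk_ii hcψ 2 hz).const_mul _) (Qk_ii hcψ 1 hz)]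
    congr 1; funext s; ring
  linarith

/-- monotone decay of the regularised transform -/
theorem Qhat_mono (h : ProlSol c χ ψ) (hc : 0 < c) (hχ : 2 < χ) (h1 : 0 < ψ 1) {R t : ℝ} (hR : 1 < R) (ht : R ≤ t) :
    t * (t * Qk ψ 1 t - mom ψ 0) ≤ R * (R * Qk ψ 1 R - mom ψ 0) := by
  have hM := h.mom_nonneg hc hχ h1
  have s1 := (Q_hasSum h.cont hR).mul_left R
  have s2 := (Q_hasSum h.cont (hR.trans_le ht)).mul_left t
  have hR0 : 0 < R := by linarith
  have ht0 : 0 < t := by linarith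
  have := le_hasSum (s1.sub s2) 0 (fun j hj => by
    obtain ⟨i, rfl⟩ := Nat.exists_eq_succ_of_ne_zero hj
    have e : R * ((1/R)^(i+1) * mom ψ (i+1)) - t * ((1/t)^(i+1) * mom ψ (i+1)) = ((1/R)^i - (1/t)^i) * mom ψ (i+1) := by
      rw [pow_succ, pow_succ]; field_simp
    rw [e]
    apply mul_nonneg _ (hM _)
    have : (1/t)^i ≤ (1/R)^i := by gcongr
    linarith)
  simp at this
  linarith

theorem Q2_le (h : ProlSol c χ ψ) {R : ℝ} (hc : 0 < c) (hR : 1 < R) (hχ : χ = c^2*R^2) (h1 : 0 < ψ 1) {z : ℝ} (hz : 1 < z) :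
    Qk ψ 2 z ≤ 2 * ψ 1/(z^2-1) ∧ (z^2-1) * Qk ψ 1 z ≤ 2 * ψ 1 * √(z^2-1) := by
  have hcψ := h.cont
  have hz2 : 0 < z^2-1 := by nlinarith
  have habs : ∀ x ∈ Icc (-1:ℝ) 1, ψ x ≤ ψ 1 := fun x hx => by
    have := h.le_one hc hR hχ hx
    exact (abs_le_of_sq_le_sq' this h1.le).2
  have hint : ∫ s in (-1:ℝ)..1, 1/(z-s)^2 = 2/(z^2-1) := by
    rw [intervalIntegral.integral_eq_sub_of_hasDerivAt (f := fun s => 1/(z-s))]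
    · have : z - 1 ≠ 0 := by linarith
      have : z + 1 ≠ 0 := by linarith
      have e : z^2-1 = (z-1)*(z+1) := by ring
      rw [e, sub_neg_eq_add]; field_simp; ring
    · intro x hx
      rw [uIcc_of_le (by norm_num)] at hx
      have hne : z - x ≠ 0 := by linarith [hx.2]
      have h1 : HasDerivAt (fun s : ℝ => z - s) (-1) x := by simpa using (hasDerivAt_id x).const_sub z
      have := h1.fun_inv hne
      simp only [one_div]
      refine this.congr_deriv ?_
      field_simp
    · simpa using Qk_ii (ψ := fun _ => 1) continuous_const 2 hz
  have i2 : IntervalIntegrable (fun s => 1/(z-s)^2) volume (-1) 1 := by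
    simpa using Qk_ii (ψ := fun _ => 1) continuous_const 2 hz
  constructor
  · have : Qk ψ 2 z ≤ ∫ s in (-1:ℝ)..1, ψ 1 * (1/(z-s)^2) := by
      unfold Qk
      apply intervalIntegral.integral_mono_on (by norm_num) (Qk_ii hcψ 2 hz) (i2.const_mul _)
      intro x hx
      exact mul_le_mul_of_nonneg_right (habs x hx) (by positivity)
    rw [intervalIntegral.integral_const_mul, hint] at this
    refine this.trans (le_of_eq ?_)
    ring
  · set a := √(z^2-1) with ha
    have ha0 : 0 < a := sqrt_pos.2 hz2
    have ha2 : a^2 = z^2-1 := sq_sqrt hz2.le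
    have : Qk ψ 1 z ≤ ∫ s in (-1:ℝ)..1, ψ 1 * (1/2*(1/a) + 1/2*a*(1/(z-s)^2)) := by
      unfold Qk
      apply intervalIntegral.integral_mono_on (by norm_num) (Qk_ii hcψ 1 hz)
        (((by simp : IntervalIntegrable (fun _ => 1/2*(1/a)) volume (-1) 1).add (i2.const_mul _)).const_mul _)
      intro x hx
      have hzx : 0 < z - x := by linarith [hx.2]
      refine (mul_le_mul_of_nonneg_right (habs x hx) (by positivity)).trans (mul_le_mul_of_nonneg_left ?_ h1.le)
      have e : 1/2*(1/a) + 1/2*a*(1/(z-x)^2) - 1/(z-x)^1 = ((z-x) - a)^2/(2*a*(z-x)^2) := by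
        field_simp; ring
      have : 0 ≤ ((z-x) - a)^2/(2*a*(z-x)^2) := by positivity
      linarith
    rw [intervalIntegral.integral_const_mul, intervalIntegral.integral_add (by simp) (i2.const_mul _),
      intervalIntegral.integral_const_mul (r := 1/2*a), hint] at this
    simp only [intervalIntegral.integral_const, smul_eq_mul] at this
    rw [← ha2] at this ⊢
    have e : ψ 1 * ((1 - -1) * (1/2*(1/a)) + 1/2*a*(2/a^2)) = 2*ψ 1/a := by field_simp; ring
    rw [e] at this
    calc a^2 * Qk ψ 1 z ≤ a^2 * (2*ψ 1/a) := mul_le_mul_of_nonneg_left this (by positivity)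
      _ = 2*ψ 1*a := by field_simp

theorem Q_at_R (h : ProlSol c χ ψ) {R : ℝ} (hc : 0 < c) (hR : 1 < R) (hχ : χ = c^2*R^2) (h1 : 0 < ψ 1) (hχ2 : 2 < χ) :
    (R^2-1) * ψ R * Qk ψ 1 R ≤ 2 * R * (ψ 1)^2 := by
  have hcψ := h.cont
  have hcψ' := h.cont'
  have hb := h.barrier_pos hR hχ h1
  have hM := h.mom_nonneg hc hχ2 h1
  have hw : ∀ z, 1 < z → HasDerivAt (fun z => ψ z * ((z^2-1) * (-(Qk ψ 2 z))) - ((z^2-1)*deriv ψ z) * Qk ψ 1 z)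
      (c^2 * ψ z * (z * mom ψ 0 + mom ψ 1)) z := fun z hz => by
    refine (((h.hd z).fun_mul (h.Q_ode hz)).fun_sub ((h.hP z).fun_mul (Qk_deriv hcψ 1 hz))).congr_deriv ?_
    push_cast
    ring
  have hψR : 0 < ψ R := lt_of_lt_of_le h1 (hb R ⟨hR.le, le_rfl⟩).1
  have key : ∀ z ∈ Ioo 1 R, -(2*ψ 1*ψ z) - |deriv ψ z| * (2 * ψ 1 * √(z^2-1)) ≤
      ψ R * ((R^2-1) * (-(Qk ψ 2 R))) - ((R^2-1)*deriv ψ R) * Qk ψ 1 R := by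
    intro z hz
    have hm := mono_help hz.2.le (fun x hx => (hw x (hz.1.trans_le hx.1)).continuousAt.continuousWithinAt)
      (fun x hx => hw x (hz.1.trans hx.1)) (fun x hx => by
        have h1x : 1 < x := hz.1.trans hx.1
        have : 0 ≤ ψ x := h1.le.trans (hb x ⟨h1x.le, hx.2.le⟩).1
        have := hM 0
        have := hM 1
        positivity)
    refine le_trans ?_ hm
    obtain ⟨q2, q1⟩ := h.Q2_le hc hR hχ h1 hz.1
    obtain ⟨f1, -, -⟩ := h.Q_facts hc hχ2 h1 hz.1
    have hz2 : 0 < z^2-1 := by nlinarith [hz.1]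
    have hψz : 0 ≤ ψ z := h1.le.trans (hb z ⟨hz.1.le, hz.2.le⟩).1
    have b1 : ψ z * ((z^2-1) * Qk ψ 2 z) ≤ ψ z * (2*ψ 1) := by
      apply mul_le_mul_of_nonneg_left _ hψz
      rw [le_div_iff₀ hz2] at q2; linarith
    have b2 : ((z^2-1)*deriv ψ z) * Qk ψ 1 z ≤ |deriv ψ z| * (2 * ψ 1 * √(z^2-1)) := by
      calc ((z^2-1)*deriv ψ z) * Qk ψ 1 z = deriv ψ z * ((z^2-1) * Qk ψ 1 z) := by ring
        _ ≤ |deriv ψ z| * ((z^2-1) * Qk ψ 1 z) := mul_le_mul_of_nonneg_right (le_abs_self _) (by positivity)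
        _ ≤ _ := mul_le_mul_of_nonneg_left q1 (abs_nonneg _)
    linarith
  have hlim : Filter.Tendsto (fun z => -(2*ψ 1*ψ z) - |deriv ψ z| * (2 * ψ 1 * √(z^2-1))) (nhdsWithin 1 (Ioi 1))
      (nhds (-(2*(ψ 1)^2))) := by
    have hcont : Continuous (fun z => -(2*ψ 1*ψ z) - |deriv ψ z| * (2 * ψ 1 * √(z^2-1))) := by fun_prop
    have := (hcont.tendsto 1).mono_left (nhdsWithin_le_nhds (s := Ioi (1:ℝ)))
    convert this using 2
    norm_num; ring
  have hfin := le_of_tendsto hlim (by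
    filter_upwards [Ioo_mem_nhdsGT hR] with z hz
    exact key z hz)
  obtain ⟨f1, -, f3⟩ := h.Q_facts hc hχ2 h1 hR
  have hR2 : 0 < R^2-1 := by nlinarith
  have g1 : 0 ≤ ((R^2-1)*deriv ψ R) * Qk ψ 1 R := mul_nonneg (hb R ⟨hR.le, le_rfl⟩).2 f1
  have g2 : (R^2-1) * ψ R * Qk ψ 2 R ≤ 2*(ψ 1)^2 := by linarith
  calc (R^2-1) * ψ R * Qk ψ 1 R ≤ (R^2-1) * ψ R * (R * Qk ψ 2 R) := mul_le_mul_of_nonneg_left f3 (by positivity)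
    _ = R * ((R^2-1) * ψ R * Qk ψ 2 R) := by ring
    _ ≤ R * (2*(ψ 1)^2) := mul_le_mul_of_nonneg_left g2 (by linarith)
    _ = _ := by ring

/-- The key exponential smallness. -/
theorem Q_small (h : ProlSol c χ ψ) {R g : ℝ} (hc : 0 < c) (hR : 1 < R) (hχ : χ = c^2*R^2) (h1 : 0 < ψ 1) (hχ2 : 2 < χ)
    (hg : g = c*(R-1/R)) (hg1 : 1 < g) : Qk ψ 1 R ≤ 2 * c * ψ 1 * exp (1 - π*g/4) := by
  have a := h.Q_at_R hc hR hχ h1 hχ2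
  have b := h.growth hc hR hχ h1 hg hg1
  obtain ⟨f1, -, -⟩ := h.Q_facts hc hχ2 h1 hR
  have hR0 : 0 < R := by linarith
  have hR2 : 0 < R^2-1 := by nlinarith
  have hg0 : 0 < g := by linarith
  have e : R^2-1 = g*R/c := by rw [hg]; field_simp
  have hE := exp_pos (π*g/4 - 1)
  have c1 : (R^2-1) * (ψ 1 * exp (π*g/4-1)/g) * Qk ψ 1 R ≤ 2*R*(ψ 1)^2 := by
    refine le_trans ?_ a
    gcongr
  have e2 : (R^2-1) * (ψ 1 * exp (π*g/4-1)/g) * Qk ψ 1 R = (R * ψ 1) * (exp (π*g/4-1)/c * Qk ψ 1 R) := by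
    rw [e]; field_simp
  have e3 : 2*R*(ψ 1)^2 = (R * ψ 1) * (2*ψ 1) := by ring
  rw [e2, e3, mul_le_mul_iff_right₀ (by positivity)] at c1
  have e4 : exp (1-π*g/4) = 1/exp (π*g/4-1) := by rw [one_div, ← exp_neg]; ring_nf
  rw [e4, mul_one_div, le_div_iff₀ hE]
  have := mul_le_mul_of_nonneg_left c1 hc.le
  have e5 : c * (exp (π*g/4-1)/c * Qk ψ 1 R) = Qk ψ 1 R * exp (π*g/4-1) := by field_simp
  linarith

end ProlSol
end

section
namespace ProlSol
variable {c χ : ℝ} {ψ φ : ℝ → ℝ}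

theorem e0_ge (h : ProlSol c χ ψ) {R : ℝ} (hc : 0 < c) (hR : 1 < R) (hχ : χ = c^2*R^2)
    (hnorm : ∫ t in (-1:ℝ)..1, (ψ t)^2 = 1) :
    c^2*(R^2-1)/4 ≤ χ*(ψ 0)^2 + (deriv ψ 0)^2 := by
  by_contra hcon
  push Not at hcon
  have hR0 : 0 < R := by linarith
  have hcont := h.cont
  have hcont' := h.cont'
  have hE2 : ∀ z, HasDerivAt (fun z => ((1-z^2)*deriv ψ z)^2 + (1-z^2)*(χ-c^2*z^2)*(ψ z)^2)
      (-(2*z*((χ-c^2*z^2)+c^2*(1-z^2))*(ψ z)^2)) z := by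
    intro z
    have d1 : HasDerivAt (fun x => χ - c^2*x^2) (-(c^2*(2*z))) z := by
      simpa using (((hasDerivAt_id z).pow 2).const_mul (c^2)).const_sub χ
    have d0 : HasDerivAt (fun x : ℝ => 1 - x^2) (-(2*z)) z := by
      simpa using ((hasDerivAt_id z).pow 2).const_sub 1
    refine (((h.hp z).fun_pow 2).fun_add ((d0.fun_mul d1).fun_mul ((h.hd z).fun_pow 2))).congr_deriv ?_
    norm_num
    ring
  have hqlow : ∀ z ∈ Icc (0:ℝ) 1, c^2*(R^2-1) ≤ χ - c^2*z^2 := fun z hz => by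
    have : z^2 ≤ 1 := by nlinarith [hz.1, hz.2]
    rw [hχ]; nlinarith [mul_le_mul_of_nonneg_left this (sq_nonneg c)]
  have hcR : 0 < c^2*(R^2-1) := by
    have : 0 < R^2-1 := by nlinarith
    positivity
  have hχ0 : 0 < χ := by rw [hχ]; positivity
  have hI := intervalIntegral.integral_eq_sub_of_hasDerivAt (a := 0) (b := 1) (fun z _ => hE2 z) (by
    apply Continuous.intervalIntegrable; fun_prop)
  norm_num at hI
  -- bound near zero
  have hnear : ∀ z ∈ Icc (0:ℝ) (1/2), (ψ z)^2 ≤ 0.4445 := by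
    intro z hz
    have hz1 : z ∈ Icc (0:ℝ) 1 := ⟨hz.1, by linarith [hz.2]⟩
    have := anti_help (f' := fun z => (-(2*z*((χ-c^2*z^2)+c^2*(1-z^2))*(ψ z)^2))) hz.1 (by fun_prop)
      (fun y _ => hE2 y) (fun y hy => by
        have hy1 : y ∈ Icc (0:ℝ) 1 := ⟨hy.1.le, by linarith [hy.2, hz.2]⟩
        have := hqlow y hy1
        have h3 : 0 ≤ 1 - y^2 := by nlinarith [hy1.1, hy1.2]
        have h4 : 0 ≤ (χ-c^2*y^2)+c^2*(1-y^2) := by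
          have : 0 ≤ c^2*(1-y^2) := by positivity
          linarith
        have := mul_nonneg (mul_nonneg (mul_nonneg (by norm_num : (0:ℝ) ≤ 2) hy1.1) h4) (sq_nonneg (ψ y))
        linarith)
    norm_num at this
    have hz2 : z^2 ≤ 1/4 := by nlinarith [hz.1, hz.2]
    have h5 : χ*(3/4) ≤ χ - c^2*z^2 := by
      have h6 : c^2*z^2*1 ≤ c^2*z^2*R^2 := mul_le_mul_of_nonneg_left (by nlinarith) (by positivity)
      have h7 : c^2*R^2*z^2 ≤ c^2*R^2*(1/4) := mul_le_mul_of_nonneg_left hz2 (by positivity)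
      rw [hχ]; linarith
    have h8 : (3/4)*(χ*(3/4)) ≤ (1-z^2)*(χ-c^2*z^2) :=
      mul_le_mul (by linarith) h5 (by positivity) (by linarith)
    have h9 : (3/4)*(χ*(3/4))*(ψ z)^2 ≤ χ*(ψ 0)^2 + (deriv ψ 0)^2 := by
      have := mul_le_mul_of_nonneg_right h8 (sq_nonneg (ψ z))
      have := sq_nonneg ((1-z^2)*deriv ψ z)
      linarith
    have h10 : χ * ((9/16)*(ψ z)^2) ≤ χ * (1/4) := by
      have : c^2*(R^2-1) ≤ χ := by rw [hχ]; nlinarith [sq_nonneg c]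
      linarith
    have h11 := le_of_mul_le_mul_left h10 hχ0
    norm_num
    linarith
  have hhalf : ∫ z in (0:ℝ)..1, (ψ z)^2 = 1/2 := by
    have h1 : ∫ z in (-1:ℝ)..0, (ψ z)^2 = ∫ z in (0:ℝ)..1, (ψ z)^2 := by
      have := intervalIntegral.integral_comp_neg (a := 0) (b := 1) (fun x => (ψ x)^2)
      simp only [h.abs_symm] at this
      simpa using this.symm
    have h2 := intervalIntegral.integral_add_adjacent_intervals (a := (-1:ℝ)) (b := 0) (c := 1) (f := fun z => (ψ z)^2)
      (μ := volume) (by apply Continuous.intervalIntegrable; fun_prop) (by apply Continuous.intervalIntegrable; fun_prop)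
    rw [h1, hnorm] at h2
    linarith
  have hsplit := intervalIntegral.integral_add_adjacent_intervals (a := (0:ℝ)) (b := 1/2) (c := 1) (f := fun z => (ψ z)^2)
      (μ := volume) (by apply Continuous.intervalIntegrable; fun_prop) (by apply Continuous.intervalIntegrable; fun_prop)
  have hn2 : ∫ z in (0:ℝ)..(1/2), (ψ z)^2 ≤ ∫ z in (0:ℝ)..(1/2), (0.4445:ℝ) := by
    apply intervalIntegral.integral_mono_on (by norm_num) (by apply Continuous.intervalIntegrable; fun_prop) (by simp)
    exact hnear
  rw [hhalf] at hsplit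
  norm_num at hn2
  have hout : (1/4:ℝ) ≤ ∫ z in (1/2:ℝ)..1, (ψ z)^2 := by linarith
  have hfinal : c^2*(R^2-1) * ∫ z in (1/2:ℝ)..1, (ψ z)^2 ≤ ∫ z in (0:ℝ)..1, 2*z*((χ-c^2*z^2)+c^2*(1-z^2))*(ψ z)^2 := by
    have h2 := intervalIntegral.integral_add_adjacent_intervals (a := (0:ℝ)) (b := 1/2) (c := 1)
      (f := fun z => 2*z*((χ-c^2*z^2)+c^2*(1-z^2))*(ψ z)^2)
      (μ := volume) (by apply Continuous.intervalIntegrable; fun_prop) (by apply Continuous.intervalIntegrable; fun_prop)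
    rw [← h2, ← intervalIntegral.integral_const_mul]
    have hge : ∀ z ∈ Icc (0:ℝ) 1, c^2*(R^2-1) ≤ (χ-c^2*z^2)+c^2*(1-z^2) := fun z hz => by
      have := hqlow z hz
      have h3 : 0 ≤ 1 - z^2 := by nlinarith [hz.1, hz.2]
      have : 0 ≤ c^2*(1-z^2) := by positivity
      linarith
    have h3 : 0 ≤ ∫ z in (0:ℝ)..(1/2), 2*z*((χ-c^2*z^2)+c^2*(1-z^2))*(ψ z)^2 := by
      apply intervalIntegral.integral_nonneg (by norm_num)
      intro z hz
      have := hge z ⟨hz.1, by linarith [hz.2]⟩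
      exact mul_nonneg (mul_nonneg (by linarith [hz.1]) (by linarith)) (sq_nonneg _)
    have h4 : ∫ z in (1/2:ℝ)..1, c^2*(R^2-1)*(ψ z)^2 ≤ ∫ z in (1/2:ℝ)..1, 2*z*((χ-c^2*z^2)+c^2*(1-z^2))*(ψ z)^2 := by
      apply intervalIntegral.integral_mono_on (by norm_num) (by apply Continuous.intervalIntegrable; fun_prop)
        (by apply Continuous.intervalIntegrable; fun_prop)
      intro z hz
      apply mul_le_mul_of_nonneg_right _ (sq_nonneg _)
      have := hge z ⟨by linarith [hz.1], hz.2⟩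
      nlinarith [hz.1]
    linarith
  have h14 := mul_le_mul_of_nonneg_left hout hcR.le
  linarith

theorem Q_at_rho (h : ProlSol c χ ψ) {R : ℝ} (hc : 0 < c) (hR : 1 < R) (hχ : χ = c^2*R^2) (h1 : 0 < ψ 1) (hχ2 : 2 < χ) {ρ : ℝ} (hρ : 1 < ρ) (hρR : ρ ≤ R) :
    (ρ^2-1) * ψ ρ * Qk ψ 1 ρ ≤ 2 * ρ * (ψ 1)^2 := by
  have hcψ := h.cont
  have hcψ' := h.cont'
  have hb := h.barrier_pos hR hχ h1
  have hM := h.mom_nonneg hc hχ2 h1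
  have hw : ∀ z, 1 < z → HasDerivAt (fun z => ψ z * ((z^2-1) * (-(Qk ψ 2 z))) - ((z^2-1)*deriv ψ z) * Qk ψ 1 z)
      (c^2 * ψ z * (z * mom ψ 0 + mom ψ 1)) z := fun z hz => by
    refine (((h.hd z).fun_mul (h.Q_ode hz)).fun_sub ((h.hP z).fun_mul (Qk_deriv hcψ 1 hz))).congr_deriv ?_
    push_cast
    ring
  have hψρ : 0 < ψ ρ := lt_of_lt_of_le h1 (hb ρ ⟨hρ.le, hρR⟩).1
  have key : ∀ z ∈ Ioo 1 ρ, -(2*ψ 1*ψ z) - |deriv ψ z| * (2 * ψ 1 * √(z^2-1)) ≤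
      ψ ρ * ((ρ^2-1) * (-(Qk ψ 2 ρ))) - ((ρ^2-1)*deriv ψ ρ) * Qk ψ 1 ρ := by
    intro z hz
    have hm := mono_help hz.2.le (fun x hx => (hw x (hz.1.trans_le hx.1)).continuousAt.continuousWithinAt)
      (fun x hx => hw x (hz.1.trans hx.1)) (fun x hx => by
        have h1x : 1 < x := hz.1.trans hx.1
        have : 0 ≤ ψ x := h1.le.trans (hb x ⟨h1x.le, hx.2.le.trans hρR⟩).1
        have := hM 0
        have := hM 1
        positivity)
    refine le_trans ?_ hm
    obtain ⟨q2, q1⟩ := h.Q2_le hc hR hχ h1 hz.1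
    obtain ⟨f1, -, -⟩ := h.Q_facts hc hχ2 h1 hz.1
    have hz2 : 0 < z^2-1 := by nlinarith [hz.1]
    have hψz : 0 ≤ ψ z := h1.le.trans (hb z ⟨hz.1.le, hz.2.le.trans hρR⟩).1
    have b1 : ψ z * ((z^2-1) * Qk ψ 2 z) ≤ ψ z * (2*ψ 1) := by
      apply mul_le_mul_of_nonneg_left _ hψz
      rw [le_div_iff₀ hz2] at q2; linarith
    have b2 : ((z^2-1)*deriv ψ z) * Qk ψ 1 z ≤ |deriv ψ z| * (2 * ψ 1 * √(z^2-1)) := by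
      calc ((z^2-1)*deriv ψ z) * Qk ψ 1 z = deriv ψ z * ((z^2-1) * Qk ψ 1 z) := by ring
        _ ≤ |deriv ψ z| * ((z^2-1) * Qk ψ 1 z) := mul_le_mul_of_nonneg_right (le_abs_self _) (by positivity)
        _ ≤ _ := mul_le_mul_of_nonneg_left q1 (abs_nonneg _)
    linarith
  have hlim : Filter.Tendsto (fun z => -(2*ψ 1*ψ z) - |deriv ψ z| * (2 * ψ 1 * √(z^2-1))) (nhdsWithin 1 (Ioi 1))
      (nhds (-(2*(ψ 1)^2))) := by
    have hcont : Continuous (fun z => -(2*ψ 1*ψ z) - |deriv ψ z| * (2 * ψ 1 * √(z^2-1))) := by fun_prop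
    have := (hcont.tendsto 1).mono_left (nhdsWithin_le_nhds (s := Ioi (1:ℝ)))
    convert this using 2
    norm_num; ring
  have hfin := le_of_tendsto hlim (by
    filter_upwards [Ioo_mem_nhdsGT hρ] with z hz
    exact key z hz)
  obtain ⟨f1, -, f3⟩ := h.Q_facts hc hχ2 h1 hρ
  have hρ2 : 0 < ρ^2-1 := by nlinarith
  have g1 : 0 ≤ ((ρ^2-1)*deriv ψ ρ) * Qk ψ 1 ρ := mul_nonneg (hb ρ ⟨hρ.le, hρR⟩).2 f1
  have g2 : (ρ^2-1) * ψ ρ * Qk ψ 2 ρ ≤ 2*(ψ 1)^2 := by linarith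
  calc (ρ^2-1) * ψ ρ * Qk ψ 1 ρ ≤ (ρ^2-1) * ψ ρ * (ρ * Qk ψ 2 ρ) := mul_le_mul_of_nonneg_left f3 (by positivity)
    _ = ρ * ((ρ^2-1) * ψ ρ * Qk ψ 2 ρ) := by ring
    _ ≤ ρ * (2*(ψ 1)^2) := mul_le_mul_of_nonneg_left g2 (by linarith)
    _ = _ := by ring


theorem log_deriv_le (h : ProlSol c χ ψ) {R : ℝ} (hc : 0 < c) (hR : 1 < R) (hχ : χ = c^2*R^2) (h1 : 0 < ψ 1) :
    ∀ x ∈ Icc 1 R, (x^2-1) * deriv ψ x ≤ c*(R^2-1)/2 * ψ x := by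
  intro x hx
  have hcont := h.cont
  have hcont' := h.cont'
  have hb := h.barrier_pos hR hχ h1
  have := anti_help (f := fun x => ((x^2-1) * deriv ψ x)^2 - (c*(R^2-1)/2)^2*(ψ x)^2)
    (f' := fun x => 2*((x^2-1) * deriv ψ x)*((χ-c^2*x^2)*ψ x) - (c*(R^2-1)/2)^2*(2*ψ x*deriv ψ x)) hx.1 (by fun_prop)
    (fun z _ => by
      refine (((h.hP z).fun_pow 2).fun_sub (((h.hd z).fun_pow 2).const_mul _)).congr_deriv ?_
      norm_num) (fun z hz => by
      have hz' : z ∈ Icc 1 R := ⟨hz.1.le, hz.2.le.trans hx.2⟩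
      have p1 : 0 ≤ ψ z := h1.le.trans (hb z hz').1
      have p2 := h.barrier_deriv hR hχ h1 z hz'
      have e : 2*((z^2-1) * deriv ψ z)*((χ-c^2*z^2)*ψ z) - (c*(R^2-1)/2)^2*(2*ψ z*deriv ψ z)
        = -(2*(ψ z*deriv ψ z)*(c*(R^2-1)/2 - c*(z^2-1))^2) := by rw [hχ]; ring
      rw [e]
      have := mul_nonneg p1 p2
      have : 0 ≤ 2*(ψ z*deriv ψ z)*(c*(R^2-1)/2 - c*(z^2-1))^2 := by positivity
      linarith)
  norm_num at this
  have hx0 : 0 ≤ ψ x := h1.le.trans (hb x hx).1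
  have hR2 : 0 < R^2-1 := by nlinarith
  have h2 : 0 ≤ (c*(R^2-1)/2)^2*(ψ 1)^2 := by positivity
  refine (sq_le_sq₀ (hb x hx).2 (by positivity)).1 ?_
  rw [mul_pow (c*(R^2-1)/2)]
  linarith

theorem Q_rho_small (h : ProlSol c χ ψ) {R g ρ : ℝ} (hc : 60 < c) (hR : 1 < R) (hχ : χ = c^2*R^2) (h1 : 0 < ψ 1)
    (hg : g = c*(R-1/R)) (hg1 : 48 ≤ g) (hρ1 : 1 < ρ) (hρR : ρ ≤ R) (hρ : ρ^2 = R^2 - 1/(2*c^2*(R^2-1))) :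
    ρ * Qk ψ 1 ρ ≤ 8 * c * R * ψ 1 * exp (1 - π*g/4) := by
  have hc0 : 0 < c := by linarith
  have hR2 : 0 < R^2-1 := by nlinarith
  have hχ2 : 2 < χ := by rw [hχ]; nlinarith
  have hgR : g * R = c * (R^2-1) := by rw [hg]; field_simp
  have hcd : 48 ≤ c * (R^2-1) := by rw [← hgR]; nlinarith
  have hc2d : 2880 ≤ c^2*(R^2-1) := by nlinarith
  have hw : 1/(2*c^2*(R^2-1)) ≤ (R^2-1)/2 := by
    rw [div_le_div_iff₀ (by positivity) (by norm_num)]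
    nlinarith
  have hP : (R^2-1)/2 ≤ ρ^2-1 := by rw [hρ]; linarith
  have hb := h.barrier_pos hR hχ h1
  have hcont := h.cont
  have hRρ : ψ R ≤ 2 * ψ ρ := by
    have := anti_help (f := fun x => ψ x * exp (-(c*x)))
      (f' := fun x => deriv ψ x * exp (-(c*x)) + ψ x * (exp (-(c*x)) * (-(c*1)))) hρR (by fun_prop)
      (fun z _ => (h.hd z).fun_mul (((hasDerivAt_id z).const_mul c).fun_neg.exp)) (fun z hz => by
        have hz' : z ∈ Icc 1 R := ⟨hρ1.le.trans hz.1.le, hz.2.le⟩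
        have l := h.log_deriv_le hc0 hR hχ h1 z hz'
        have p1 : 0 ≤ ψ z := h1.le.trans (hb z hz').1
        have p2 := h.barrier_deriv hR hχ h1 z hz'
        have hPz : (R^2-1)/2 ≤ z^2-1 := by nlinarith [hz.1]
        have : (R^2-1)/2 * deriv ψ z ≤ (R^2-1)/2 * (c * ψ z) := by
          have := mul_le_mul_of_nonneg_right hPz p2
          linarith
        have := le_of_mul_le_mul_left this (by positivity)
        have := mul_le_mul_of_nonneg_right this (exp_pos (-(c*z))).le
        linarith)
    have hd : c*(R-ρ) ≤ 1/2 := by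
      have e1 : (R-ρ)*(R+ρ) ≤ 1/5760 := by
        have : (R-ρ)*(R+ρ) = 1/(2*(c^2*(R^2-1))) := by linear_combination -hρ
        rw [this]
        apply one_div_le_one_div_of_le (by norm_num); linarith
      have e2 : (R-ρ)*(R+ρ) = 1/(2*(c^2*(R^2-1))) := by linear_combination -hρ
      have e3 : c*((R-ρ)*(R+ρ)) ≤ 1/96 := by
        rw [e2]
        rw [mul_one_div, div_le_div_iff₀ (by positivity) (by norm_num)]
        nlinarith
      have : 0 ≤ c*(R-ρ) := by apply mul_nonneg hc0.le; linarith
      nlinarith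
    have e1 : exp (-(c*R)) = exp (-(c*ρ)) * exp (-(c*(R-ρ))) := by rw [← exp_add]; ring_nf
    rw [e1] at this
    have hpos := exp_pos (-(c*ρ))
    have h3 : 1/2 ≤ exp (-(c*(R-ρ))) := by have := add_one_le_exp (-(c*(R-ρ))); linarith
    have hψR : 0 ≤ ψ R := h1.le.trans (hb R ⟨hR.le, le_rfl⟩).1
    have h4 : ψ R * (1/2) ≤ ψ ρ := by
      have : exp (-(c*ρ)) * (ψ R * exp (-(c*(R-ρ)))) ≤ exp (-(c*ρ)) * ψ ρ := by linarith
      have := le_of_mul_le_mul_left this hpos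
      have := mul_le_mul_of_nonneg_left h3 hψR
      linarith
    linarith
  have a := h.Q_at_rho hc0 hR hχ h1 hχ2 hρ1 hρR
  have b := h.growth hc0 hR hχ h1 hg (by linarith)
  obtain ⟨f1, -, -⟩ := h.Q_facts hc0 hχ2 h1 hρ1
  have hR0 : 0 < R := by linarith
  have hg0 : 0 < g := by linarith
  have e : R^2-1 = g*R/c := by field_simp; linarith
  have hE := exp_pos (π*g/4 - 1)
  have c1 : (R^2-1)/2 * (ψ 1 * exp (π*g/4-1)/g/2) * Qk ψ 1 ρ ≤ 2*R*(ψ 1)^2 := by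
    calc _ ≤ (ρ^2-1) * ψ ρ * Qk ψ 1 ρ := by
          gcongr
          · linarith
          · linarith
      _ ≤ 2*ρ*(ψ 1)^2 := a
      _ ≤ _ := by gcongr
  have e2 : (R^2-1)/2 * (ψ 1 * exp (π*g/4-1)/g/2) * Qk ψ 1 ρ = (R * ψ 1) * (exp (π*g/4-1)/(4*c) * Qk ψ 1 ρ) := by
    rw [e]; field_simp; norm_num
  have e3 : 2*R*(ψ 1)^2 = (R * ψ 1) * (2*ψ 1) := by ring
  rw [e2, e3, mul_le_mul_iff_right₀ (by positivity)] at c1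
  have e4 : exp (1-π*g/4) = 1/exp (π*g/4-1) := by rw [one_div, ← exp_neg]; ring_nf
  have e6 : Qk ψ 1 ρ ≤ 8 * c * ψ 1 * exp (1-π*g/4) := by
    rw [e4, mul_one_div, le_div_iff₀ hE]
    have := mul_le_mul_of_nonneg_left c1 hc0.le
    have e5 : c * (exp (π*g/4-1)/(4*c) * Qk ψ 1 ρ) = Qk ψ 1 ρ * exp (π*g/4-1) / 4 := by field_simp
    linarith
  calc ρ * Qk ψ 1 ρ ≤ R * (8 * c * ψ 1 * exp (1-π*g/4)) := by gcongr
    _ = _ := by ring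

end ProlSol
end

section
namespace ProlSol
variable {c χ : ℝ} {ψ φ : ℝ → ℝ}

theorem liou (h : ProlSol c χ ψ) {R : ℝ} (hc : 60 < c) (hR : 1 < R) (hχ : χ = c^2*R^2)
    (hnorm : ∫ t in (-1:ℝ)..1, (ψ t)^2 = 1) {x : ℝ} (hx0 : 0 ≤ x) (hx1 : x < 1) (hp : 1/(2*c) ≤ 1 - x^2) :
    (R^2-1)/(15*R^2) ≤ √(1-x^2) * ((ψ x)^2 + (1-x^2)*(deriv ψ x)^2/(χ-c^2*x^2)) := by
  have hc0 : 0 < c := by linarith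
  have hcont := h.cont
  have hcont' := h.cont'
  have hR2 : 0 < R^2-1 := by nlinarith
  have hq : ∀ z ∈ Icc 0 x, 0 < χ - c^2*z^2 := fun z hz => by
    rw [hχ, ← mul_sub]
    have : z^2 ≤ 1 := by nlinarith [hz.1, hz.2]
    have : 0 < R^2 - z^2 := by nlinarith
    positivity
  have hpz : ∀ z ∈ Icc 0 x, 1/(2*c) ≤ 1 - z^2 := fun z hz => by nlinarith [hz.1, hz.2]
  have hpz0 : ∀ z ∈ Icc 0 x, 0 < 1 - z^2 := fun z hz => lt_of_lt_of_le (by positivity) (hpz z hz)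
  have hκ : ∀ z ∈ Icc 0 x, 0 < (1-z^2)*(χ - c^2*z^2) + (1-z^2)/4 + 1/4 := fun z hz => by
    have := hq z hz
    have := hpz0 z hz
    positivity
  have hd : ∀ z ∈ Icc 0 x, HasDerivAt (fun z => √(1-z^2) * ((ψ z)^2 + ((1-z^2)*deriv ψ z - z*ψ z/2)^2/((1-z^2)*(χ - c^2*z^2) + (1-z^2)/4 + 1/4)))
      (√(1-z^2) * (((1-z^2)*deriv ψ z - z*ψ z/2)^2 * (z*(2*c^2 - 1/(2*(1-z^2)^2))) * (1-z^2) / ((1-z^2)*(χ - c^2*z^2) + (1-z^2)/4 + 1/4)^2)) z := by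
    intro z hz
    have k0 := (hκ z hz).ne'
    have p0 := hpz0 z hz
    have d1 : HasDerivAt (fun x => χ - c^2*x^2) (-(c^2*(2*z))) z := by
      simpa using (((hasDerivAt_id z).pow 2).const_mul (c^2)).const_sub χ
    have d0 : HasDerivAt (fun x : ℝ => 1 - x^2) (-(2*z)) z := by
      simpa using ((hasDerivAt_id z).pow 2).const_sub 1
    have dk : HasDerivAt (fun z => (1-z^2)*(χ - c^2*z^2) + (1-z^2)/4 + 1/4) (-(2*z)*(χ-c^2*z^2) + (1-z^2)*(-(c^2*(2*z))) + -(2*z)/4) z :=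
      (((d0.fun_mul d1).fun_add (d0.div_const 4)).add_const _)
    have dw : HasDerivAt (fun z => (1-z^2)*deriv ψ z - z*ψ z/2) (-((χ-c^2*z^2)*ψ z) - (1*ψ z + z*deriv ψ z)/2) z := by
      refine ((h.hp z).fun_sub ((((hasDerivAt_id z).fun_mul (h.hd z)).div_const 2))).congr_deriv ?_
      simp
    have ds : HasDerivAt (fun z : ℝ => √(1-z^2)) (-(2*z)/(2*√(1-z^2))) z := d0.sqrt p0.ne'
    refine (ds.fun_mul (((h.hd z).fun_pow 2).fun_add ((dw.fun_pow 2).fun_div dk k0))).congr_deriv ?_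
    have hs : √(1-z^2) * √(1-z^2) = 1-z^2 := mul_self_sqrt p0.le
    have hs0 : √(1-z^2) ≠ 0 := (sqrt_pos.2 p0).ne'
    have e1 : -(2*z)/(2*√(1-z^2)) = √(1-z^2) * (-(z/(1-z^2))) := by
      rw [neg_div, mul_neg, mul_div_mul_left _ _ (by norm_num : (2:ℝ) ≠ 0), neg_inj, div_eq_iff hs0]
      have : √(1-z^2) * (z/(1-z^2)) * √(1-z^2) = (√(1-z^2)*√(1-z^2)) * (z/(1-z^2)) := by ring
      rw [this, hs]; field_simp
    rw [e1, mul_assoc, ← mul_add]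
    congr 1
    have p1 := p0.ne'
    generalize hK : (1-z^2)*(χ - c^2*z^2) + (1-z^2)/4 + 1/4 = K at *
    have hχe : χ - c^2*z^2 = (K - 1/4 - (1-z^2)/4)/(1-z^2) := by
      rw [← hK]; field_simp; ring
    rw [hχe]
    generalize hP : 1-z^2 = p at *
    have hz2 : z^2 = 1-p := by linarith
    norm_num
    field_simp
    ring_nf
    have hz3 : z^3 = z*(1-p) := by rw [← hz2]; ring
    have hz4 : z^4 = (1-p)^2 := by rw [← hz2]; ring
    have hz5 : z^5 = z*(1-p)^2 := by rw [← hz2]; ring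
    simp only [hz2, hz3, hz4, hz5]
    ring
  have hm := mono_help hx0 (fun z hz => (hd z hz).continuousAt.continuousWithinAt)
    (fun z hz => hd z ⟨hz.1.le, hz.2.le⟩) (fun z hz => by
      have hz' : z ∈ Icc 0 x := ⟨hz.1.le, hz.2.le⟩
      have p0 := hpz0 z hz'
      have k0 := hκ z hz'
      have : 0 ≤ 2*c^2 - 1/(2*(1-z^2)^2) := by
        have h2 := hpz z hz'
        have h3 : (1/(2*c))^2 ≤ (1-z^2)^2 := by gcongr
        have h4 : 1/(2*(1-z^2)^2) ≤ 1/(2*(1/(2*c))^2) := by gcongr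
        have h5 : 1/(2*(1/(2*c))^2) = 2*c^2 := by field_simp
        linarith
      have := hz'.1
      positivity)
  beta_reduce at hm
  have hx' : x ∈ Icc 0 x := ⟨hx0, le_rfl⟩
  have q0 := hq x hx'
  have p0 := hpz0 x hx'
  have k0 := hκ x hx'
  have he := h.e0_ge hc0 hR hχ hnorm
  have hχ0 : 3600 ≤ χ := by rw [hχ]; nlinarith
  have hl : (R^2-1)/(5*R^2) ≤ √(1-0^2) * ((ψ 0)^2 + ((1-0^2)*deriv ψ 0 - 0*ψ 0/2)^2/((1-0^2)*(χ - c^2*0^2) + (1-0^2)/4 + 1/4)) := by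
    norm_num
    have e1 : (c^2*(R^2-1)/4)/(χ+1/2) ≤ (ψ 0)^2 + deriv ψ 0^2/(χ+1/4+1/4) := by
      have : (ψ 0)^2 + deriv ψ 0^2/(χ+1/4+1/4) = ((χ+1/2)*(ψ 0)^2 + deriv ψ 0^2)/(χ+1/2) := by
        have : χ + 1/2 ≠ 0 := by positivity
        have e : χ+1/4+1/4 = χ+1/2 := by ring
        rw [e]; field_simp
      rw [this]
      gcongr
      nlinarith [sq_nonneg (ψ 0)]
    refine le_trans ?_ e1
    rw [div_le_div_iff₀ (by positivity) (by positivity)]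
    have : 4*(χ+1/2) ≤ c^2*(5*R^2) := by linarith
    nlinarith
  have hr : ((ψ x)^2 + ((1-x^2)*deriv ψ x - x*ψ x/2)^2/((1-x^2)*(χ - c^2*x^2) + (1-x^2)/4 + 1/4)) ≤
      3*((ψ x)^2 + (1-x^2)*(deriv ψ x)^2/(χ-c^2*x^2)) := by
    have a1 : ((1-x^2)*deriv ψ x - x*ψ x/2)^2 ≤ 2*((1-x^2)*deriv ψ x)^2 + (ψ x)^2/2 := by
      have : x^2*(ψ x)^2 ≤ 1*(ψ x)^2 := mul_le_mul_of_nonneg_right (by nlinarith) (sq_nonneg _)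
      nlinarith [sq_nonneg ((1-x^2)*deriv ψ x + x*ψ x/2)]
    have a2 : ((1-x^2)*deriv ψ x - x*ψ x/2)^2/((1-x^2)*(χ - c^2*x^2) + (1-x^2)/4 + 1/4) ≤
        2*((1-x^2)*deriv ψ x)^2/((1-x^2)*(χ - c^2*x^2)) + ((ψ x)^2/2)/(1/4) := by
      calc _ ≤ (2*((1-x^2)*deriv ψ x)^2 + (ψ x)^2/2)/((1-x^2)*(χ - c^2*x^2) + (1-x^2)/4 + 1/4) := by gcongr
        _ = 2*((1-x^2)*deriv ψ x)^2/((1-x^2)*(χ - c^2*x^2) + (1-x^2)/4 + 1/4) + ((ψ x)^2/2)/((1-x^2)*(χ - c^2*x^2) + (1-x^2)/4 + 1/4) := by rw [add_div]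
        _ ≤ _ := by
          have : 0 < (1-x^2)*(χ - c^2*x^2) := by positivity
          gcongr
          · linarith
          · linarith
    have a3 : 2*((1-x^2)*deriv ψ x)^2/((1-x^2)*(χ - c^2*x^2)) = 2*((1-x^2)*(deriv ψ x)^2/(χ-c^2*x^2)) := by
      field_simp
    have a4 : 0 ≤ (1-x^2)*(deriv ψ x)^2/(χ-c^2*x^2) := by positivity
    linarith
  have := mul_le_mul_of_nonneg_left hr (sqrt_nonneg (1-x^2))
  have e : (R^2-1)/(15*R^2) = (R^2-1)/(5*R^2)/3 := by field_simp; norm_num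
  rw [e]
  linarith

/-- amplitude lower bounds -/
theorem amp (h : ProlSol c χ ψ) {R : ℝ} (hc : 60 < c) (hR : 1 < R) (hχ : χ = c^2*R^2) (hcd : 1 ≤ c*(R^2-1))
    (hnorm : ∫ t in (-1:ℝ)..1, (ψ t)^2 = 1) {x : ℝ} (hx0 : 0 ≤ x) (hx1 : x < 1) (hp : 1/(2*c^2*(R^2-1)) ≤ 1 - x^2) :
    (R^2-1)/(15*R^2) / √(c*(R^2-1)) ≤ √(1-x^2) * ((ψ x)^2 + (1-x^2)*(deriv ψ x)^2/(χ-c^2*x^2)) ∧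
    (R^2-1)/(15*R^2) ≤ ((ψ x)^2 + (1-x^2)*(deriv ψ x)^2/(χ-c^2*x^2)) := by
  have hc0 : 0 < c := by linarith
  have hR2 : 0 < R^2-1 := by nlinarith
  have hE : 0 < (R^2-1)/(15*R^2) := by positivity
  have hsq1 : 1 ≤ √(c*(R^2-1)) := by rw [one_le_sqrt]; exact hcd
  rcases le_total (1/(2*c)) (1-x^2) with h1 | h1
  · have l := h.liou hc hR hχ hnorm hx0 hx1 h1
    refine ⟨(div_le_self hE.le hsq1).trans l, l.trans ?_⟩
    apply mul_le_of_le_one_left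
    · have : 0 ≤ 1 - x^2 := le_trans (by positivity) h1
      have : 0 ≤ χ-c^2*x^2 := by
        rw [hχ, ← mul_sub]
        have : 0 < R^2 - x^2 := by nlinarith
        positivity
      positivity
    · rw [sqrt_le_iff]; exact ⟨zero_le_one, by nlinarith [sq_nonneg x]⟩
  · have hc1 : 1/(2*c) < 1 := by rw [div_lt_one (by positivity)]; linarith
    have hx1s : (√(1-1/(2*c)))^2 = 1 - 1/(2*c) := sq_sqrt (by linarith)
    have hc2 : 0 < 1/(2*c) := by positivity
    have hlt : √(1-1/(2*c)) < 1 := by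
      rw [sqrt_lt' one_pos]; linarith
    have l := h.liou hc hR hχ hnorm (sqrt_nonneg (1-1/(2*c))) hlt (by rw [hx1s]; linarith)
    have hle : √(1-1/(2*c)) ≤ x := by rw [sqrt_le_left hx0]; linarith
    have m := h.E1_mono hc0 hR hχ (sqrt_nonneg (1-1/(2*c))) hle hx1.le
    set G1 := ((ψ √(1-1/(2*c)))^2 + (1-√(1-1/(2*c))^2)*(deriv ψ √(1-1/(2*c)))^2/(χ-c^2*√(1-1/(2*c))^2)) with hG1
    set G := ((ψ x)^2 + (1-x^2)*(deriv ψ x)^2/(χ-c^2*x^2)) with hG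
    have e1 : 1 - √(1-1/(2*c))^2 = 1/(2*c) := by rw [hx1s]; ring
    rw [e1] at l
    have hsp : 0 < √(1/(2*c)) := sqrt_pos.2 hc2
    have hG1p : 0 ≤ G1 := by
      by_contra hn
      push Not at hn
      nlinarith
    have hs1 : √(1/(2*c)) ≤ 1 := by rw [sqrt_le_iff]; exact ⟨zero_le_one, by linarith⟩
    constructor
    · have e2 : √(1/(2*c)) ≤ √(c*(R^2-1)) * √(1-x^2) := by
        rw [← sqrt_mul (by positivity)]
        apply sqrt_le_sqrt
        have := mul_le_mul_of_nonneg_left hp (by positivity : 0 ≤ c*(R^2-1))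
        refine le_trans (le_of_eq ?_) this
        field_simp
      rw [div_le_iff₀ (by linarith)]
      calc _ ≤ √(1/(2*c)) * G1 := l
        _ ≤ (√(c*(R^2-1)) * √(1-x^2)) * G := by gcongr
        _ = _ := by ring
    · exact l.trans ((mul_le_of_le_one_left hG1p hs1).trans m)

end ProlSol
end

section
theorem ident {f g : ℂ → ℂ} (hf : Differentiable ℂ f) (hg : Differentiable ℂ g) (h : ∀ x : ℝ, f x = g x) : ∀ z, f z = g z := by
  have hfa : AnalyticOnNhd ℂ f univ := fun z _ => hf.analyticAt z
  have hga : AnalyticOnNhd ℂ g univ := fun z _ => hg.analyticAt z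
  have hfr : ∃ᶠ z in nhdsWithin (0:ℂ) {0}ᶜ, f z = g z := by
    have ht : Filter.Tendsto (fun x : ℝ => (x:ℂ)) (nhdsWithin 0 {0}ᶜ) (nhdsWithin (0:ℂ) {0}ᶜ) := by
      refine tendsto_nhdsWithin_iff.2 ⟨?_, ?_⟩
      · have := (Complex.continuous_ofReal.tendsto 0).mono_left (nhdsWithin_le_nhds (s := {0}ᶜ))
        simpa using this
      · filter_upwards [self_mem_nhdsWithin] with x hx
        simpa using hx
    exact ht.frequently (Filter.Eventually.of_forall (fun x => h x)).frequently
  have := hfa.eq_of_frequently_eq hga hfr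
  exact fun z => congrFun this z

structure CExt (c χ : ℝ) (ψ : ℝ → ℝ) (Ψ : ℂ → ℂ) : Prop where
  sol : ProlSol c χ ψ
  diff : Differentiable ℂ Ψ
  ext : ∀ x : ℝ, Ψ x = ψ x

theorem exists_ext {c χ : ℝ} {ψ : ℝ → ℝ} {lam : ℂ} (h : ProlSol c χ ψ) (hl : lam ≠ 0)
    (he : ∀ x : ℝ, lam * (ψ x:ℂ) = ∫ t in (-1:ℝ)..1, (ψ t:ℂ) * Complex.exp (Complex.I * (c:ℂ) * (x:ℂ) * (t:ℂ))) :
    ∃ Ψ : ℂ → ℂ, CExt c χ ψ Ψ := by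
  refine ⟨fun z => lam⁻¹ * ∫ t in (-1:ℝ)..1, (ψ t:ℂ) * Complex.exp (Complex.I * (c:ℂ) * z * (t:ℂ)), h, ?_, ?_⟩
  · have hcψ := h.cont
    apply Differentiable.const_mul
    intro z
    have hcF : ∀ z : ℂ, Continuous (fun t : ℝ => (ψ t:ℂ) * Complex.exp (Complex.I * (c:ℂ) * z * (t:ℂ))) := fun z => by
      fun_prop
    have hcF' : ∀ z : ℂ, Continuous (fun t : ℝ => (ψ t:ℂ) * (Complex.exp (Complex.I * (c:ℂ) * z * (t:ℂ)) * (Complex.I * (c:ℂ) * t))) := fun z => by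
      fun_prop
    have hjc : Continuous (fun p : ℂ × ℝ => ‖(ψ p.2:ℂ) * (Complex.exp (Complex.I * (c:ℂ) * p.1 * (p.2:ℂ)) * (Complex.I * (c:ℂ) * p.2))‖) := by
      fun_prop
    obtain ⟨B, hB⟩ := ((isCompact_closedBall z 1).prod (isCompact_Icc (a := (-1:ℝ)) (b := 1))).bddAbove_image hjc.continuousOn
    have := intervalIntegral.hasDerivAt_integral_of_dominated_loc_of_deriv_le (μ := volume) (a := (-1:ℝ)) (b := 1)
      (F := fun (z : ℂ) (t : ℝ) => (ψ t:ℂ) * Complex.exp (Complex.I * (c:ℂ) * z * (t:ℂ)))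
      (F' := fun (z : ℂ) (t : ℝ) => (ψ t:ℂ) * (Complex.exp (Complex.I * (c:ℂ) * z * (t:ℂ)) * (Complex.I * (c:ℂ) * t)))
      (x₀ := z) (s := Metric.ball z 1) (bound := fun _ => B) (Metric.ball_mem_nhds z one_pos)
      (Filter.Eventually.of_forall (fun w => (hcF w).aestronglyMeasurable))
      ((hcF z).intervalIntegrable _ _) ((hcF' z).aestronglyMeasurable)
      (Filter.Eventually.of_forall (fun t ht w hw => by
        apply hB
        refine ⟨(w, t), ⟨Metric.ball_subset_closedBall hw, ?_⟩, rfl⟩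
        rw [uIoc_of_le (by norm_num)] at ht
        exact ⟨ht.1.le, ht.2⟩))
      (by simp)
      (Filter.Eventually.of_forall (fun t ht w hw => by
        apply HasDerivAt.const_mul
        apply HasDerivAt.cexp
        have := ((hasDerivAt_id w).const_mul (Complex.I * (c:ℂ))).mul_const (t:ℂ)
        simpa using this))
    exact this.2.differentiableAt
  · intro x
    beta_reduce
    rw [← he x]
    field_simp

namespace CExt
variable {c χ : ℝ} {ψ : ℝ → ℝ} {Ψ : ℂ → ℂ}

theorem diff' (h : CExt c χ ψ Ψ) : Differentiable ℂ (deriv Ψ) := h.diff.deriv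
theorem diff'' (h : CExt c χ ψ Ψ) : Differentiable ℂ (deriv (deriv Ψ)) := h.diff'.deriv

theorem dext {F : ℂ → ℂ} {f : ℝ → ℝ} (hF : Differentiable ℂ F) (he : ∀ x : ℝ, F x = f x)
    (x : ℝ) : deriv F x = deriv f x := by
  have h1 : HasDerivAt (fun y : ℝ => F y) (deriv F x) x := (hF x).hasDerivAt.comp_ofReal
  have h2 : (fun y : ℝ => F y) = fun y : ℝ => (f y : ℂ) := funext he
  rw [h2] at h1
  have h3 := (hF x).hasDerivAt.real_of_complex
  have h4 : (fun y : ℝ => (F y).re) = f := by funext y; rw [he]; simp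
  rw [h4] at h3
  have h5 := h3.deriv
  have h6 : HasDerivAt (fun y : ℝ => (f y : ℂ)) ((deriv F x).re : ℂ) x := h3.ofReal_comp
  rw [h5, h1.unique h6]
  simp

theorem ext' (h : CExt c χ ψ Ψ) (x : ℝ) : deriv Ψ x = deriv ψ x := dext h.diff h.ext x
theorem ext'' (h : CExt c χ ψ Ψ) (x : ℝ) : deriv (deriv Ψ) x = deriv (deriv ψ) x := dext h.diff' h.ext' x

theorem ode (h : CExt c χ ψ Ψ) (z : ℂ) :
    (1-z^2) * deriv (deriv Ψ) z - 2*z*deriv Ψ z + (χ - c^2*z^2) * Ψ z = 0 := by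
  have h0 := h.diff
  have h1 := h.diff'
  have h2 := h.diff''
  refine ident (f := fun z => (1-z^2) * deriv (deriv Ψ) z - 2*z*deriv Ψ z + (χ - c^2*z^2) * Ψ z) (g := fun _ => 0)
    (by fun_prop) (by fun_prop) (fun x => ?_) z
  beta_reduce
  rw [h.ext, h.ext', h.ext'']
  exact_mod_cast congrArg (fun x : ℝ => (x:ℂ)) (h.sol.ode x)

theorem conj (h : CExt c χ ψ Ψ) (z : ℂ) : Ψ ((starRingEnd ℂ) z) = (starRingEnd ℂ) (Ψ z) := by
  have hd : Differentiable ℂ (fun z => (starRingEnd ℂ) (Ψ ((starRingEnd ℂ) z))) := fun z =>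
    differentiableAt_conj_conj_iff.2 (h.diff _)
  have := ident hd h.diff (fun x => by simp [h.ext]) ((starRingEnd ℂ) z)
  rw [← this]; simp

theorem norm_conj (h : CExt c χ ψ Ψ) (z : ℂ) : ‖Ψ ((starRingEnd ℂ) z)‖ = ‖Ψ z‖ := by
  rw [h.conj]; simp

theorem norm_neg (h : CExt c χ ψ Ψ) (z : ℂ) : ‖Ψ (-z)‖ = ‖Ψ z‖ := by
  have h0 := h.diff
  rcases h.sol.parity with hp | hp
  · have := ident (f := fun z => Ψ (-z)) (g := Ψ) (by fun_prop) h.diff (fun x => by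
      have := h.ext (-x); push_cast at this; rw [this, h.ext, hp]) z
    rw [← this]
  · have := ident (f := fun z => Ψ (-z)) (g := fun z => - Ψ z) (by fun_prop) (by fun_prop) (fun x => by
      have := h.ext (-x); push_cast at this; rw [this, h.ext, hp]; simp) z
    beta_reduce at this
    rw [this]; simp

theorem hP (h : CExt c χ ψ Ψ) (z : ℂ) :
    HasDerivAt (fun z => (z^2-1) * deriv Ψ z) ((χ - c^2*z^2) * Ψ z) z := by
  have d0 : HasDerivAt (fun z : ℂ => z^2-1) (2*z) z := by
    simpa using ((hasDerivAt_id z).pow 2).sub_const 1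
  refine (d0.fun_mul (h.diff' z).hasDerivAt).congr_deriv ?_
  have := h.ode z
  linear_combination -this

end CExt
end

section
namespace CExt
variable {c χ : ℝ} {ψ : ℝ → ℝ} {Ψ : ℂ → ℂ}

set_option maxHeartbeats 1000000 in
theorem local_one (h : CExt c χ ψ Ψ) {R : ℝ} (hc : 60 < c) (hR : 1 < R) (hχ : χ = c^2*R^2) (hcd : 48 ≤ c*(R^2-1))
    (h1 : 0 < ψ 1) {z : ℂ} (hz0 : 0 ≤ z.re) (hz : ‖z^2-1‖ ≤ 1/(2*(c^2*(R^2-1)))) :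
    0.85 * ψ 1 ≤ ‖Ψ z‖ ∧ ‖Ψ z‖ ≤ 1.15 * ψ 1 ∧ ‖z‖ * ‖deriv Ψ z‖ ≤ ((χ:ℂ) - c^2*z^2).re * ‖Ψ z‖ := by
  have hc0 : 0 < c := by linarith
  have hR2 : 0 < R^2-1 := by nlinarith
  set D := c^2*(R^2-1) with hD
  have hD1 : 48*c ≤ D := by rw [hD]; nlinarith
  have hD2 : 2880 ≤ D := by nlinarith
  have hD0 : 0 < D := by linarith
  have hcD : c^2/(2*D) ≤ D/4608 := by
    rw [div_le_div_iff₀ (by positivity) (by norm_num)]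
    nlinarith
  have hinv : 1/(2*D) ≤ 1/5760 := by
    apply one_div_le_one_div_of_le (by norm_num); linarith
  have hfac : ∀ w : ℂ, ‖w^2-1‖ = ‖w-1‖*‖w+1‖ := fun w => by rw [← norm_mul]; congr 1; ring
  have hz1 : 1 ≤ ‖z+1‖ := by
    have := Complex.re_le_norm (z+1)
    simp at this; linarith
  have hzz : ‖z-1‖ ≤ 1/5760 := by
    have := hfac z
    nlinarith [norm_nonneg (z-1)]
  have hlow : ∀ w : ℂ, ‖w-1‖ ≤ 1/5760 → 1.999 ≤ ‖w+1‖ ∧ ‖w+1‖ ≤ 2.001 := fun w hw => by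
    constructor
    · have := norm_sub_norm_le (2:ℂ) (1-w)
      have e : (2:ℂ) - (1-w) = w+1 := by ring
      rw [e, norm_sub_rev 1 w] at this
      norm_num at this ⊢
      linarith
    · have := norm_add_le (2:ℂ) (w-1)
      have e : (2:ℂ) + (w-1) = w+1 := by ring
      rw [e] at this
      norm_num at this ⊢
      linarith
  set r0 := 1/(3.99*D) with hr0
  have hr0D : r0 * D = 1/3.99 := by rw [hr0]; field_simp
  have hr0p : 0 < r0 := by positivity
  have hr05 : r0 ≤ 1/5760 := by
    rw [hr0]; apply one_div_le_one_div_of_le (by norm_num); linarith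
  have hzr : ‖z-1‖ ≤ r0 := by
    have a := hfac z
    have b := (hlow z hzz).1
    have : ‖z-1‖*1.999 ≤ 1/(2*D) := by
      have := mul_le_mul_of_nonneg_left b (norm_nonneg (z-1))
      linarith
    have e : 1/(2*D) = r0 * 1.995 := by rw [hr0]; field_simp; norm_num
    rw [e] at this
    nlinarith
  have hB : ∀ w ∈ Metric.closedBall (1:ℂ) r0, ‖w-1‖ ≤ r0 := fun w hw => by
    simpa [dist_eq_norm] using hw
  have hq : ∀ w ∈ Metric.closedBall (1:ℂ) r0, ‖(χ:ℂ) - c^2*w^2‖ ≤ 1.001*D := fun w hw => by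
    have w1 := hB w hw
    have w2 := hlow w (w1.trans hr05)
    have e : (χ:ℂ) - c^2*w^2 = ((D:ℝ):ℂ) - c^2*(w^2-1) := by rw [hD, hχ]; push_cast; ring
    rw [e]
    have n1 := norm_sub_le ((D:ℝ):ℂ) (c^2*(w^2-1))
    rw [norm_mul, hfac, Complex.norm_real, norm_of_nonneg hD0.le] at n1
    have e2 : ‖(c:ℂ)^2‖ = c^2 := by
      rw [norm_pow, Complex.norm_real, norm_of_nonneg hc0.le]
    rw [e2] at n1
    have : ‖w-1‖*‖w+1‖ ≤ r0*2.001 := by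
      apply mul_le_mul w1 w2.2 (norm_nonneg _) hr0p.le
    have : c^2*(‖w-1‖*‖w+1‖) ≤ c^2*(r0*2.001) := by gcongr
    have e3 : c^2*(r0*2.001) = c^2/(2*D)*(2*2.001/3.99) := by rw [hr0]; field_simp
    have : c^2/(2*D)*(2*2.001/3.99) ≤ D/4608*(2*2.001/3.99) := by gcongr
    norm_num at *
    linarith
  obtain ⟨w0, hw0, hmax⟩ := (isCompact_closedBall (1:ℂ) r0).exists_isMaxOn ⟨1, by simp [hr0p.le]⟩ h.diff.continuous.norm.continuousOn
  set m := ‖Ψ w0‖ with hm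
  have hmx : ∀ w ∈ Metric.closedBall (1:ℂ) r0, ‖Ψ w‖ ≤ m := fun w hw => hmax hw
  have hm0 : 0 ≤ m := norm_nonneg _
  have h1B : (1:ℂ) ∈ Metric.closedBall (1:ℂ) r0 := by simp [hr0p.le]
  have hconv := convex_closedBall (1:ℂ) r0
  have hd1 : ∀ w ∈ Metric.closedBall (1:ℂ) r0, ‖deriv Ψ w‖ ≤ 0.502*D*m := fun w hw => by
    by_cases hw1 : w = 1
    · have := h.ode 1
      have e : deriv Ψ 1 = ((χ:ℂ)-c^2*1^2)*Ψ 1/2 := by linear_combination -(1/2)*this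
      rw [hw1, e, norm_div, norm_mul]
      have a := hq 1 h1B
      have b := hmx 1 h1B
      have : ‖(χ:ℂ)-c^2*1^2‖*‖Ψ 1‖ ≤ 1.001*D*m := mul_le_mul a b (norm_nonneg _) (by positivity)
      have e2 : ‖(2:ℂ)‖ = 2 := by norm_num
      rw [e2]
      have : 0 ≤ D*m := by positivity
      norm_num at *
      linarith
    · have := hconv.norm_image_sub_le_of_norm_hasDerivWithin_le (C := 1.001*D*m) (fun x _ => (h.hP x).hasDerivWithinAt)
        (fun x hx => by
          rw [norm_mul]
          exact mul_le_mul (hq x hx) (hmx x hx) (norm_nonneg _) (by positivity)) h1B hw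
      norm_num only [one_pow, sub_self, zero_mul, sub_zero] at this
      rw [norm_mul, hfac] at this
      have hw0 : 0 < ‖w-1‖ := norm_pos_iff.2 (sub_ne_zero.2 hw1)
      have t2 : ‖w-1‖*(‖w+1‖*‖deriv Ψ w‖) ≤ ‖w-1‖*(1.001*D*m) := by
        norm_num at *
        linarith
      have t3 := le_of_mul_le_mul_left t2 hw0
      have t4 := (hlow w ((hB w hw).trans hr05)).1
      have t5 := mul_le_mul_of_nonneg_right t4 (norm_nonneg (deriv Ψ w))
      have : 0 ≤ D*m := by positivity
      norm_num at *
      linarith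
  have hvar : ∀ w ∈ Metric.closedBall (1:ℂ) r0, ‖Ψ w - Ψ 1‖ ≤ 0.126*m := fun w hw => by
    have := hconv.norm_image_sub_le_of_norm_hasDerivWithin_le (C := 0.502*D*m) (fun x _ => (h.diff x).hasDerivAt.hasDerivWithinAt)
        hd1 h1B hw
    refine this.trans ?_
    have a : 0.502*D*m*‖w-1‖ ≤ 0.502*D*m*r0 := by
      apply mul_le_mul_of_nonneg_left (hB w hw); positivity
    have b : 0.502*D*m*r0 = 0.502*(r0*D)*m := by ring
    rw [b, hr0D] at a
    norm_num at *
    linarith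
  have hΨ1 : ‖Ψ 1‖ = ψ 1 := by
    have := h.ext 1
    push_cast at this
    rw [this, Complex.norm_real, norm_of_nonneg h1.le]
  have hmle : m ≤ 1.145*ψ 1 := by
    have a := hvar w0 hw0
    have b := norm_sub_norm_le (Ψ w0) (Ψ 1)
    rw [hΨ1] at b
    norm_num at *
    linarith
  have hzB : z ∈ Metric.closedBall (1:ℂ) r0 := by simpa [dist_eq_norm] using hzr
  have lowΨ : 0.855*ψ 1 ≤ ‖Ψ z‖ := by
    have a := hvar z hzB
    have b := norm_sub_norm_le (Ψ 1) (Ψ z)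
    rw [hΨ1, norm_sub_rev] at b
    norm_num at *
    linarith
  refine ⟨?_, ?_, ?_⟩
  · norm_num at *; linarith
  · have := hmx z hzB
    norm_num at *; linarith
  · have hre : 0.999*D ≤ ((χ:ℂ) - c^2*z^2).re := by
      have e : (χ:ℂ) - c^2*z^2 = ((D:ℝ):ℂ) - c^2*(z^2-1) := by rw [hD, hχ]; push_cast; ring
      rw [e, Complex.sub_re, Complex.ofReal_re]
      have a := Complex.re_le_norm ((c:ℂ)^2*(z^2-1))
      have e2 : ‖(c:ℂ)^2‖ = c^2 := by
        rw [norm_pow, Complex.norm_real, norm_of_nonneg hc0.le]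
      rw [norm_mul, e2] at a
      have b : c^2*‖z^2-1‖ ≤ c^2*(1/(2*D)) := by gcongr
      have e3 : c^2*(1/(2*D)) = c^2/(2*D) := by ring
      norm_num at *
      linarith
    have hzn : ‖z‖ ≤ 1.001 := by
      have := norm_add_le (1:ℂ) (z-1)
      have e : (1:ℂ)+(z-1) = z := by ring
      rw [e] at this
      norm_num at *; linarith
    have a := hd1 z hzB
    have b : ‖z‖*‖deriv Ψ z‖ ≤ 1.001*(0.502*D*m) := mul_le_mul hzn a (norm_nonneg _) (by norm_num)
    have d : 0.999*D*(0.855*ψ 1) ≤ ((χ:ℂ) - c^2*z^2).re * ‖Ψ z‖ := by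
      apply mul_le_mul hre lowΨ (by positivity)
      refine le_trans ?_ hre; positivity
    have e : D*m ≤ D*(1.145*ψ 1) := by gcongr
    have : 0 < D*ψ 1 := by positivity
    norm_num at b d e ⊢
    linarith
end CExt
end

section
theorem hasDerivAt_re {f : ℝ → ℂ} {f' : ℂ} {x : ℝ} (h : HasDerivAt f f' x) : HasDerivAt (fun x => (f x).re) f'.re x :=
  (Complex.reCLM.hasFDerivAt (x := f x)).comp_hasDerivAt x h
theorem hasDerivAt_im {f : ℝ → ℂ} {f' : ℂ} {x : ℝ} (h : HasDerivAt f f' x) : HasDerivAt (fun x => (f x).im) f'.im x :=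
  (Complex.imCLM.hasFDerivAt (x := f x)).comp_hasDerivAt x h

noncomputable def Sre (f g : ℂ) : ℝ := f.re*g.re + f.im*g.im

theorem nsq (f : ℂ) : ‖f‖^2 = f.re^2 + f.im^2 := by
  rw [Complex.sq_norm, Complex.normSq_apply]; ring

theorem hasDerivAt_nsq {f : ℝ → ℂ} {f' : ℂ} {x : ℝ} (h : HasDerivAt f f' x) :
    HasDerivAt (fun x => ‖f x‖^2) (2*Sre (f x) f') x := by
  simp only [nsq]
  refine (((hasDerivAt_re h).fun_pow 2).fun_add ((hasDerivAt_im h).fun_pow 2)).congr_deriv ?_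
  simp only [Sre]; norm_num; ring

theorem hasDerivAt_Sre {f g : ℝ → ℂ} {f' g' : ℂ} {x : ℝ} (h : HasDerivAt f f' x) (k : HasDerivAt g g' x) :
    HasDerivAt (fun x => Sre (f x) (g x)) (Sre f' (g x) + Sre (f x) g') x := by
  simp only [Sre]
  refine (((hasDerivAt_re h).fun_mul (hasDerivAt_re k)).fun_add ((hasDerivAt_im h).fun_mul (hasDerivAt_im k))).congr_deriv ?_
  ring

/-- cross term -/
noncomputable def Xre (f g : ℂ) : ℝ := f.re*g.im - f.im*g.re

theorem Xre_le (f g : ℂ) : |Xre f g| ≤ ‖f‖*‖g‖ := by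
  apply abs_le_of_sq_le_sq _ (by positivity)
  rw [mul_pow, nsq, nsq, Xre]
  nlinarith [sq_nonneg (f.re*g.re+f.im*g.im)]

theorem Sre_le (f g : ℂ) : |Sre f g| ≤ ‖f‖*‖g‖ := by
  apply abs_le_of_sq_le_sq _ (by positivity)
  rw [mul_pow, nsq, nsq, Sre]
  nlinarith [sq_nonneg (f.re*g.im-f.im*g.re)]

theorem Sre_alg (f g T q : ℂ) : Sre f (Complex.I*T*g + q*f) = q.re*‖f‖^2 - T.im*Sre f g - T.re*Xre f g := by
  simp only [nsq, Sre, Xre, Complex.add_re, Complex.add_im, Complex.mul_re, Complex.mul_im, Complex.I_re, Complex.I_im]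
  ring

/-- monotonicity of the modulus along a line -/
theorem line_mono {f g T q : ℝ → ℂ} {n : ℝ → ℝ} {b : ℝ}
    (hf : ∀ s ∈ Icc 0 b, HasDerivAt f (g s) s) (hg : ∀ s ∈ Icc 0 b, HasDerivAt g (Complex.I*T s*g s + q s*f s) s)
    (hn : ∀ s ∈ Icc 0 b, 0 < n s) (hn' : ∀ s ∈ Icc 0 b, HasDerivAt n (2*(T s).im*n s) s)
    (hS : Sre (f 0) (g 0) = 0) (hc : ∀ s ∈ Icc 0 b, |(T s).re| * (‖f s‖*‖g s‖) ≤ ‖g s‖^2 + (q s).re*‖f s‖^2) :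
    ∀ s ∈ Icc 0 b, 0 ≤ Sre (f s) (g s) := by
  intro s hs
  have hd : ∀ x ∈ Icc 0 b, HasDerivAt (fun x => √(n x) * Sre (f x) (g x))
      (√(n x) * (‖g x‖^2 + (q x).re*‖f x‖^2 - (T x).re*Xre (f x) (g x))) x := fun x hx => by
    have n0 := hn x hx
    refine (((hn' x hx).sqrt n0.ne').fun_mul (hasDerivAt_Sre (hf x hx) (hg x hx))).congr_deriv ?_
    rw [Sre_alg]
    have hs : √(n x) * √(n x) = n x := mul_self_sqrt n0.le
    have hs0 : √(n x) ≠ 0 := (sqrt_pos.2 n0).ne'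
    have e1 : 2*(T x).im*n x/(2*√(n x)) = √(n x) * (T x).im := by
      rw [div_eq_iff (by positivity)]; linear_combination -2*(T x).im*hs
    have e2 : Sre (g x) (g x) = ‖g x‖^2 := by rw [nsq, Sre]; ring
    rw [e1, e2]; ring
  have := mono_help hs.1 (fun x hx => (hd x ⟨hx.1, hx.2.trans hs.2⟩).continuousAt.continuousWithinAt)
    (fun x hx => hd x ⟨hx.1.le, hx.2.le.trans hs.2⟩) (fun x hx => by
      have hx' : x ∈ Icc 0 b := ⟨hx.1.le, hx.2.le.trans hs.2⟩
      apply mul_nonneg (sqrt_nonneg _)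
      have a := hc x hx'
      have b1 := mul_le_mul_of_nonneg_left (Xre_le (f x) (g x)) (abs_nonneg (T x).re)
      rw [← abs_mul] at b1
      have := le_abs_self ((T x).re * Xre (f x) (g x))
      linarith)
  rw [hS, mul_zero] at this
  exact nonneg_of_mul_nonneg_right this (sqrt_pos.2 (hn s hs))

/-- energy decay for the quotient of two solutions -/
theorem line_energy {f1 g1 f2 g2 T q : ℝ → ℂ} {Δ a b : ℝ} (hab : a ≤ b)
    (hf1 : ∀ s ∈ Icc a b, HasDerivAt f1 (g1 s) s) (hg1 : ∀ s ∈ Icc a b, HasDerivAt g1 (Complex.I*T s*g1 s + q s*f1 s) s)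
    (hf2 : ∀ s ∈ Icc a b, HasDerivAt f2 (g2 s) s) (hg2 : ∀ s ∈ Icc a b, HasDerivAt g2 (Complex.I*T s*g2 s + (q s - Δ)*f2 s) s)
    (h0 : ∀ s ∈ Icc a b, f1 s ≠ 0) (hS : ∀ s ∈ Icc a b, 0 ≤ Sre (f1 s) (g1 s)) (hT : ∀ s ∈ Icc a b, 0 ≤ (T s).im) :
    ‖(g2 b*f1 b - f2 b*g1 b)/(f1 b)^2‖^2 + Δ*‖f2 b/f1 b‖^2 ≤ ‖(g2 a*f1 a - f2 a*g1 a)/(f1 a)^2‖^2 + Δ*‖f2 a/f1 a‖^2 := by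
  have hd : ∀ x ∈ Icc a b, HasDerivAt (fun x => ‖(g2 x*f1 x - f2 x*g1 x)/(f1 x)^2‖^2 + Δ*‖f2 x/f1 x‖^2)
      (-((2*(T x).im + 4*(Sre (f1 x) (g1 x)/‖f1 x‖^2)) * ‖(g2 x*f1 x - f2 x*g1 x)/(f1 x)^2‖^2)) x := fun x hx => by
    have z0 := h0 x hx
    have dr : HasDerivAt (fun x => f2 x/f1 x) ((g2 x*f1 x - f2 x*g1 x)/(f1 x)^2) x :=
      (hf2 x hx).fun_div (hf1 x hx) z0
    have dd : HasDerivAt (fun x => (g2 x*f1 x - f2 x*g1 x)/(f1 x)^2)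
        (Complex.I*(T x + 2*Complex.I*(g1 x/f1 x))*((g2 x*f1 x - f2 x*g1 x)/(f1 x)^2) - Δ*(f2 x/f1 x)) x := by
      refine ((((hg2 x hx).fun_mul (hf1 x hx)).fun_sub ((hf2 x hx).fun_mul (hg1 x hx))).fun_div
        ((hf1 x hx).fun_pow 2) (pow_ne_zero 2 z0)).congr_deriv ?_
      norm_num
      field_simp
      linear_combination -2*g1 x*(g2 x*f1 x - f2 x*g1 x)*Complex.I_sq
    refine ((hasDerivAt_nsq dd).fun_add ((hasDerivAt_nsq dr).const_mul Δ)).congr_deriv ?_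
    have e1 : (g1 x/f1 x).re = Sre (f1 x) (g1 x)/‖f1 x‖^2 := by
      rw [Complex.div_re, ← Complex.sq_norm, Sre]; ring
    rw [← e1]
    generalize (g2 x*f1 x - f2 x*g1 x)/(f1 x)^2 = d
    generalize f2 x/f1 x = r
    generalize g1 x/f1 x = k
    simp only [nsq, Sre, Complex.add_re, Complex.add_im, Complex.sub_re, Complex.sub_im, Complex.mul_re, Complex.mul_im, Complex.I_re, Complex.I_im, Complex.ofReal_re, Complex.ofReal_im]
    norm_num
    ring
  exact anti_help hab (fun x hx => (hd x hx).continuousAt.continuousWithinAt)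
    (fun x hx => hd x ⟨hx.1.le, hx.2.le⟩) (fun x hx => by
      have hx' : x ∈ Icc a b := ⟨hx.1.le, hx.2.le⟩
      have := hT x hx'
      have := hS x hx'
      rw [neg_nonpos]
      positivity)

/-- growth of a second solution -/
theorem line_growth {f g T q : ℝ → ℂ} {X b K : ℝ} (hX : 0 < X) (hK : 0 ≤ K)
    (hf : ∀ s ∈ Icc 0 b, HasDerivAt f (g s) s) (hg : ∀ s ∈ Icc 0 b, HasDerivAt g (Complex.I*T s*g s + q s*f s) s)
    (hT : ∀ s ∈ Icc 0 b, 0 ≤ (T s).im) (hq : ∀ s ∈ Icc 0 b, ‖q s + X‖ ≤ K*√X) :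
    ∀ s ∈ Icc 0 b, ‖g s‖^2 + X*‖f s‖^2 ≤ (‖g 0‖^2 + X*‖f 0‖^2) * exp (K*s) := by
  intro s hs
  have hd : ∀ x ∈ Icc 0 b, HasDerivAt (fun x => (‖g x‖^2 + X*‖f x‖^2) * exp (-(K*x)))
      ((2*Sre (g x) (Complex.I*T x*g x + q x*f x) + X*(2*Sre (f x) (g x))) * exp (-(K*x)) + (‖g x‖^2 + X*‖f x‖^2) * (exp (-(K*x)) * (-(K*1)))) x := fun x hx =>
    (((hasDerivAt_nsq (hg x hx)).fun_add ((hasDerivAt_nsq (hf x hx)).const_mul X)).fun_mul (((hasDerivAt_id x).const_mul K).fun_neg.exp))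
  have := anti_help hs.1 (fun x hx => (hd x ⟨hx.1, hx.2.trans hs.2⟩).continuousAt.continuousWithinAt)
    (fun x hx => hd x ⟨hx.1.le, hx.2.le.trans hs.2⟩) (fun x hx => by
      have hx' : x ∈ Icc 0 b := ⟨hx.1.le, hx.2.le.trans hs.2⟩
      have e : 2*Sre (g x) (Complex.I*T x*g x + q x*f x) + X*(2*Sre (f x) (g x)) =
          2*Sre (g x) ((q x + X)*f x) - 2*(T x).im*‖g x‖^2 := by
        simp only [nsq, Sre, Complex.add_re, Complex.add_im, Complex.sub_re, Complex.sub_im, Complex.mul_re, Complex.mul_im, Complex.I_re, Complex.I_im, Complex.ofReal_re, Complex.ofReal_im]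
        ring
      have a1 := (le_abs_self _).trans (Sre_le (g x) ((q x + X)*f x))
      rw [norm_mul] at a1
      have a2 : ‖g x‖*(‖q x + X‖*‖f x‖) ≤ ‖g x‖*((K*√X)*‖f x‖) := by gcongr; exact hq x hx'
      have a3 : 2*(√X*‖f x‖*‖g x‖) ≤ ‖g x‖^2 + X*‖f x‖^2 := by
        have := sq_nonneg (‖g x‖ - √X*‖f x‖)
        have e3 : √X^2 = X := sq_sqrt hX.le
        nlinarith
      have a4 := mul_le_mul_of_nonneg_left a3 hK
      have a5 : 0 ≤ 2*(T x).im*‖g x‖^2 := by have := hT x hx'; positivity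
      rw [e]
      have : (2*Sre (g x) ((q x + X)*f x) - 2*(T x).im*‖g x‖^2) - K*(‖g x‖^2 + X*‖f x‖^2) ≤ 0 := by linarith
      have := mul_le_mul_of_nonneg_right this (exp_pos (-(K*x))).le
      linarith)
  norm_num at this
  have e : exp (-(K*s)) * exp (K*s) = 1 := by rw [← exp_add]; norm_num
  have := mul_le_mul_of_nonneg_right this (exp_pos (K*s)).le
  rw [mul_assoc, e, mul_one] at this
  exact this

/-- Taylor-type lower bound -/
theorem line_taylor {f g T q : ℝ → ℂ} {s u v : ℝ} (hs : 0 < s)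
    (hf : ∀ x ∈ Icc 0 s, HasDerivAt f (g x) x) (hg : ∀ x ∈ Icc 0 s, HasDerivAt g (Complex.I*T x*g x + q x*f x) x)
    (hT : ∀ x ∈ Icc 0 s, ‖T x‖*s ≤ 1/20) (hq : ∀ x ∈ Icc 0 s, ‖q x‖*s^2 ≤ 1/20)
    (hf0 : f 0 = u) (hg0 : g 0 = Complex.I*v) : (u^2 + s^2*v^2)/2 ≤ ‖f s‖^2 := by
  have cf : ContinuousOn f (Icc 0 s) := fun x hx => (hf x hx).continuousAt.continuousWithinAt
  have cg : ContinuousOn g (Icc 0 s) := fun x hx => (hg x hx).continuousAt.continuousWithinAt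
  obtain ⟨x0, hx0, hmax⟩ := isCompact_Icc.exists_isMaxOn (nonempty_Icc.2 hs.le) (f := fun x => ‖f x‖ + s*‖g x‖)
    (cf.norm.add (continuousOn_const.mul cg.norm))
  set K := ‖f x0‖ + s*‖g x0‖ with hK
  have hKx : ∀ x ∈ Icc 0 s, ‖f x‖ + s*‖g x‖ ≤ K := fun x hx => hmax hx
  have hb : ∀ x ∈ Icc 0 s, ‖Complex.I*T x*g x + q x*f x‖ ≤ K/(20*s^2) := fun x hx => by
    rw [le_div_iff₀ (by positivity)]
    have n1 := norm_add_le (Complex.I*T x*g x) (q x*f x)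
    rw [norm_mul, norm_mul, norm_mul, Complex.norm_I, one_mul] at n1
    have a := mul_le_mul_of_nonneg_right (hT x hx) (norm_nonneg (g x))
    have b := mul_le_mul_of_nonneg_right (hq x hx) (norm_nonneg (f x))
    have d := hKx x hx
    calc _ ≤ (‖T x‖*‖g x‖ + ‖q x‖*‖f x‖)*(20*s^2) := by gcongr
      _ = 20*s*(‖T x‖*s*‖g x‖) + 20*(‖q x‖*s^2*‖f x‖) := by ring
      _ ≤ 20*s*(1/20*‖g x‖) + 20*(1/20*‖f x‖) := by gcongr
      _ ≤ K := by linarith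
  have hg1 : ∀ x ∈ Icc 0 s, ‖g x - g 0‖ ≤ K/(20*s) := fun x hx => by
    have := norm_image_sub_le_of_norm_deriv_le_segment' (f := g) (C := K/(20*s^2)) (fun y hy => (hg y hy).hasDerivWithinAt)
      (fun y hy => hb y ⟨hy.1, hy.2.le⟩) x hx
    refine this.trans ?_
    have K0 : 0 ≤ K := by positivity
    calc _ ≤ K/(20*s^2)*s := by gcongr; linarith [hx.2]
      _ = _ := by field_simp
  have hf1 : ∀ x ∈ Icc 0 s, ‖f x - f 0 - x*g 0‖ ≤ K/20 := fun x hx => by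
    have := norm_image_sub_le_of_norm_deriv_le_segment' (f := fun x : ℝ => f x - x*g 0) (f' := fun x => g x - g 0) (C := K/(20*s))
      (fun y hy => by
        have d1 : HasDerivAt (fun x : ℝ => (x:ℂ)*g 0) (g 0) y := by
          simpa using (Complex.ofRealCLM.hasDerivAt (x := y)).mul_const (g 0)
        exact ((hf y hy).fun_sub d1).hasDerivWithinAt)
      (fun y hy => hg1 y ⟨hy.1, hy.2.le⟩) x hx
    have e : f x - x*g 0 - (f 0 - ((0:ℝ):ℂ)*g 0) = f x - f 0 - x*g 0 := by push_cast; ring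
    rw [e] at this
    refine this.trans ?_
    have K0 : 0 ≤ K := by positivity
    calc _ ≤ K/(20*s)*s := by gcongr; linarith [hx.2]
      _ = _ := by field_simp
  have n0 : ‖f 0‖ = |u| := by rw [hf0, Complex.norm_real, Real.norm_eq_abs]
  have n1 : ‖g 0‖ = |v| := by rw [hg0, norm_mul, Complex.norm_I, one_mul, Complex.norm_real, Real.norm_eq_abs]
  have hKb : K ≤ 10/9*(|u| + 2*(s*|v|)) := by
    have a := hf1 x0 hx0
    have b := hg1 x0 hx0
    have a1 : ‖f x0‖ ≤ K/20 + |u| + s*|v| := by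
      have e : f x0 = (f x0 - f 0 - x0*g 0) + f 0 + x0*g 0 := by ring
      have := norm_add₃_le (a := f x0 - f 0 - x0*g 0) (b := f 0) (c := (x0:ℂ)*g 0)
      rw [← e, n0, norm_mul, n1, Complex.norm_real, norm_of_nonneg hx0.1] at this
      have := mul_le_mul_of_nonneg_right hx0.2 (abs_nonneg v)
      linarith
    have b1 : ‖g x0‖ ≤ K/(20*s) + |v| := by
      have := norm_sub_norm_le (g x0) (g 0)
      rw [n1] at this; linarith
    have b2 : s*‖g x0‖ ≤ K/20 + s*|v| := by
      have := mul_le_mul_of_nonneg_left b1 hs.le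
      have e : s*(K/(20*s) + |v|) = K/20 + s*|v| := by field_simp
      linarith
    linarith
  have hfs := hf1 s ⟨hs.le, le_rfl⟩
  have hnl : ‖f 0 + s*g 0‖^2 = u^2 + s^2*v^2 := by
    rw [nsq, hf0, hg0]; simp; ring
  have hlow : ‖f 0 + s*g 0‖ - K/20 ≤ ‖f s‖ := by
    have := norm_sub_norm_le (f 0 + s*g 0) (f s)
    rw [norm_sub_rev] at this
    have e : f s - (f 0 + s*g 0) = f s - f 0 - s*g 0 := by ring
    rw [e] at this
    linarith
  set N := ‖f 0 + s*g 0‖ with hN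
  have hN0 : 0 ≤ N := norm_nonneg _
  have hcs : |u| + 2*(s*|v|) ≤ 2.25*N := by
    apply abs_le_of_sq_le_sq' _ (by positivity) |>.2
    rw [mul_pow, hnl]
    have := sq_nonneg (2*|u| - s*|v|)
    have e1 := sq_abs u
    have e2 := sq_abs v
    have e3 : (s*|v|)^2 = s^2*v^2 := by rw [mul_pow, e2]
    have : 0 ≤ s^2*v^2 := by positivity
    nlinarith [sq_nonneg u]
  have : 0.87*N ≤ ‖f s‖ := by norm_num at *; linarith
  have : (0.87*N)^2 ≤ ‖f s‖^2 := by gcongr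
  rw [mul_pow, hnl] at this
  have : 0 ≤ u^2 + s^2*v^2 := by positivity
  norm_num at *
  linarith
end

section
noncomputable def Zl (α β : ℝ) : ℂ := Complex.sin (α + β*Complex.I)
noncomputable def Cl (α β : ℝ) : ℂ := Complex.cos (α + β*Complex.I)
noncomputable def nl (α β : ℝ) : ℝ := cos α^2 + sinh β^2

theorem Zl_eq (α β : ℝ) : Zl α β = ((sin α * cosh β : ℝ):ℂ) + ((cos α * sinh β : ℝ):ℂ)*Complex.I := by
  rw [Zl, Complex.sin_add_mul_I]; push_cast; ring
theorem Cl_eq (α β : ℝ) : Cl α β = ((cos α * cosh β : ℝ):ℂ) - ((sin α * sinh β : ℝ):ℂ)*Complex.I := by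
  rw [Cl, Complex.cos_add_mul_I]; push_cast; ring
theorem Zl_re (α β : ℝ) : (Zl α β).re = sin α * cosh β := by rw [Zl_eq]; simp [-Complex.ofReal_mul]
theorem Zl_im (α β : ℝ) : (Zl α β).im = cos α * sinh β := by rw [Zl_eq]; simp [-Complex.ofReal_mul]
theorem Cl_re (α β : ℝ) : (Cl α β).re = cos α * cosh β := by rw [Cl_eq]; simp [-Complex.ofReal_mul]
theorem Cl_im (α β : ℝ) : (Cl α β).im = -(sin α * sinh β) := by rw [Cl_eq]; simp [-Complex.ofReal_mul]

theorem Zl_nsq (α β : ℝ) : ‖Zl α β‖^2 = sin α^2 + sinh β^2 := by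
  rw [nsq, Zl_re, Zl_im]
  have := sin_sq_add_cos_sq α
  have := cosh_sq β
  have e : cos α^2 = 1 - sin α^2 := by linarith
  rw [mul_pow, mul_pow, this, e]; ring
theorem Cl_nsq (α β : ℝ) : ‖Cl α β‖^2 = nl α β := by
  rw [nsq, Cl_re, Cl_im, nl]
  have := sin_sq_add_cos_sq α
  have := cosh_sq β
  have e : cos α^2 = 1 - sin α^2 := by linarith
  rw [neg_sq, mul_pow, mul_pow, this, e]; ring
theorem Cl_sq (α β : ℝ) : (Cl α β)^2 = 1 - (Zl α β)^2 := by
  have := Complex.sin_sq_add_cos_sq (α + β*Complex.I)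
  rw [Cl, Zl]; linear_combination this
theorem norm_Zsq (α β : ℝ) : ‖(Zl α β)^2 - 1‖ = nl α β := by
  rw [← Cl_nsq, ← norm_pow, Cl_sq, norm_sub_rev]

theorem Zl_deriv (α β : ℝ) : HasDerivAt (fun b => Zl α b) (Complex.I * Cl α β) β := by
  have h1 : HasDerivAt (fun b : ℝ => (α:ℂ) + (b:ℂ)*Complex.I) Complex.I β := by
    simpa using ((Complex.ofRealCLM.hasDerivAt (x := β)).mul_const Complex.I).const_add (α:ℂ)
  have := (Complex.hasDerivAt_sin ((α:ℂ) + (β:ℂ)*Complex.I)).comp β h1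
  rw [mul_comm] at this
  exact this
theorem Cl_deriv (α β : ℝ) : HasDerivAt (fun b => Cl α b) (-(Complex.I * Zl α β)) β := by
  have h1 : HasDerivAt (fun b : ℝ => (α:ℂ) + (b:ℂ)*Complex.I) Complex.I β := by
    simpa using ((Complex.ofRealCLM.hasDerivAt (x := β)).mul_const Complex.I).const_add (α:ℂ)
  have := (Complex.hasDerivAt_cos ((α:ℂ) + (β:ℂ)*Complex.I)).comp β h1
  rw [mul_comm, mul_neg] at this
  exact this

noncomputable def Tl (α β : ℝ) : ℂ := Zl α β / Cl α β

theorem nl_pos {α : ℝ} (ha : 0 < cos α) (β : ℝ) : 0 < nl α β := by rw [nl]; positivity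
theorem Cl_ne {α : ℝ} (ha : 0 < cos α) (β : ℝ) : Cl α β ≠ 0 := by
  intro h0
  have := Cl_nsq α β
  have := nl_pos ha β
  rw [h0] at *; norm_num at *; linarith
theorem Tl_im (α β : ℝ) : (Tl α β).im = sinh β * cosh β / nl α β := by
  rw [Tl, Complex.div_im, ← Complex.sq_norm, Cl_nsq, Zl_re, Zl_im, Cl_re, Cl_im]
  have := sin_sq_add_cos_sq α
  have e : cos α^2 = 1 - sin α^2 := by linarith
  rw [← sub_div]
  congr 1
  linear_combination sinh β*cosh β*this
theorem Tl_re (α β : ℝ) : (Tl α β).re = sin α * cos α / nl α β := by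
  rw [Tl, Complex.div_re, ← Complex.sq_norm, Cl_nsq, Zl_re, Zl_im, Cl_re, Cl_im]
  have := cosh_sq β
  rw [← add_div]
  congr 1
  linear_combination sin α*cos α*this
theorem Tl_im_nonneg {α : ℝ} (ha : 0 < cos α) {β : ℝ} (hb : 0 ≤ β) : 0 ≤ (Tl α β).im := by
  rw [Tl_im]
  have := nl_pos ha β
  have := sinh_nonneg_iff.2 hb
  have := cosh_pos β
  positivity
theorem Tl_re_sq {α : ℝ} (ha : 0 < cos α) (β : ℝ) : (Tl α β).re^2 ≤ 1/nl α β := by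
  have n0 := nl_pos ha β
  rw [Tl_re, div_pow, div_le_div_iff₀ (by positivity) n0]
  have h1 : cos α^2 ≤ nl α β := by rw [nl]; nlinarith [sq_nonneg (sinh β)]
  have h2 := sin_sq_le_one α
  have h3 : sin α^2*cos α^2 ≤ 1*nl α β := by gcongr
  rw [mul_pow]
  nlinarith
theorem nl_deriv {α : ℝ} (ha : 0 < cos α) (β : ℝ) : HasDerivAt (fun b => nl α b) (2*(Tl α β).im*nl α β) β := by
  simp only [nl]
  refine (((hasDerivAt_sinh β).fun_pow 2).const_add (cos α^2)).congr_deriv ?_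
  have n0 := nl_pos ha β
  rw [Tl_im, ← nl]
  norm_num
  field_simp

noncomputable def fl (Ψ : ℂ → ℂ) (α β : ℝ) : ℂ := Ψ (Zl α β)
noncomputable def gl (Ψ : ℂ → ℂ) (α β : ℝ) : ℂ := Complex.I * Cl α β * deriv Ψ (Zl α β)
noncomputable def ql (c χ : ℝ) (α β : ℝ) : ℂ := (χ:ℂ) - c^2*(Zl α β)^2

theorem Zl_zero (α : ℝ) : Zl α 0 = ((sin α:ℝ):ℂ) := by rw [Zl_eq]; simp
theorem Cl_zero (α : ℝ) : Cl α 0 = ((cos α:ℝ):ℂ) := by rw [Cl_eq]; simp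

namespace CExt
variable {c χ : ℝ} {ψ : ℝ → ℝ} {Ψ : ℂ → ℂ}

theorem fl_deriv (h : CExt c χ ψ Ψ) (α β : ℝ) : HasDerivAt (fl Ψ α) (gl Ψ α β) β := by
  have := (h.diff (Zl α β)).hasDerivAt.comp β (Zl_deriv α β)
  rw [mul_comm] at this
  exact this

theorem gl_deriv (h : CExt c χ ψ Ψ) {α : ℝ} (ha : 0 < cos α) (β : ℝ) :
    HasDerivAt (gl Ψ α) (Complex.I*Tl α β*gl Ψ α β + ql c χ α β*fl Ψ α β) β := by
  have h1 := (h.diff' (Zl α β)).hasDerivAt.comp β (Zl_deriv α β)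
  refine (((Cl_deriv α β).const_mul Complex.I).fun_mul h1).congr_deriv ?_
  have o := h.ode (Zl α β)
  have c0 := Cl_ne ha β
  have cs := Cl_sq α β
  simp only [gl, ql, fl, Function.comp_def, Tl]
  field_simp
  rw [← cs] at o
  linear_combination (-1)*o - (deriv Ψ (Zl α β)*2*Zl α β - deriv (deriv Ψ) (Zl α β)*(Cl α β)^2)*Complex.I_sq

theorem fl_zero (h : CExt c χ ψ Ψ) (α : ℝ) : fl Ψ α 0 = ((ψ (sin α):ℝ):ℂ) := by
  rw [fl, Zl_zero, h.ext]
theorem gl_zero (h : CExt c χ ψ Ψ) (α : ℝ) : gl Ψ α 0 = Complex.I*((cos α * deriv ψ (sin α):ℝ):ℂ) := by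
  rw [gl, Zl_zero, Cl_zero, h.ext']; push_cast; ring

theorem ql_re_ge (hχ : χ = c^2*R^2) (α β : ℝ) : c^2*(R^2 - (sin α^2 + sinh β^2)) ≤ (ql c χ α β).re := by
  have e : (ql c χ α β).re = χ - c^2*((Zl α β)^2).re := by
    simp only [ql]
    rw [Complex.sub_re, ← Complex.ofReal_pow, Complex.re_ofReal_mul]; simp
  have : ((Zl α β)^2).re ≤ sin α^2 + sinh β^2 := by
    have := Complex.re_le_norm ((Zl α β)^2)
    rwa [norm_pow, Zl_nsq] at this
  rw [e, hχ]
  nlinarith [sq_nonneg c]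

theorem theta_mono (h : CExt c χ ψ Ψ) {R α b : ℝ} (hc : 60 < c) (hR : 1 < R) (hχ : χ = c^2*R^2) (hcd : 48 ≤ c*(R^2-1))
    (h1 : 0 < ψ 1) (ha0 : 0 ≤ sin α) (ha : 0 < cos α) (hb : sin α^2 + sinh b^2 ≤ R^2 - 1/(2*(c^2*(R^2-1)))) :
    ∀ s ∈ Icc 0 b, 0 ≤ Sre (fl Ψ α s) (gl Ψ α s) := by
  have hR2 : 0 < R^2-1 := by nlinarith
  have hc0 : 0 < c := by linarith
  refine line_mono (T := Tl α) (q := ql c χ α) (n := nl α) (fun s _ => h.fl_deriv α s) (fun s _ => h.gl_deriv ha s)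
    (fun s _ => nl_pos ha s) (fun s _ => nl_deriv ha s) ?_ ?_
  · rw [h.fl_zero, h.gl_zero]; simp [Sre]
  · intro s hs
    have hsb : sinh s^2 ≤ sinh b^2 := by
      have := sinh_nonneg_iff.2 hs.1
      have := sinh_le_sinh.2 hs.2
      gcongr
    set ω := 1/(2*(c^2*(R^2-1))) with hω
    have hω0 : 0 < ω := by positivity
    have n0 := nl_pos ha s
    have hq1 := ql_re_ge (R := R) hχ α s
    have hq2 : c^2*ω ≤ (ql c χ α s).re := by
      refine le_trans ?_ hq1
      gcongr; linarith
    have hq0 : 0 ≤ (ql c χ α s).re := le_trans (by positivity) hq2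
    by_cases hn : nl α s ≤ ω
    · have := (h.local_one hc hR hχ hcd h1 (z := Zl α s) (by rw [Zl_re]; have := cosh_pos s; positivity) (by rw [norm_Zsq]; exact hn)).2.2
      have e1 : ‖Tl α s‖ * ‖gl Ψ α s‖ = ‖Zl α s‖ * ‖deriv Ψ (Zl α s)‖ := by
        rw [← norm_mul, ← norm_mul, Tl, gl]
        have : Zl α s/Cl α s * (Complex.I*Cl α s*deriv Ψ (Zl α s)) = Complex.I*(Zl α s*deriv Ψ (Zl α s)) := by
          have := Cl_ne ha s
          field_simp
        rw [this, norm_mul, Complex.norm_I, one_mul]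
      rw [← e1] at this
      have h2 : |(Tl α s).re| * ‖gl Ψ α s‖ ≤ (ql c χ α s).re*‖fl Ψ α s‖ := by
        refine le_trans ?_ this
        gcongr; exact Complex.abs_re_le_norm _
      have := mul_le_mul_of_nonneg_right h2 (norm_nonneg (fl Ψ α s))
      nlinarith [sq_nonneg ‖gl Ψ α s‖]
    · push Not at hn
      have hT : (Tl α s).re^2 ≤ 4*(ql c χ α s).re := by
        refine (Tl_re_sq ha s).trans ?_
        have e : (ql c χ α s).re = c^2*(R^2-1) - c^2*((Zl α s)^2-1).re := by
          simp only [ql]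
          rw [Complex.sub_re, ← Complex.ofReal_pow, Complex.re_ofReal_mul, Complex.ofReal_re, Complex.sub_re, Complex.one_re]; linear_combination hχ
        by_cases hr : ((Zl α s)^2-1).re ≤ (R^2-1)/2
        · have : c^2*(R^2-1)/2 ≤ (ql c χ α s).re := by rw [e]; nlinarith [sq_nonneg c]
          have h3 : 1/nl α s ≤ 1/ω := by gcongr
          have h4 : 1/ω = 2*(c^2*(R^2-1)) := by rw [hω]; simp
          linarith
        · push Not at hr
          have := hr.le.trans (Complex.re_le_norm _)
          rw [norm_Zsq] at this
          have h3 : 1/nl α s ≤ 1/((R^2-1)/2) := by gcongr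
          have h4 : 1/((R^2-1)/2) = 4*(c^2*ω) := by rw [hω]; field_simp; norm_num
          linarith
      have := sq_nonneg (‖gl Ψ α s‖ - |(Tl α s).re|/2 * ‖fl Ψ α s‖)
      have e2 := sq_abs (Tl α s).re
      have := mul_le_mul_of_nonneg_right hT (sq_nonneg ‖fl Ψ α s‖)
      rw [← e2] at this
      nlinarith

end CExt
end

section
theorem int_sub_le {F : ℝ → ℝ} (hF : Continuous F) (h0 : ∀ t, 0 ≤ F t) {x : ℝ} (hx : x ∈ Icc (-1:ℝ) 1) :
    ∫ t in x..1, F t ≤ ∫ t in (-1:ℝ)..1, F t := by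
  have := intervalIntegral.integral_add_adjacent_intervals (μ := volume) (hF.intervalIntegrable (-1) x) (hF.intervalIntegrable x 1)
  have := intervalIntegral.integral_nonneg (μ := volume) hx.1 (fun t _ => h0 t)
  linarith

namespace ProlSol
variable {c χ χm : ℝ} {ψ φ : ℝ → ℝ}

/-- Wronskian -/
theorem wron (h : ProlSol c χ ψ) (k : ProlSol c χm φ) (x : ℝ) :
    (1-x^2)*(deriv φ x * ψ x - φ x * deriv ψ x) = -((χ-χm) * ∫ t in x..1, φ t * ψ t) := by
  have c1 := h.cont
  have c2 := k.cont
  have e : ∀ y ∈ uIcc x 1, HasDerivAt (fun y => ((1-y^2)*deriv φ y) * ψ y - φ y * ((1-y^2)*deriv ψ y))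
      ((χ-χm)*(φ y*ψ y)) y := fun y _ => by
    refine (((k.hp y).fun_mul (h.hd y)).fun_sub ((k.hd y).fun_mul (h.hp y))).congr_deriv ?_
    ring
  have := intervalIntegral.integral_eq_sub_of_hasDerivAt e (by apply Continuous.intervalIntegrable; fun_prop)
  rw [intervalIntegral.integral_const_mul] at this
  rw [this]; ring

theorem wron_int_le (h : ProlSol c χ ψ) (k : ProlSol c χm φ) (hn : ∫ t in (-1:ℝ)..1, (ψ t)^2 = 1)
    (hm : ∫ t in (-1:ℝ)..1, (φ t)^2 = 1) {x : ℝ} (hx : x ∈ Icc (-1:ℝ) 1) : |∫ t in x..1, φ t * ψ t| ≤ 1 := by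
  have c1 := h.cont
  have c2 := k.cont
  have a1 := int_sub_le (F := fun t => (ψ t)^2) (by fun_prop) (fun t => sq_nonneg _) hx
  have a2 := int_sub_le (F := fun t => (φ t)^2) (by fun_prop) (fun t => sq_nonneg _) hx
  have := intervalIntegral.abs_integral_le_integral_abs (μ := volume) hx.2 (f := fun t => φ t * ψ t)
  refine this.trans ?_
  have : ∫ t in x..1, |φ t * ψ t| ≤ ∫ t in x..1, ((φ t)^2*(1/2) + (ψ t)^2*(1/2)) := by
    apply intervalIntegral.integral_mono_on hx.2 (by apply Continuous.intervalIntegrable; fun_prop)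
      (by apply Continuous.intervalIntegrable; fun_prop)
    intro t _
    rw [abs_mul]
    nlinarith [sq_nonneg (|φ t| - |ψ t|), sq_abs (φ t), sq_abs (ψ t)]
  rw [intervalIntegral.integral_add (by apply Continuous.intervalIntegrable; fun_prop) (by apply Continuous.intervalIntegrable; fun_prop),
    intervalIntegral.integral_mul_const, intervalIntegral.integral_mul_const] at this
  linarith

/-- derivative bound for the second solution -/
theorem cder_le (k : ProlSol c χm φ) (hm : ∫ t in (-1:ℝ)..1, (φ t)^2 = 1) {x X C : ℝ} (hx : x ∈ Icc (0:ℝ) 1)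
    (hC : 0 < C) (hC2 : C^2 = 1-x^2) (hX : ∀ t ∈ Icc x 1, |χm - c^2*t^2| ≤ X) : |C*deriv φ x| ≤ X := by
  have c2 := k.cont
  have hx' : x ∈ Icc (-1:ℝ) 1 := ⟨by linarith [hx.1], hx.2⟩
  have X0 : 0 ≤ X := (abs_nonneg _).trans (hX 1 ⟨hx.2, le_rfl⟩)
  have := intervalIntegral.integral_eq_sub_of_hasDerivAt (fun y (_ : y ∈ uIcc x 1) => k.hp y)
    (by apply Continuous.intervalIntegrable; fun_prop)
  have e1 : C*(C*deriv φ x) = ∫ t in x..1, (χm - c^2*t^2)*φ t := by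
    rw [intervalIntegral.integral_neg] at this
    linear_combination deriv φ x * hC2 + this
  have a2 := int_sub_le (F := fun t => (φ t)^2) (by fun_prop) (fun t => sq_nonneg _) hx'
  have b1 := intervalIntegral.abs_integral_le_integral_abs (μ := volume) hx.2 (f := fun t => (χm - c^2*t^2)*φ t)
  have b2 : ∫ t in x..1, |(χm - c^2*t^2)*φ t| ≤ ∫ t in x..1, ((φ t)^2*(X*C/2) + X/(2*C)) := by
    apply intervalIntegral.integral_mono_on hx.2 (by apply Continuous.intervalIntegrable; fun_prop)
      (by apply Continuous.intervalIntegrable; fun_prop)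
    intro t ht
    rw [abs_mul]
    have h1 : |φ t| ≤ (φ t)^2*(C/2) + 1/(2*C) := by
      have h2 : (φ t)^2*(C/2) + 1/(2*C) - |φ t| = C/2*(|φ t| - 1/C)^2 := by
        have := sq_abs (φ t)
        field_simp
        linear_combination -C^2*this
      have : 0 ≤ C/2*(|φ t| - 1/C)^2 := by positivity
      linarith
    calc _ ≤ X * ((φ t)^2*(C/2) + 1/(2*C)) := by gcongr; exact hX t ht
      _ = _ := by field_simp
  rw [intervalIntegral.integral_add (by apply Continuous.intervalIntegrable; fun_prop) (by apply Continuous.intervalIntegrable; fun_prop),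
    intervalIntegral.integral_mul_const, intervalIntegral.integral_const] at b2
  rw [← e1, abs_mul, abs_of_pos hC] at b1
  have b3 : (∫ t in x..1, (φ t)^2)*(X*C/2) ≤ 1*(X*C/2) := by gcongr; linarith
  have b4 : (1-x)*(X/(2*C)) ≤ C^2*(X/(2*C)) := by
    have : 1 - x ≤ C^2 := by rw [hC2]; nlinarith [hx.1, hx.2]
    gcongr
  have b5 : C^2*(X/(2*C)) = X*C/2 := by field_simp
  rw [smul_eq_mul] at b2
  have : C*|C*deriv φ x| ≤ C*X := by linarith
  exact le_of_mul_le_mul_left this hC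

end ProlSol

namespace CExt
variable {c χ χm : ℝ} {ψ φ : ℝ → ℝ} {Ψ Φ : ℂ → ℂ}

theorem fl_mono (h : CExt c χ ψ Ψ) {α b : ℝ} (hS : ∀ s ∈ Icc 0 b, 0 ≤ Sre (fl Ψ α s) (gl Ψ α s)) {s t : ℝ}
    (hs : 0 ≤ s) (hst : s ≤ t) (ht : t ≤ b) : ‖fl Ψ α s‖ ≤ ‖fl Ψ α t‖ := by
  have := mono_help hst (f := fun s => ‖fl Ψ α s‖^2) (fun x hx => (hasDerivAt_nsq (h.fl_deriv α x)).continuousAt.continuousWithinAt)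
    (fun x hx => hasDerivAt_nsq (h.fl_deriv α x)) (fun x hx => by
      have := hS x ⟨hs.trans hx.1.le, hx.2.le.trans ht⟩; positivity)
  exact (sq_le_sq₀ (norm_nonneg _) (norm_nonneg _)).1 this

theorem Cl_mono {α s t : ℝ} (hs : 0 ≤ s) (hst : s ≤ t) : ‖Cl α s‖ ≤ ‖Cl α t‖ := by
  apply (sq_le_sq₀ (norm_nonneg _) (norm_nonneg _)).1
  rw [Cl_nsq, Cl_nsq, nl, nl]
  have := sinh_nonneg_iff.2 hs
  have := sinh_le_sinh.2 hst
  gcongr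

theorem ratio_step (h : CExt c χ ψ Ψ) (k : CExt c χm φ Φ) (hΔ : 0 < χ - χm) {α a b A M : ℝ} (ha : 0 < cos α)
    (hS : ∀ s ∈ Icc 0 b, 0 ≤ Sre (fl Ψ α s) (gl Ψ α s)) (ha0 : 0 ≤ a) (hab : a ≤ b) (hA : 0 ≤ A) (hM : 0 ≤ M)
    (hf0 : fl Ψ α a ≠ 0) (hD : ‖gl Φ α a*fl Ψ α a - fl Φ α a*gl Ψ α a‖ ≤ (χ-χm)*A*‖fl Ψ α a‖^2)
    (hf : ‖fl Φ α a‖ ≤ M*‖fl Ψ α a‖) : ‖fl Φ α b‖ ≤ (√(χ-χm)*A + M)*‖fl Ψ α b‖ := by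
  set Δ := χ-χm with hΔd
  have hsub : ∀ s ∈ Icc a b, s ∈ Icc 0 b := fun s hs => ⟨ha0.trans hs.1, hs.2⟩
  have hne : ∀ s ∈ Icc a b, fl Ψ α s ≠ 0 := fun s hs => by
    have := h.fl_mono hS ha0 hs.1 hs.2
    have := norm_pos_iff.2 hf0
    exact norm_pos_iff.1 (by linarith)
  have key := line_energy (f1 := fl Ψ α) (g1 := gl Ψ α) (f2 := fl Φ α) (g2 := gl Φ α) (T := Tl α) (q := ql c χ α) (Δ := Δ) hab
    (fun s _ => h.fl_deriv α s) (fun s _ => h.gl_deriv ha s) (fun s _ => k.fl_deriv α s)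
    (fun s _ => by
      refine (k.gl_deriv ha s).congr_deriv ?_
      simp only [ql, hΔd]; push_cast; ring) hne (fun s hs => hS s (hsub s hs)) (fun s hs => Tl_im_nonneg ha (hsub s hs).1)
  have n0 := norm_pos_iff.2 hf0
  have n1 := norm_pos_iff.2 (hne b ⟨hab, le_rfl⟩)
  have k1 : ‖(gl Φ α a*fl Ψ α a - fl Φ α a*gl Ψ α a)/(fl Ψ α a)^2‖ ≤ Δ*A := by
    rw [norm_div, norm_pow, div_le_iff₀ (by positivity)]; exact hD
  have k2 : ‖fl Φ α a/fl Ψ α a‖ ≤ M := by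
    rw [norm_div, div_le_iff₀ (by positivity)]; exact hf
  have k3 : Δ*‖fl Φ α b/fl Ψ α b‖^2 ≤ (Δ*A)^2 + Δ*M^2 := by
    refine le_trans ?_ (key.trans ?_)
    · have := sq_nonneg ‖(gl Φ α b*fl Ψ α b - fl Φ α b*gl Ψ α b)/(fl Ψ α b)^2‖
      linarith
    · gcongr
  have k4 : ‖fl Φ α b/fl Ψ α b‖^2 ≤ Δ*A^2 + M^2 := by
    have : Δ*‖fl Φ α b/fl Ψ α b‖^2 ≤ Δ*(Δ*A^2 + M^2) := by nlinarith
    exact le_of_mul_le_mul_left this hΔ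
  have k5 : ‖fl Φ α b/fl Ψ α b‖ ≤ √Δ*A + M := by
    apply (sq_le_sq₀ (norm_nonneg _) (by positivity)).1
    have e := sq_sqrt hΔ.le
    have : 0 ≤ √Δ*A*M := by positivity
    nlinarith
  rwa [norm_div, div_le_iff₀ n1] at k5

/-- Wronskian propagation on a line -/
theorem wron_line (h : CExt c χ ψ Ψ) (k : CExt c χm φ Φ) (hΔ : 0 < χ - χm) {α a M w : ℝ} (ha : 0 < cos α)
    (hS : ∀ s ∈ Icc 0 a, 0 ≤ Sre (fl Ψ α s) (gl Ψ α s)) (ha0 : 0 ≤ a) (hM : 0 ≤ M)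
    (hw : |∫ t in (sin α)..1, φ t * ψ t| ≤ w)
    (hf : ∀ s ∈ Icc 0 a, ‖fl Φ α s‖ ≤ M) :
    ‖gl Φ α a*fl Ψ α a - fl Φ α a*gl Ψ α a‖ ≤ (χ-χm)*(w/cos α + a*(M*‖fl Ψ α a‖)) := by
  set W : ℝ → ℂ := fun s => Cl α s*(gl Φ α s*fl Ψ α s - fl Φ α s*gl Ψ α s) with hW
  have hd : ∀ s ∈ Icc 0 a, HasDerivWithinAt W (-((χ:ℂ)-χm)*(Cl α s*(fl Φ α s*fl Ψ α s))) (Icc 0 a) s := fun s hs => by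
    have : HasDerivAt W (-((χ:ℂ)-χm)*(Cl α s*(fl Φ α s*fl Ψ α s))) s := by
      refine ((Cl_deriv α s).fun_mul (((k.gl_deriv ha s).fun_mul (h.fl_deriv α s)).fun_sub ((k.fl_deriv α s).fun_mul (h.gl_deriv ha s)))).congr_deriv ?_
      have := Cl_ne ha s
      simp only [ql, Tl]
      field_simp
      ring
    exact this.hasDerivWithinAt
  have hb : ∀ s ∈ Ico 0 a, ‖-((χ:ℂ)-χm)*(Cl α s*(fl Φ α s*fl Ψ α s))‖ ≤ (χ-χm)*(‖Cl α a‖*(M*‖fl Ψ α a‖)) := fun s hs => by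
    have e : ‖-((χ:ℂ)-χm)‖ = χ-χm := by
      rw [_root_.norm_neg, ← Complex.ofReal_sub, Complex.norm_real, norm_of_nonneg hΔ.le]
    rw [norm_mul, norm_mul, norm_mul, e]
    have h1 := h.fl_mono hS hs.1 hs.2.le le_rfl
    have h2 := Cl_mono (α := α) hs.1 hs.2.le
    have h3 := hf s ⟨hs.1, hs.2.le⟩
    gcongr
  have key := norm_image_sub_le_of_norm_deriv_le_segment' hd hb a ⟨ha0, le_rfl⟩
  rw [sub_zero] at key
  have e0 : ‖W 0‖ ≤ (χ-χm)*w := by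
    have : W 0 = Complex.I*(((1-sin α^2)*(deriv φ (sin α) * ψ (sin α) - φ (sin α) * deriv ψ (sin α)):ℝ):ℂ) := by
      rw [← cos_sq']
      simp only [hW, h.fl_zero, h.gl_zero, k.fl_zero, k.gl_zero, Cl_zero]; push_cast; ring
    rw [this, h.sol.wron k.sol, norm_mul, Complex.norm_I, one_mul, Complex.norm_real, Real.norm_eq_abs, abs_neg, abs_mul, abs_of_pos hΔ]
    gcongr
  have k2 : ‖W a‖ ≤ (χ-χm)*w + (χ-χm)*(‖Cl α a‖*(M*‖fl Ψ α a‖))*a := by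
    have := norm_sub_norm_le (W a) (W 0)
    linarith
  have hC : cos α ≤ ‖Cl α a‖ := by
    have := Cl_mono (α := α) le_rfl ha0
    rw [Cl_zero, Complex.norm_real, norm_of_nonneg ha.le] at this
    exact this
  have hC0 : 0 < ‖Cl α a‖ := by linarith
  have w0 : 0 ≤ w := (abs_nonneg _).trans hw
  simp only [hW, norm_mul] at k2
  have k3 : ‖gl Φ α a*fl Ψ α a - fl Φ α a*gl Ψ α a‖ ≤ ((χ-χm)*w + (χ-χm)*(‖Cl α a‖*(M*‖fl Ψ α a‖))*a)/‖Cl α a‖ := by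
    rw [le_div_iff₀ hC0]; linarith
  refine k3.trans ?_
  have e : ((χ-χm)*w + (χ-χm)*(‖Cl α a‖*(M*‖fl Ψ α a‖))*a)/‖Cl α a‖ = (χ-χm)*(w/‖Cl α a‖ + a*(M*‖fl Ψ α a‖)) := by
    field_simp
  rw [e]
  gcongr

end CExt
end

section
theorem sinh_le_two {s : ℝ} (h0 : 0 ≤ s) (h1 : s ≤ 1) : sinh s ≤ 2*s := by
  rw [sinh_eq]
  have a := (abs_le.1 (Real.abs_exp_sub_one_sub_id_le (x := s) (by rw [abs_of_nonneg h0]; exact h1))).2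
  have b := add_one_le_exp (-s)
  nlinarith

theorem Tl_norm {α : ℝ} (ha : 0 < cos α) (β : ℝ) : ‖Tl α β‖^2 ≤ 1/cos α^2 := by
  have n0 := nl_pos ha β
  rw [Tl, norm_div, div_pow, Zl_nsq, Cl_nsq, div_le_div_iff₀ n0 (by positivity), nl]
  have h1 := sin_sq_le_one α
  have h2 := cos_sq_le_one α
  nlinarith [sq_nonneg (sinh β), sq_nonneg (cos α), mul_nonneg (sub_nonneg.2 h1) (sq_nonneg (cos α)), mul_nonneg (sub_nonneg.2 h2) (sq_nonneg (sinh β))]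

namespace CExt
variable {c χ χm R : ℝ} {ψ φ : ℝ → ℝ} {Ψ Φ : ℂ → ℂ}

theorem ql_norm (hR : 1 < R) (hχ : χ = c^2*R^2) (α β : ℝ) : ‖ql c χ α β‖ ≤ (χ - c^2*sin α^2) + c^2*sinh β^2 := by
  have e : ql c χ α β = ((c^2*(R^2-1):ℝ):ℂ) + ((c^2:ℝ):ℂ)*(Cl α β)^2 := by
    rw [Cl_sq, ql, hχ]; push_cast; ring
  have hR2 : 0 < R^2-1 := by nlinarith
  rw [e]
  refine (norm_add_le _ _).trans ?_
  rw [norm_mul, norm_pow, Cl_nsq, Complex.norm_real, Complex.norm_real, norm_of_nonneg (by positivity), norm_of_nonneg (by positivity), nl, cos_sq', hχ]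
  linarith

theorem sup3 (k : CExt c χm φ Φ) (hc : 60 < c) (hR : 1 < R) (hχ : χ = c^2*R^2) (hΔ : 0 < χ - χm)
    (hm : ∫ t in (-1:ℝ)..1, (φ t)^2 = 1) {x : ℝ} (hx : x ∈ Icc (-1:ℝ) 1) : (φ x)^2 ≤ 8*(c^2*R^2) := by
  have m0 := k.sol.chi_nonneg hm
  have hR2 : 1 < R^2 := by nlinarith
  refine k.sol.sup_bound hm (by nlinarith) (fun t ht => ?_) x hx
  have : t^2 ≤ 1 := by nlinarith [ht.1, ht.2]
  rw [abs_le]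
  constructor <;> nlinarith [sq_nonneg (c*t), sq_nonneg c]

set_option maxHeartbeats 1000000 in
theorem sliver (h : CExt c χ ψ Ψ) (k : CExt c χm φ Φ) (hc : 60 < c) (hR : 1 < R) (hχ : χ = c^2*R^2) (hcd : 48 ≤ c*(R^2-1))
    (h1 : 0 < ψ 1) (hn : ∫ t in (-1:ℝ)..1, (ψ t)^2 = 1) (hm : ∫ t in (-1:ℝ)..1, (φ t)^2 = 1) (hΔ : 0 < χ - χm)
    {α b : ℝ} (hb0 : 0 ≤ b) (ha0 : 0 ≤ sin α) (ha : 0 < cos α) (hb : sin α^2 + sinh b^2 ≤ R^2 - 1/(2*(c^2*(R^2-1))))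
    (hs : cos α^2 < 1/(2*(c^2*(R^2-1)))) :
    ‖fl Φ α b‖ ≤ (27100*c^2*R^3/√(c*(R^2-1)))*‖fl Ψ α b‖ := by
  have hR2 : 0 < R^2-1 := by nlinarith
  have hc0 : 0 < c := by linarith
  have hR0 : 0 < R := by linarith
  have hS := h.theta_mono hc hR hχ hcd h1 ha0 ha hb
  have hx1 : sin α ≤ 1 := sin_le_one α
  have hC := cos_sq' α
  have h7 : 0.7 ≤ ψ 1 := by
    have := h.sol.one_ge hc0 hR hχ hn
    by_contra hlt; push Not at hlt
    have : ψ 1^2 < 0.7^2 := by gcongr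
    norm_num at *; linarith
  have hu : 0.85*ψ 1 ≤ ‖fl Ψ α 0‖ := by
    rw [fl]
    refine (h.local_one hc hR hχ hcd h1 ?_ ?_).1
    · rw [Zl_zero, Complex.ofReal_re]; exact ha0
    · rw [norm_Zsq, nl]; simpa using hs.le
  have hu0 : 0 < ‖fl Ψ α 0‖ := lt_of_lt_of_le (by norm_num; exact h1) hu
  have hsup : ∀ t ∈ Icc (-1:ℝ) 1, |φ t| ≤ 3*(c*R) := fun t ht => by
    apply abs_le_of_sq_le_sq _ (by positivity)
    have := sup3 k hc hR hχ hΔ hm ht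
    nlinarith [mul_pos hc0 hR0]
  have hw : |∫ t in (sin α)..1, φ t * ψ t| ≤ (3*(c*R)*ψ 1)*cos α^2 := by
    have := intervalIntegral.norm_integral_le_of_norm_le_const (a := sin α) (b := 1) (f := fun t => φ t * ψ t) (C := 3*(c*R)*ψ 1) (fun t ht => by
      rw [uIoc_of_le hx1] at ht
      have ht' : t ∈ Icc (-1:ℝ) 1 := ⟨by linarith [ht.1], ht.2⟩
      rw [norm_mul]
      have a1 := hsup t ht'
      have a2 : |ψ t| ≤ ψ 1 := abs_le_of_sq_le_sq (h.sol.le_one hc0 hR hχ ht') h1.le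
      rw [Real.norm_eq_abs, Real.norm_eq_abs]
      gcongr)
    rw [Real.norm_eq_abs, abs_of_nonneg (sub_nonneg.2 hx1)] at this
    refine this.trans ?_
    gcongr
    rw [hC]; nlinarith
  have hf3 : ∀ s ∈ Icc (0:ℝ) 0, ‖fl Φ α s‖ ≤ 3*(c*R) := fun s hs => by
    have : s = 0 := le_antisymm hs.2 hs.1
    rw [this, k.fl_zero, Complex.norm_real]
    exact hsup _ ⟨by linarith, hx1⟩
  have hD := h.wron_line k hΔ ha (a := 0) (fun s hs => hS s ⟨hs.1, hs.2.trans hb0⟩) le_rfl (by positivity) hw hf3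
  have key := h.ratio_step k hΔ ha hS le_rfl hb0 (A := 6*(c*R)*cos α) (M := 6*(c*R)) (by positivity) (by positivity)
    (norm_pos_iff.1 hu0) (hD.trans (by
      have e : 3*(c*R)*ψ 1*cos α^2/cos α = 3*(c*R)*ψ 1*cos α := by field_simp
      rw [zero_mul, add_zero, e, mul_assoc (χ-χm)]
      refine mul_le_mul_of_nonneg_left ?_ hΔ.le
      have h3 : (0.85*ψ 1)^2 ≤ ‖fl Ψ α 0‖^2 := by gcongr
      have h4 : ψ 1/2 ≤ ‖fl Ψ α 0‖^2 := by norm_num at *; nlinarith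
      have := mul_le_mul_of_nonneg_left h4 (by positivity : 0 ≤ 6*(c*R)*cos α)
      linarith))
    ((hf3 0 ⟨le_rfl, le_rfl⟩).trans (by
      have : 1/2 ≤ ‖fl Ψ α 0‖ := by norm_num at *; linarith
      have := mul_le_mul_of_nonneg_left this (by positivity : 0 ≤ 6*(c*R))
      linarith))
  refine key.trans ?_
  gcongr
  set y := c*(R^2-1) with hy
  have y0 : 0 < y := by positivity
  have sy : 0 < √y := sqrt_pos.2 y0
  have sy2 : √y^2 = y := sq_sqrt y0.le
  rw [le_div_iff₀ sy]
  have b1 : √(χ-χm) ≤ c*R := by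
    rw [sqrt_le_left (by positivity)]
    have := k.sol.chi_nonneg hm
    nlinarith
  have b2 : cos α*√y ≤ 1 := by
    have : (cos α*√y)^2 ≤ 1 := by
      rw [mul_pow, sy2]
      have e : c^2*(R^2-1) = c*y := by rw [hy]; ring
      rw [e, lt_div_iff₀ (by positivity)] at hs
      have : 0 ≤ cos α^2*y := by positivity
      nlinarith
    exact (abs_le_one_iff_mul_self_le_one.2 (by rw [← sq]; exact this)) |> (le_abs_self _).trans
  have b3 : √y ≤ c*R^2 := by
    rw [sqrt_le_left (by positivity)]
    have : y ≤ c*R^2 := by rw [hy]; nlinarith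
    have : 1 ≤ c*R^2 := by linarith
    nlinarith
  calc (√(χ-χm)*(6*(c*R)*cos α) + 6*(c*R))*√y = 6*(c*R)*√(χ-χm)*(cos α*√y) + 6*(c*R)*√y := by ring
    _ ≤ 6*(c*R)*(c*R)*1 + 6*(c*R)*(c*R^2) := by gcongr
    _ = 6*c^2*R^2*1 + 6*c^2*R^3 := by ring
    _ ≤ 6*c^2*R^2*R + 6*c^2*R^3 := by gcongr
    _ = 12*(c^2*R^3) := by ring
    _ ≤ 27100*(c^2*R^3) := by gcongr; norm_num
    _ = _ := by ring

end CExt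
end

section
namespace CExt
variable {c χ χm R : ℝ} {ψ φ : ℝ → ℝ} {Ψ Φ : ℂ → ℂ}

/-- bounds for the initial segment -/
theorem start (hc : 60 < c) (hR : 1 < R) (hχ : χ = c^2*R^2) (hcd : 48 ≤ c*(R^2-1)) (α : ℝ) {hh : ℝ}
    (hh0 : 0 < hh) (hhd : hh^2 = 1/(900*(χ - c^2*sin α^2))) :
    c^2*(R^2-1) ≤ χ - c^2*sin α^2 ∧ hh ≤ 1 ∧ (∀ s ∈ Icc 0 hh, c^2*sinh s^2 ≤ χ - c^2*sin α^2) ∧ sinh hh^2 ≤ (R^2-1)/4 := by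
  have hR2 : 0 < R^2-1 := by nlinarith
  have hc0 : 0 < c := by linarith
  have h1 : c^2*(R^2-1) ≤ χ - c^2*sin α^2 := by
    have := sin_sq_le_one α
    rw [hχ]; nlinarith [sq_nonneg c]
  set q := χ - c^2*sin α^2 with hq
  have hq48 : 48*c ≤ q := by nlinarith
  have hq0 : 0 < q := by nlinarith
  have hm : hh^2*q = 1/900 := by rw [hhd]; field_simp
  have h2 : hh ≤ 1 := by
    by_contra hlt; push Not at hlt
    nlinarith
  have h3 : ∀ s ∈ Icc 0 hh, sinh s^2 ≤ 4*hh^2 := fun s hs => by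
    have a := sinh_le_two hs.1 (hs.2.trans h2)
    have b := sinh_nonneg_iff.2 hs.1
    have : sinh s ≤ 2*hh := by linarith [hs.2]
    calc _ ≤ (2*hh)^2 := by gcongr
      _ = _ := by ring
  refine ⟨h1, h2, fun s hs => ?_, ?_⟩
  · have h4 : c^2*4*hh^2 ≤ q := by
      have : c^2*4*hh^2*q ≤ q*q := by nlinarith
      exact le_of_mul_le_mul_right this hq0
    have := mul_le_mul_of_nonneg_left (h3 s hs) (sq_nonneg c)
    linarith
  · refine (h3 hh ⟨hh0.le, le_rfl⟩).trans ?_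
    have e1 : c^2*(R^2-1)*(R^2-1) = (c*(R^2-1))^2 := by ring
    have : 4*hh^2*q ≤ (R^2-1)/4*q := by
      have := mul_le_mul_of_nonneg_right h1 hR2.le
      nlinarith
    exact le_of_mul_le_mul_right this hq0

set_option maxHeartbeats 1000000 in
theorem lower_h (h : CExt c χ ψ Ψ) (hc : 60 < c) (hR : 1 < R) (hχ : χ = c^2*R^2) (hcd : 48 ≤ c*(R^2-1))
    (hn : ∫ t in (-1:ℝ)..1, (ψ t)^2 = 1) {α hh : ℝ} (ha0 : 0 ≤ sin α) (ha : 0 < cos α)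
    (hs : 1/(2*(c^2*(R^2-1))) ≤ cos α^2) (hh0 : 0 < hh) (hhd : hh^2 = 1/(900*(χ - c^2*sin α^2))) :
    (R^2-1)/(27000*R^2)/√(c*(R^2-1)) ≤ cos α*‖fl Ψ α hh‖^2 ∧ (R^2-1)/(27000*R^2) ≤ ‖fl Ψ α hh‖^2 := by
  obtain ⟨h1, h2, h3, h4⟩ := start hc hR hχ hcd α hh0 hhd
  have hR2 : 0 < R^2-1 := by nlinarith
  have hc0 : 0 < c := by linarith
  set q := χ - c^2*sin α^2 with hq
  have hq0 : 0 < q := lt_of_lt_of_le (by positivity) h1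
  have hm : hh^2*q = 1/900 := by rw [hhd]; field_simp
  have key := line_taylor (f := fl Ψ α) (g := gl Ψ α) (T := Tl α) (q := ql c χ α) (s := hh) (u := ψ (sin α)) (v := cos α*deriv ψ (sin α)) hh0
    (fun x _ => h.fl_deriv α x) (fun x _ => h.gl_deriv ha x) (fun x hx => by
      have a := Tl_norm ha x
      have b : 1/cos α^2 ≤ 2*q := by
        rw [div_le_iff₀ (by positivity)] at hs
        rw [div_le_iff₀ (by positivity)]
        nlinarith [sq_nonneg (cos α)]
      have : (‖Tl α x‖*hh)^2 ≤ (1/20)^2 := by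
        rw [mul_pow]
        calc _ ≤ 2*q*hh^2 := by gcongr; linarith
          _ ≤ _ := by linarith
      exact (sq_le_sq₀ (by positivity) (by norm_num)).1 this)
    (fun x hx => by
      have a := ql_norm hR hχ α x
      have b := h3 x hx
      calc _ ≤ 2*q*hh^2 := by gcongr; linarith
        _ ≤ _ := by linarith) (h.fl_zero α) (h.gl_zero α)
  have e1 : hh^2*(cos α*deriv ψ (sin α))^2 = 1/900*((1-sin α^2)*(deriv ψ (sin α))^2/q) := by
    rw [hhd, mul_pow, cos_sq']; field_simp
  rw [e1] at key
  have hx1 : sin α < 1 := by nlinarith [sin_sq_add_cos_sq α]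
  have am := h.sol.amp hc hR hχ (by linarith) hn ha0 hx1 (by rw [← cos_sq']; convert hs using 2; ring)
  rw [← cos_sq', sqrt_sq ha.le, cos_sq', ← hq] at am
  have hF : 1/1800*((ψ (sin α))^2 + (1-sin α^2)*(deriv ψ (sin α))^2/q) ≤ ‖fl Ψ α hh‖^2 := by
    have := sq_nonneg (ψ (sin α))
    linarith
  constructor
  · calc _ = 1/1800*((R^2-1)/(15*R^2)/√(c*(R^2-1))) := by field_simp; norm_num
      _ ≤ 1/1800*(cos α * ((ψ (sin α))^2 + (1-sin α^2)*(deriv ψ (sin α))^2/q)) := by gcongr; exact am.1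
      _ = cos α * (1/1800*((ψ (sin α))^2 + (1-sin α^2)*(deriv ψ (sin α))^2/q)) := by ring
      _ ≤ _ := by gcongr
  · calc _ = 1/1800*((R^2-1)/(15*R^2)) := by field_simp; norm_num
      _ ≤ 1/1800*((ψ (sin α))^2 + (1-sin α^2)*(deriv ψ (sin α))^2/q) := by gcongr; exact am.2
      _ ≤ _ := hF

set_option maxHeartbeats 1000000 in
theorem upper_m (k : CExt c χm φ Φ) (hc : 60 < c) (hR : 1 < R) (hχ : χ = c^2*R^2) (hcd : 48 ≤ c*(R^2-1))
    (hm : ∫ t in (-1:ℝ)..1, (φ t)^2 = 1) (hΔ : 0 < χ - χm) {α hh : ℝ} (ha0 : 0 ≤ sin α) (ha : 0 < cos α)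
    (hh0 : 0 < hh) (hhd : hh^2 = 1/(900*(χ - c^2*sin α^2))) : ∀ s ∈ Icc 0 hh, ‖fl Φ α s‖ ≤ 3.5*(c*R) := by
  obtain ⟨h1, h2, h3, h4⟩ := start hc hR hχ hcd α hh0 hhd
  have hR2 : 0 < R^2-1 := by nlinarith
  have hc0 : 0 < c := by linarith
  set q := χ - c^2*sin α^2 with hq
  have hq0 : 0 < q := lt_of_lt_of_le (by positivity) h1
  have hmm : hh^2*q = 1/900 := by rw [hhd]; field_simp
  set X := (χ-χm) + q with hX
  have X0 : 0 < X := by positivity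
  have m0 := k.sol.chi_nonneg hm
  have hx1 : sin α ≤ 1 := sin_le_one α
  have X2 : X ≤ 2*χ := by rw [hX, hq]; nlinarith [mul_nonneg (sq_nonneg c) (sq_nonneg (sin α))]
  have hv : |cos α*deriv φ (sin α)| ≤ X := k.sol.cder_le hm ⟨ha0, hx1⟩ ha (cos_sq' α) (fun t ht => by
    have t1 : t^2 ≤ 1 := by nlinarith [ht.1, ht.2]
    have t2 : sin α^2 ≤ t^2 := by nlinarith [ht.1]
    have c2 := mul_le_mul_of_nonneg_left t1 (sq_nonneg c)
    have c3 := mul_le_mul_of_nonneg_left t2 (sq_nonneg c)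
    have : c^2 ≤ χ := by rw [hχ]; nlinarith [sq_nonneg c]
    rw [abs_le]
    constructor <;> linarith)
  have key := line_growth (f := fl Φ α) (g := gl Φ α) (T := Tl α) (q := ql c χm α) (X := X) (K := 3*√q) (b := hh) X0 (by positivity)
    (fun x _ => k.fl_deriv α x) (fun x _ => k.gl_deriv ha x) (fun x hx => Tl_im_nonneg ha hx.1) (fun x hx => by
      have e : ql c χm α x + X = ql c χ α x + ((q:ℝ):ℂ) := by simp only [ql, hX]; push_cast; ring
      rw [e]
      have a := ql_norm hR hχ α x
      have b := h3 x hx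
      have d := norm_add_le (ql c χ α x) ((q:ℝ):ℂ)
      rw [Complex.norm_real, norm_of_nonneg hq0.le] at d
      have f : q ≤ √q*√X := by
        have e1 := mul_self_sqrt hq0.le
        have e2 : √q ≤ √X := sqrt_le_sqrt (by linarith)
        nlinarith [sqrt_nonneg q]
      linarith)
  intro s hs
  have ks := key s hs
  rw [k.fl_zero, k.gl_zero, norm_mul, Complex.norm_I, one_mul, Complex.norm_real, Complex.norm_real, Real.norm_eq_abs, Real.norm_eq_abs, sq_abs (φ _)] at ks
  have hex : exp (3*√q*s) ≤ 1.2 := by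
    have : √q*hh = 1/30 := by
      have : (√q*hh)^2 = (1/30)^2 := by rw [mul_pow, sq_sqrt hq0.le]; linarith
      exact (sq_eq_sq₀ (by positivity) (by norm_num)).1 this
    have h5 : 3*√q*s ≤ 0.1 := by
      calc _ ≤ 3*√q*hh := by gcongr; exact hs.2
        _ = 3*(√q*hh) := by ring
        _ ≤ _ := by rw [this]; norm_num
    refine (exp_le_exp.2 h5).trans ?_
    have := (abs_le.1 (Real.abs_exp_sub_one_sub_id_le (x := 0.1) (by norm_num))).2
    norm_num at *; linarith
  have hu := sup3 k hc hR hχ hΔ hm (x := sin α) ⟨by linarith, hx1⟩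
  rw [← hχ] at hu
  have χ0 : 0 < χ := by rw [hχ]; positivity
  have h6 : X*‖fl Φ α s‖^2 ≤ X*(12*χ) := by
    calc X*‖fl Φ α s‖^2 ≤ (|cos α*deriv φ (sin α)|^2 + X*(φ (sin α))^2)*exp (3*√q*s) := by
          have := sq_nonneg ‖gl Φ α s‖; linarith
      _ ≤ (X^2 + X*(8*χ))*1.2 := by gcongr
      _ ≤ _ := by norm_num; nlinarith
  have h7 := le_of_mul_le_mul_left h6 X0
  apply (sq_le_sq₀ (norm_nonneg _) (by positivity)).1
  rw [hχ] at h7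
  nlinarith [mul_pos hc0 (by linarith : 0 < R)]

end CExt
end

section
namespace CExt
variable {c χ χm R : ℝ} {ψ φ : ℝ → ℝ} {Ψ Φ : ℂ → ℂ}

theorem final_arith {c R N C F hh sD : ℝ} (hc : 60 < c) (hR : 1 < R) (hcd : 48 ≤ c*(R^2-1)) (hN0 : 0 < N)
    (hN : (R^2-1)/(27000*R^2) ≤ N^2) (hC : 0 < C) (hF : F = N^2)
    (hCF : (R^2-1)/(27000*R^2)/√(c*(R^2-1)) ≤ C*F) (hh0 : 0 < hh) (hhd : hh*(30*(c*√(R^2-1))) ≤ 1) (hsD : sD ≤ c*R) (hsD0 : 0 ≤ sD) :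
    sD*(1/(C*F) + hh*(3.5*(c*R))/N) + 3.5*(c*R)/N ≤ 27100*c^2*R^3/√(c*(R^2-1)) := by
  have hR2 : 0 < R^2-1 := by nlinarith
  have hc0 : 0 < c := by linarith
  have hR0 : 0 < R := by linarith
  set d := √(R^2-1) with hd
  have d0 : 0 < d := sqrt_pos.2 hR2
  have d2 : d^2 = R^2-1 := sq_sqrt hR2.le
  set e := √c with he
  have e0 : 0 < e := sqrt_pos.2 hc0
  have e2 : e^2 = c := sq_sqrt hc0.le
  have e7 : 7.7 ≤ e := by rw [he]; apply le_sqrt_of_sq_le; norm_num; linarith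
  have hy : √(c*(R^2-1)) = e*d := sqrt_mul hc0.le _
  rw [hy] at hCF ⊢
  rw [← d2] at hN hCF hcd
  have ed : 6.9 ≤ e*d := by
    by_contra hlt; push Not at hlt
    have : (e*d)^2 < 6.9^2 := by gcongr
    rw [mul_pow, e2] at this; norm_num at this; linarith
  have n1 : 1/N ≤ 165*R/d := by
    rw [div_le_div_iff₀ hN0 d0]
    rw [div_le_iff₀ (by positivity)] at hN
    have : d^2 ≤ (165*R*N)^2 := by nlinarith [mul_pos hR0 hN0]
    linarith [(sq_le_sq₀ d0.le (by positivity)).1 this]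
  have n2 : 1/(C*F) ≤ 27000*R^2*e/d := by
    have : 0 < d^2/(27000*R^2)/(e*d) := by positivity
    calc 1/(C*F) ≤ 1/(d^2/(27000*R^2)/(e*d)) := by gcongr
      _ = _ := by field_simp
  have n3 : hh ≤ 1/(30*(c*d)) := by rw [le_div_iff₀ (by positivity)]; exact hhd
  have t1 : sD*(1/(C*F)) ≤ 27000*(c^2*R^3/(e*d)) := by
    have CF0 : 0 < C*F := by rw [hF]; positivity
    calc _ ≤ c*R*(27000*R^2*e/d) := by gcongr
      _ = 27000*((e^2)*c*R^3/(e*d)) := by field_simp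
      _ = _ := by rw [e2]; ring
  have t2 : sD*(hh*(3.5*(c*R))/N) ≤ 3*(c^2*R^3/(e*d)) := by
    calc _ = sD*hh*(3.5*(c*R))*(1/N) := by ring
      _ ≤ (c*R)*(1/(30*(c*d)))*(3.5*(c*R))*(165*R/d) := by gcongr
      _ = 19.25*(c*R^3/(d*d)) := by field_simp; norm_num
      _ = 19.25*(e^2*c*R^3/(e*d))/(e*d) := by field_simp
      _ ≤ 19.25*(e^2*c*R^3/(e*d))/6.9 := by gcongr
      _ = (19.25/6.9)*(c^2*R^3/(e*d)) := by rw [e2]; ring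
      _ ≤ _ := by gcongr; norm_num
  have t3 : 3.5*(c*R)/N ≤ 76*(c^2*R^3/(e*d)) := by
    calc _ = 3.5*(c*R)*(1/N) := by ring
      _ ≤ 3.5*(c*R)*(165*R/d) := by gcongr
      _ = 577.5*(e*c*R^2/(e*d)) := by field_simp; norm_num
      _ ≤ 577.5*((c/7.7)*c*(R^2*R)/(e*d)) := by
          gcongr
          · rw [le_div_iff₀ (by norm_num), ← e2, sq]; gcongr
          · nlinarith
      _ = 75*(c^2*R^3/(e*d)) := by ring
      _ ≤ _ := by gcongr; norm_num
  have p : 0 < c^2*R^3/(e*d) := by positivity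
  calc _ = sD*(1/(C*F)) + sD*(hh*(3.5*(c*R))/N) + 3.5*(c*R)/N := by ring
    _ ≤ 27100*(c^2*R^3/(e*d)) := by linarith
    _ = _ := by ring

set_option maxHeartbeats 1000000 in
theorem nonsliver (h : CExt c χ ψ Ψ) (k : CExt c χm φ Φ) (hc : 60 < c) (hR : 1 < R) (hχ : χ = c^2*R^2) (hcd : 48 ≤ c*(R^2-1))
    (h1 : 0 < ψ 1) (hn : ∫ t in (-1:ℝ)..1, (ψ t)^2 = 1) (hm : ∫ t in (-1:ℝ)..1, (φ t)^2 = 1) (hΔ : 0 < χ - χm)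
    {α b : ℝ} (hb0 : 0 ≤ b) (ha0 : 0 ≤ sin α) (ha : 0 < cos α) (hb : sin α^2 + sinh b^2 = R^2 - 1/(2*(c^2*(R^2-1))))
    (hs : 1/(2*(c^2*(R^2-1))) ≤ cos α^2) :
    ‖fl Φ α b‖ ≤ (27100*c^2*R^3/√(c*(R^2-1)))*‖fl Ψ α b‖ := by
  have hR2 : 0 < R^2-1 := by nlinarith
  have hc0 : 0 < c := by linarith
  have hR0 : 0 < R := by linarith
  have hS := h.theta_mono hc hR hχ hcd h1 ha0 ha hb.le
  have hq0 : 0 < χ - c^2*sin α^2 := by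
    have := sin_sq_le_one α
    have : 0 < c^2*(R^2-1) := by positivity
    rw [hχ]; nlinarith [sq_nonneg c]
  set hh := √(1/(900*(χ - c^2*sin α^2))) with hhdef
  have hh0 : 0 < hh := sqrt_pos.2 (by positivity)
  have hhd : hh^2 = 1/(900*(χ - c^2*sin α^2)) := sq_sqrt (by positivity)
  obtain ⟨s1, s2, s3, s4⟩ := start hc hR hχ hcd α hh0 hhd
  obtain ⟨l1, l2⟩ := h.lower_h hc hR hχ hcd hn ha0 ha hs hh0 hhd
  have um := upper_m k hc hR hχ hcd hm hΔ ha0 ha hh0 hhd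
  have N0 : 0 < ‖fl Ψ α hh‖ := by
    have : 0 < ‖fl Ψ α hh‖^2 := lt_of_lt_of_le (by positivity) l2
    exact (norm_nonneg _).lt_of_ne' (fun h0 => by rw [h0] at this; norm_num at this)
  have hhb : hh ≤ b := by
    have hω : 1/(2*(c^2*(R^2-1))) ≤ (R^2-1)/2 := by
      rw [div_le_div_iff₀ (by positivity) (by norm_num)]
      have e1 : (R^2-1)*(2*(c^2*(R^2-1))) = 2*(c*(R^2-1))^2 := by ring
      nlinarith
    have : sinh hh^2 ≤ sinh b^2 := by
      have := sin_sq_add_cos_sq α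
      nlinarith [sq_nonneg (cos α)]
    have := (sq_le_sq₀ (sinh_nonneg_iff.2 hh0.le) (sinh_nonneg_iff.2 hb0)).1 this
    exact sinh_le_sinh.1 this
  have hw := h.sol.wron_int_le k.sol hn hm (x := sin α) ⟨by linarith, sin_le_one α⟩
  have hD := h.wron_line k hΔ ha (a := hh) (fun s hs => hS s ⟨hs.1, hs.2.trans hhb⟩) hh0.le (by positivity) hw um
  set N := ‖fl Ψ α hh‖ with hN
  have key := h.ratio_step k hΔ ha hS hh0.le hhb (A := 1/(cos α*N^2) + hh*(3.5*(c*R))/N) (M := 3.5*(c*R)/N) (by positivity) (by positivity)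
    (norm_pos_iff.1 N0) (hD.trans (le_of_eq (by rw [← hN]; field_simp))) ((um hh ⟨hh0.le, le_rfl⟩).trans (le_of_eq (by rw [← hN]; field_simp)))
  refine key.trans ?_
  refine mul_le_mul_of_nonneg_right ?_ (norm_nonneg _)
  refine final_arith hc hR hcd N0 l2 ha rfl l1 hh0 ?_ ?_ (sqrt_nonneg _)
  · have : (hh*(30*(c*√(R^2-1))))^2 ≤ 1^2 := by
      rw [mul_pow, mul_pow, mul_pow, sq_sqrt hR2.le, hhd, div_mul_eq_mul_div, div_le_iff₀ (by positivity)]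
      linarith
    exact (sq_le_sq₀ (by positivity) (by norm_num)).1 this
  · rw [sqrt_le_left (by positivity)]
    have := k.sol.chi_nonneg hm
    nlinarith

end CExt
end

section
theorem exists_theta {z : ℂ} (hre : 0 ≤ z.re) (him : 0 < z.im) :
    ∃ α β : ℝ, 0 ≤ sin α ∧ 0 < cos α ∧ 0 < β ∧ Zl α β = z := by
  obtain ⟨w, hw⟩ := Complex.sin_surjective z
  have e : Zl w.re w.im = z := by rw [Zl, Complex.re_add_im]; exact hw
  have r := Zl_re w.re w.im
  have i := Zl_im w.re w.im
  rw [e] at r i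
  have hc := cosh_pos w.im
  have hs : 0 ≤ sin w.re := by
    by_contra hlt; push Not at hlt
    nlinarith [mul_neg_of_neg_of_pos hlt hc]
  rw [i] at him
  rcases pos_and_pos_or_neg_and_neg_of_mul_pos him with ⟨a, b⟩ | ⟨a, b⟩
  · exact ⟨w.re, w.im, hs, a, sinh_pos_iff.1 b, e⟩
  · refine ⟨π - w.re, -w.im, by rw [sin_pi_sub]; exact hs, by rw [cos_pi_sub]; linarith, ?_, ?_⟩
    · have := sinh_neg_iff.1 b; linarith
    · rw [← e, Zl_eq, Zl_eq, sin_pi_sub, cos_pi_sub, cosh_neg, sinh_neg]; push_cast; ring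

namespace CExt
variable {c χ χm R : ℝ} {ψ φ : ℝ → ℝ} {Ψ Φ : ℂ → ℂ}

theorem quad_red {P : ℂ → Prop} (hconj : ∀ z, P ((starRingEnd ℂ) z) → P z) (hneg : ∀ z, P (-z) → P z)
    {z : ℂ} (h : ∀ w : ℂ, ‖w‖ = ‖z‖ → 0 ≤ w.re → 0 ≤ w.im → (w.im = 0 → z.im = 0) → P w) : P z := by
  rcases le_total 0 z.re with a | a <;> rcases le_total 0 z.im with b | b
  · exact h z rfl a b id
  · exact hconj z (h _ (by simp) (by simpa using a) (by simpa using b) (by simp))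
  · refine hneg z (hconj _ (h _ (by simp) (by simpa using a) (by simpa using b) (by simp)))
  · exact hneg z (h _ (by simp) (by simpa using a) (by simpa using b) (by simp))

theorem ratio_bound (h : CExt c χ ψ Ψ) (k : CExt c χm φ Φ) (hc : 60 < c) (hR : 1 < R) (hχ : χ = c^2*R^2) (hcd : 48 ≤ c*(R^2-1))
    (h1 : 0 < ψ 1) (hn : ∫ t in (-1:ℝ)..1, (ψ t)^2 = 1) (hm : ∫ t in (-1:ℝ)..1, (φ t)^2 = 1) (hΔ : 0 < χ - χm)
    {z : ℂ} (hz : ‖z‖^2 = R^2 - 1/(2*(c^2*(R^2-1)))) :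
    ‖Φ z‖ ≤ (27100*c^2*R^3/√(c*(R^2-1)))*‖Ψ z‖ := by
  set B := 27100*c^2*R^3/√(c*(R^2-1)) with hB
  have first : ∀ z : ℂ, ‖z‖^2 = R^2 - 1/(2*(c^2*(R^2-1))) → 0 ≤ z.re → 0 < z.im → ‖Φ z‖ ≤ B*‖Ψ z‖ := by
    intro z hz hre him
    obtain ⟨α, β, ha0, ha, hb, e⟩ := exists_theta hre him
    have hb' : sin α^2 + sinh β^2 = R^2 - 1/(2*(c^2*(R^2-1))) := by rw [← Zl_nsq, e, hz]
    have : ‖fl Φ α β‖ ≤ B*‖fl Ψ α β‖ := by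
      rcases lt_or_ge (cos α^2) (1/(2*(c^2*(R^2-1)))) with hs | hs
      · exact h.sliver k hc hR hχ hcd h1 hn hm hΔ hb.le ha0 ha hb'.le hs
      · exact h.nonsliver k hc hR hχ hcd h1 hn hm hΔ hb.le ha0 ha hb' hs
    rwa [fl, fl, e] at this
  refine quad_red (P := fun z => ‖Φ z‖ ≤ B*‖Ψ z‖) (fun z hz => by rwa [k.norm_conj, h.norm_conj] at hz)
    (fun z hz => by rwa [k.norm_neg, h.norm_neg] at hz) (fun w hw hre him _ => ?_)
  rw [← hw] at hz
  rcases him.eq_or_lt with him | him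
  · -- real point: limit
    have hcl : IsClosed {θ : ℝ | ‖Φ (w*Complex.exp (θ*Complex.I))‖ ≤ B*‖Ψ (w*Complex.exp (θ*Complex.I))‖} := by
      have := h.diff.continuous
      have := k.diff.continuous
      exact isClosed_le (by fun_prop) (by fun_prop)
    have hsub : Ioc 0 (π/2) ⊆ {θ : ℝ | ‖Φ (w*Complex.exp (θ*Complex.I))‖ ≤ B*‖Ψ (w*Complex.exp (θ*Complex.I))‖} := by
      intro θ hθ
      have ew : w = ((w.re:ℝ):ℂ) := by apply Complex.ext <;> simp [him]
      have wr : w*Complex.exp (θ*Complex.I) = ((w.re*cos θ:ℝ):ℂ) + ((w.re*sin θ:ℝ):ℂ)*Complex.I := by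
        rw [Complex.exp_mul_I]; nth_rewrite 1 [ew]; push_cast; ring
      have hw0 : 0 < w.re := by
        refine hre.lt_of_ne' (fun h0 => ?_)
        rw [nsq, h0, ← him] at hz
        have hR2 : 0 < R^2-1 := by nlinarith
        have : 1/(2*(c^2*(R^2-1))) ≤ 1 := by
          rw [div_le_one (by positivity)]
          nlinarith
        nlinarith
      apply first
      · rw [norm_mul, Complex.norm_exp_ofReal_mul_I, mul_one]; exact hz
      · rw [wr]; simp [-Complex.ofReal_mul]
        exact mul_nonneg hre (cos_nonneg_of_mem_Icc ⟨by linarith [hθ.1, pi_pos], hθ.2⟩)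
      · rw [wr]; simp [-Complex.ofReal_mul]
        exact mul_pos hw0 (sin_pos_of_pos_of_lt_pi hθ.1 (by linarith [hθ.2, pi_pos]))
    have := closure_minimal hsub hcl
    rw [closure_Ioc (by positivity)] at this
    have := this ⟨le_rfl, by positivity⟩
    simpa using this
  · exact first w hz hre him

theorem zero_free (h : CExt c χ ψ Ψ) (hc : 60 < c) (hR : 1 < R) (hχ : χ = c^2*R^2) (hcd : 48 ≤ c*(R^2-1))
    (h1 : 0 < ψ 1) {z : ℂ} (hz : ‖z‖^2 ≤ R^2 - 1/(2*(c^2*(R^2-1)))) (h0 : Ψ z = 0) :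
    ∃ x : ℝ, x ∈ Ioo (-1:ℝ) 1 ∧ z = x ∧ ψ x = 0 := by
  have hR2 : 0 < R^2-1 := by nlinarith
  have hc0 : 0 < c := by linarith
  have him : z.im = 0 := by
    by_contra hne
    refine quad_red (P := fun z => Ψ z ≠ 0) (fun z hz => by rwa [← norm_ne_zero_iff, h.norm_conj, norm_ne_zero_iff] at hz)
      (fun z hz => by rwa [← norm_ne_zero_iff, h.norm_neg, norm_ne_zero_iff] at hz) (fun w hw hre him hi => ?_) h0
    rw [← hw] at hz
    have him : 0 < w.im := him.lt_of_ne' (fun h => hne (hi h))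
    obtain ⟨α, β, ha0, ha, hb, e⟩ := exists_theta hre him
    have hb' : sin α^2 + sinh β^2 ≤ R^2 - 1/(2*(c^2*(R^2-1))) := by rw [← Zl_nsq, e]; exact hz
    have hS := h.theta_mono hc hR hχ hcd h1 ha0 ha hb'
    set Q := (χ - c^2*sin α^2) + c^2*sinh β^2 with hQ
    have Q0 : 0 ≤ Q := (norm_nonneg _).trans (ql_norm hR hχ α β)
    set s := min β (min (cos α/20) (1/(20*(Q+1)))) with hs
    have s0 : 0 < s := by
      rw [hs]; refine lt_min hb (lt_min (by positivity) (by positivity))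
    have sb : s ≤ β := min_le_left _ _
    have sc : s ≤ cos α/20 := (min_le_right _ _).trans (min_le_left _ _)
    have sq : s ≤ 1/(20*(Q+1)) := (min_le_right _ _).trans (min_le_right _ _)
    have key := line_taylor (f := fl Ψ α) (g := gl Ψ α) (T := Tl α) (q := ql c χ α) (s := s) (u := ψ (sin α)) (v := cos α*deriv ψ (sin α)) s0
      (fun x _ => h.fl_deriv α x) (fun x _ => h.gl_deriv ha x) (fun x hx => by
        have a := Tl_norm ha x
        have : ‖Tl α x‖ ≤ 1/cos α := by
          apply (sq_le_sq₀ (norm_nonneg _) (by positivity)).1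
          rw [div_pow, one_pow]; exact a
        calc _ ≤ 1/cos α*(cos α/20) := by gcongr
          _ = _ := by field_simp)
      (fun x hx => by
        have a := ql_norm hR hχ α x
        have : ‖ql c χ α x‖ ≤ Q := by
          refine a.trans ?_
          have := sinh_nonneg_iff.2 hx.1
          have := sinh_le_sinh.2 (hx.2.trans sb)
          rw [hQ]; gcongr
        rw [le_div_iff₀ (by positivity)] at sq
        have s1 : s ≤ 1 := by nlinarith
        have : ‖ql c χ α x‖*s^2 ≤ Q*s^2 := by gcongr
        have : Q*s^2 ≤ Q*s := by
          have : s^2 ≤ s := by nlinarith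
          gcongr
        nlinarith) (h.fl_zero α) (h.gl_zero α)
    have pos : 0 < (ψ (sin α))^2 + s^2*(cos α*deriv ψ (sin α))^2 := by
      by_cases hu : ψ (sin α) = 0
      · have := h.sol.deriv_ne h1.ne' hu
        have : 0 < (cos α*deriv ψ (sin α))^2 := by positivity
        positivity
      · positivity
    have f0 : 0 < ‖fl Ψ α s‖ := (norm_nonneg _).lt_of_ne' (fun h0 => by rw [h0] at key; linarith)
    have := h.fl_mono hS s0.le sb le_rfl
    have : 0 < ‖fl Ψ α β‖ := by linarith
    rw [fl, e] at this
    exact norm_pos_iff.1 this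
  have ez : z = ((z.re:ℝ):ℂ) := by apply Complex.ext <;> simp [him]
  set x := z.re with hx
  have hψ : ψ x = 0 := by
    have := h.ext x
    rw [← ez, h0] at this
    exact_mod_cast this.symm
  refine ⟨x, ?_, ez, hψ⟩
  by_contra hno
  have hx1 : 1 ≤ |x| := by
    by_contra hlt; push Not at hlt
    exact hno (abs_lt.1 hlt)
  have hxR : |x| ≤ R := by
    have : |x|^2 ≤ R^2 := by
      rw [ez, Complex.norm_real, Real.norm_eq_abs] at hz
      have : 0 < 1/(2*(c^2*(R^2-1))) := by positivity
      linarith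
    exact (sq_le_sq₀ (abs_nonneg _) (by linarith)).1 this
  have hb := (h.sol.barrier_pos hR hχ h1 |x| ⟨hx1, hxR⟩).1
  have : ψ |x| = 0 := by
    rcases abs_choice x with e | e
    · rw [e]; exact hψ
    · rw [e]
      rcases h.sol.parity with hp | hp
      · rw [hp]; exact hψ
      · rw [hp, hψ]; simp
  linarith

theorem one_le_bound (h : CExt c χ ψ Ψ) (hc : 60 < c) (hR : 1 < R) (hχ : χ = c^2*R^2) (hcd : 48 ≤ c*(R^2-1))
    (h1 : 0 < ψ 1) (hn : ∫ t in (-1:ℝ)..1, (ψ t)^2 = 1) : (ψ 1)^2 ≤ 6*(c*(c*(R^2-1))) := by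
  have hR2 : 0 < R^2-1 := by nlinarith
  have hc0 : 0 < c := by linarith
  have cψ := h.sol.cont
  set ω := 1/(2*(c^2*(R^2-1))) with hω
  have hω0 : 0 < ω := by positivity
  have hω1 : ω ≤ 1 := by
    rw [hω, div_le_one (by positivity)]; nlinarith
  have a := int_sub_le (F := fun t => (ψ t)^2) (by fun_prop) (fun t => sq_nonneg _) (x := 1-ω/2) ⟨by linarith, by linarith⟩
  have b : ∫ t in (1-ω/2)..1, (0.85*ψ 1)^2 ≤ ∫ t in (1-ω/2)..1, (ψ t)^2 := by
    apply intervalIntegral.integral_mono_on (by linarith) (by simp) (by apply Continuous.intervalIntegrable; fun_prop)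
    intro t ht
    have := (h.local_one hc hR hχ hcd h1 (z := (t:ℂ)) (by simp; linarith [ht.1]) (by
      rw [← Complex.ofReal_pow, ← Complex.ofReal_one, ← Complex.ofReal_sub, Complex.norm_real, Real.norm_eq_abs, abs_sub_comm, abs_of_nonneg (by nlinarith [ht.1, ht.2])]
      nlinarith [ht.1, ht.2])).1
    rw [h.ext, Complex.norm_real, Real.norm_eq_abs] at this
    rw [← sq_abs (ψ t)]
    gcongr
  rw [intervalIntegral.integral_const, smul_eq_mul] at b
  have e : ω*(c*(c*(R^2-1))) = 1/2 := by rw [hω]; field_simp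
  have : ω*(ψ 1)^2 ≤ ω*(6*(c*(c*(R^2-1)))) := by
    rw [hn] at a
    have : (1-(1-ω/2))*(0.85*ψ 1)^2 = ω*(ψ 1)^2*0.36125 := by ring
    norm_num at *; linarith
  exact le_of_mul_le_mul_left this hω0

end CExt
end

section
theorem contourA {n : ℕ} {Ψ Φ : ℂ → ℂ} {T : Fin n → ℂ} {ρ : ℝ} (hΨ : Differentiable ℂ Ψ) (hΦ : Differentiable ℂ Φ)
    (hρ : 0 < ρ) (hT : Function.Injective T) (hTρ : ∀ j, ‖T j‖ < ρ) (h0 : ∀ j, Ψ (T j) = 0)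
    (h1 : ∀ j, deriv Ψ (T j) ≠ 0) (hz : ∀ z, ‖z‖ ≤ ρ → Ψ z = 0 → ∃ j, z = T j) {s : ℂ} (hs : ‖s‖ < ρ) (hs0 : Ψ s ≠ 0) :
    Φ s / Ψ s - ∑ j, (Φ (T j) / deriv Ψ (T j)) / (s - T j) =
      (2 * π * Complex.I : ℂ)⁻¹ • ∮ z in C(0, ρ), (z - s)⁻¹ • (Φ z / Ψ z) := by
  set a : Fin n → ℂ := fun j => Φ (T j) / deriv Ψ (T j) with ha
  have hds : ∀ j, Differentiable ℂ (dslope Ψ (T j)) := fun j => by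
    rw [← differentiableOn_univ, Complex.differentiableOn_dslope Filter.univ_mem]
    exact hΨ.differentiableOn
  set N : ℂ → ℂ := fun z => Φ z - ∑ j, a j * dslope Ψ (T j) z with hN
  have hNd : Differentiable ℂ N := by
    apply hΦ.fun_sub
    apply Differentiable.fun_sum
    intro j _
    exact (hds j).const_mul _
  have hN0 : ∀ i, N (T i) = 0 := by
    intro i
    have : ∑ j, a j * dslope Ψ (T j) (T i) = Φ (T i) := by
      rw [Finset.sum_eq_single i]
      · rw [dslope_same]; simp only [ha]; field_simp [h1 i]
      · intro j _ hji
        rw [dslope_of_ne _ (fun h => hji (hT h).symm), slope_def_field, h0, h0]; simp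
      · simp
    simp [hN, this]
  have hNe : ∀ z, Ψ z ≠ 0 → N z / Ψ z = Φ z / Ψ z - ∑ j, a j / (z - T j) := by
    intro z hz0
    have : ∀ j, dslope Ψ (T j) z = Ψ z / (z - T j) := by
      intro j
      have : z ≠ T j := by rintro rfl; exact hz0 (h0 j)
      rw [dslope_of_ne _ this, slope_def_field, h0, sub_zero]
    simp only [hN, this]
    rw [sub_div, Finset.sum_div]
    congr 1
    apply Finset.sum_congr rfl
    intro j _
    field_simp
  set F : ℂ → ℂ := fun z => if Ψ z = 0 then deriv N z / deriv Ψ z else N z / Ψ z with hF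
  have hFd : ∀ z, ‖z‖ ≤ ρ → DifferentiableAt ℂ F z := by
    intro z hzρ
    by_cases hz0 : Ψ z = 0
    · obtain ⟨i, rfl⟩ := hz z hzρ hz0
      have hdN : Differentiable ℂ (dslope N (T i)) := by
        rw [← differentiableOn_univ, Complex.differentiableOn_dslope Filter.univ_mem]
        exact hNd.differentiableOn
      have hne : dslope Ψ (T i) (T i) ≠ 0 := by rw [dslope_same]; exact h1 i
      have hd : DifferentiableAt ℂ (fun w => dslope N (T i) w / dslope Ψ (T i) w) (T i) :=
        (hdN _).fun_div (hds i _) hne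
      apply hd.congr_of_eventuallyEq
      filter_upwards [(hds i).continuous.continuousAt.eventually_ne hne] with w hw
      by_cases hwi : w = T i
      · subst hwi; simp only [hF, h0 i, if_true, dslope_same]
      · have e1 : dslope Ψ (T i) w = Ψ w / (w - T i) := by
          rw [dslope_of_ne _ hwi, slope_def_field, h0, sub_zero]
        have e2 : dslope N (T i) w = N w / (w - T i) := by
          rw [dslope_of_ne _ hwi, slope_def_field, hN0, sub_zero]
        have hΨw : Ψ w ≠ 0 := by intro h; rw [e1, h, zero_div] at hw; exact hw rfl
        have := sub_ne_zero.2 hwi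
        simp only [hF, hΨw, if_false, e1, e2]
        field_simp
    · have hd : DifferentiableAt ℂ (fun w => N w / Ψ w) z := (hNd _).fun_div (hΨ _) hz0
      apply hd.congr_of_eventuallyEq
      filter_upwards [hΨ.continuous.continuousAt.eventually_ne hz0] with w hw
      simp only [hF, hw, if_false]
  have hC := DifferentiableOn.circleIntegral_sub_inv_smul (f := F) (c := 0) (R := ρ) (w := s)
    (fun z hz => (hFd z (by simpa using hz)).differentiableWithinAt) (by simpa using hs)
  have hsph : ∀ z ∈ Metric.sphere (0:ℂ) ρ, Ψ z ≠ 0 := by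
    intro z hzs h
    have hzs' : ‖z‖ = ρ := by simpa using hzs
    obtain ⟨j, rfl⟩ := hz z hzs'.le h
    exact (hTρ j).ne hzs'
  have hsT : ∀ j, s - T j ≠ 0 := by
    intro j h; rw [sub_eq_zero] at h; subst h; exact hs0 (h0 j)
  have hzs : ∀ z ∈ Metric.sphere (0:ℂ) ρ, z - s ≠ 0 := by
    intro z hzs h
    have hzs' : ‖z‖ = ρ := by simpa using hzs
    rw [sub_eq_zero] at h; subst h; exact hs.ne hzs'
  have hzT : ∀ j, ∀ z ∈ Metric.sphere (0:ℂ) ρ, z - T j ≠ 0 := by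
    intro j z hzs h
    have hzs' : ‖z‖ = ρ := by simpa using hzs
    rw [sub_eq_zero] at h; subst h; exact (hTρ j).ne hzs'
  have hint : ∀ w : ℂ, ‖w‖ < ρ → CircleIntegrable (fun z => (z - w)⁻¹) 0 ρ := by
    intro w hw
    apply ContinuousOn.circleIntegrable hρ.le
    apply ContinuousOn.inv₀ (by fun_prop)
    intro z hzs h
    have hzs' : ‖z‖ = ρ := by simpa using hzs
    rw [sub_eq_zero] at h; subst h; exact hw.ne hzs'
  have hzero : ∀ j, (∮ z in C(0, ρ), a j * ((s - T j)⁻¹ * ((z - s)⁻¹ - (z - T j)⁻¹))) = 0 := by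
    intro j
    rw [circleIntegral.integral_const_mul, circleIntegral.integral_const_mul, circleIntegral.integral_sub (hint _ hs) (hint _ (hTρ j)),
      circleIntegral.integral_sub_inv_of_mem_ball (by simpa using hs),
      circleIntegral.integral_sub_inv_of_mem_ball (by simpa using hTρ j)]
    simp
  have hi2 : ∀ j, CircleIntegrable (fun z => a j * ((s - T j)⁻¹ * ((z - s)⁻¹ - (z - T j)⁻¹))) 0 ρ := by
    intro j
    apply ContinuousOn.circleIntegrable hρ.le
    apply ContinuousOn.mul continuousOn_const
    apply ContinuousOn.mul continuousOn_const
    apply ContinuousOn.sub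
    · exact ContinuousOn.inv₀ (by fun_prop) hzs
    · exact ContinuousOn.inv₀ (by fun_prop) (hzT j)
  have hi1 : CircleIntegrable (fun z => (z - s)⁻¹ • (Φ z / Ψ z)) 0 ρ := by
    apply ContinuousOn.circleIntegrable hρ.le
    simp only [smul_eq_mul]
    apply ContinuousOn.mul
    · exact ContinuousOn.inv₀ (by fun_prop) hzs
    · exact hΦ.continuous.continuousOn.div hΨ.continuous.continuousOn hsph
  have hEq : (∮ z in C(0, ρ), (z - s)⁻¹ • F z) = ∮ z in C(0, ρ), ((z - s)⁻¹ • (Φ z / Ψ z) -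
      ∑ j, a j * ((s - T j)⁻¹ * ((z - s)⁻¹ - (z - T j)⁻¹))) := by
    apply circleIntegral.integral_congr hρ.le
    intro z hzm
    have e : F z = Φ z / Ψ z - ∑ j, a j / (z - T j) := by
      rw [← hNe z (hsph z hzm)]; simp only [hF, hsph z hzm, if_false]
    simp only [e, smul_eq_mul]
    rw [mul_sub, Finset.mul_sum]
    congr 1
    apply Finset.sum_congr rfl
    intro j _
    have := hsT j
    have := hzs z hzm
    have := hzT j z hzm
    field_simp
    ring
  have hS : CircleIntegrable (fun z => ∑ j, a j * ((s - T j)⁻¹ * ((z - s)⁻¹ - (z - T j)⁻¹))) 0 ρ :=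
    CircleIntegrable.fun_sum _ (fun j _ => hi2 j)
  rw [hEq, circleIntegral.integral_sub hi1 hS, circleIntegral.integral_fun_sum (fun j _ => hi2 j)] at hC
  simp only [hzero, Finset.sum_const_zero, sub_zero] at hC
  rw [hC, inv_smul_smul₀ (by simp [Real.pi_ne_zero])]
  rw [← hNe s hs0]; simp only [hF, hs0, if_false]
end

section
theorem contourB {r : ℂ → ℂ} {ρ B : ℝ} (hρ : 0 < ρ) (hr : ContinuousOn r (Metric.sphere 0 ρ))
    (hB : ∀ z ∈ Metric.sphere (0:ℂ) ρ, ‖r z‖ ≤ B) : ∃ b : ℕ → ℂ, (∀ k, ‖b k‖ ≤ B * (1/ρ)^k) ∧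
    ∀ s : ℂ, ‖s‖ < ρ → HasSum (fun k => s^k * b k)
      ((2 * π * Complex.I : ℂ)⁻¹ • ∮ z in C(0, ρ), (z - s)⁻¹ • r z) := by
  refine ⟨fun k => (2 * π * Complex.I : ℂ)⁻¹ • ∮ z in C(0, ρ), (1/z)^k * (z⁻¹ * r z), ?_, ?_⟩
  · intro k
    have := circleIntegral.norm_two_pi_i_inv_smul_integral_le_of_norm_le_const (c := 0) (R := ρ)
      (f := fun z => (1/z)^k * (z⁻¹ * r z)) (C := (1/ρ)^k * (1/ρ * B)) hρ.le (by
        intro z hz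
        have hz' : ‖z‖ = ρ := by simpa using hz
        simp only [norm_mul, norm_pow, norm_div, norm_inv, hz', norm_one]
        rw [inv_eq_one_div]
        have := hB z hz
        gcongr)
    refine this.trans (le_of_eq ?_)
    field_simp
  · intro s hs
    have h := (hasSum_two_pi_I_cauchyPowerSeries_integral (f := r) (c := 0) (R := ρ) (w := s)
      (hr.circleIntegrable hρ.le) hs).const_smul ((2 * π * Complex.I : ℂ)⁻¹)
    simp only [sub_zero, zero_add] at h
    refine h.congr_fun ?_
    intro k
    have : (∮ z in C(0, ρ), (s / z)^k • z⁻¹ • r z) = s^k * ∮ z in C(0, ρ), (1/z)^k * (z⁻¹ * r z) := by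
      rw [← circleIntegral.integral_const_mul]
      congr 1; ext z; simp only [smul_eq_mul, div_pow]; ring
    rw [this]; simp only [smul_eq_mul]; ring

theorem div_int {ψ : ℝ → ℝ} (hd : Differentiable ℝ ψ) {x : ℝ} (h0 : ψ x = 0) :
    IntervalIntegrable (fun s => ψ s / (s - x)) volume (-1) 1 := by
  have hc : Continuous (dslope ψ x) := by
    rw [← continuousOn_univ, continuousOn_dslope Filter.univ_mem]
    exact ⟨hd.continuous.continuousOn, hd x⟩
  refine (hc.intervalIntegrable (-1) 1).congr_ae ?_
  have : ∀ᵐ s : ℝ, s ∈ ({x} : Set ℝ)ᶜ := (countable_singleton x).ae_notMem volume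
  refine ae_restrict_of_ae ?_
  filter_upwards [this] with s hs
  rw [dslope_of_ne _ hs, slope_def_field, h0, sub_zero]

set_option maxHeartbeats 1000000 in
theorem contourC {c χ χm ρ B : ℝ} {ψ φ : ℝ → ℝ} {Ψ Φ : ℂ → ℂ} {n : ℕ} {t : Fin n → ℝ}
    (h : CExt c χ ψ Ψ) (k : CExt c χm φ Φ) (hρ : 1 < ρ) (ht : Function.Injective t)
    (htm : ∀ j, t j ∈ Ioo (-1:ℝ) 1) (h0 : ∀ j, ψ (t j) = 0) (h1 : ∀ j, deriv ψ (t j) ≠ 0)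
    (hz : ∀ z, ‖z‖ ≤ ρ → Ψ z = 0 → ∃ j, z = t j) (hB0 : 0 ≤ B)
    (hB : ∀ z, ‖z‖ = ρ → ‖Φ z‖ ≤ B * ‖Ψ z‖) (hM : ∀ j, 0 ≤ mom ψ j) :
    |(∫ s in (-1:ℝ)..1, φ s) - ∑ j, (1 / deriv ψ (t j)) * (∫ s in (-1:ℝ)..1, ψ s / (s - t j)) * φ (t j)|
      ≤ B * (ρ * Qk ψ 1 ρ) := by
  have hρ0 : 0 < ρ := by linarith
  have hinv : 1/ρ < 1 := by rw [div_lt_one hρ0]; exact hρ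
  have htρ : ∀ j, ‖(t j : ℂ)‖ < ρ := by
    intro j
    rw [Complex.norm_real, Real.norm_eq_abs]
    exact (abs_lt.2 ⟨(htm j).1, (htm j).2⟩).trans hρ
  have hsph : ∀ z ∈ Metric.sphere (0:ℂ) ρ, Ψ z ≠ 0 := by
    intro z hzs h'
    have hzs' : ‖z‖ = ρ := by simpa using hzs
    obtain ⟨j, rfl⟩ := hz z hzs'.le h'
    exact (htρ j).ne hzs'
  obtain ⟨b, hb, hbs⟩ := contourB (r := fun z => Φ z / Ψ z) (B := B) hρ0
    (k.diff.continuous.continuousOn.div h.diff.continuous.continuousOn hsph) (by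
      intro z hzs
      have hzs' : ‖z‖ = ρ := by simpa using hzs
      rw [norm_div, div_le_iff₀ (norm_pos_iff.2 (hsph z hzs))]
      exact hB z hzs')
  have hψd : Differentiable ℝ ψ := fun x => (h.sol.an x).differentiableAt
  set f : ℝ → ℝ := fun s => φ s - ∑ j, (φ (t j) / deriv ψ (t j)) * (ψ s / (s - t j)) with hf
  have hpt : ∀ s : ℝ, s ∈ uIoc (-1:ℝ) 1 → s ∉ range t →
      HasSum (fun i => ((ψ s * s^i : ℝ):ℂ) * b i) (f s : ℂ) := by
    intro s hs hst
    rw [uIoc_of_le (by norm_num)] at hs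
    have hsn : ‖(s:ℂ)‖ < ρ := by
      rw [Complex.norm_real, Real.norm_eq_abs]
      exact (abs_le.2 ⟨hs.1.le, hs.2⟩).trans_lt hρ
    have hψs : Ψ s ≠ 0 := by
      intro h'
      obtain ⟨j, hj⟩ := hz s hsn.le h'
      exact hst ⟨j, by exact_mod_cast hj.symm⟩
    have hA := contourA (T := fun j => (t j : ℂ)) h.diff k.diff hρ0
      (fun i j hij => ht (Complex.ofReal_injective hij)) htρ (fun j => by simp [h.ext, h0])
      (fun j => by rw [h.ext']; exact_mod_cast h1 j) hz hsn hψs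
    have hS := (hbs s hsn).mul_left (ψ s : ℂ)
    rw [← hA] at hS
    have hψs' : (ψ s : ℂ) ≠ 0 := by rw [← h.ext]; exact hψs
    have e : (f s : ℂ) = (ψ s : ℂ) * (Φ s / Ψ s - ∑ j, (Φ (t j) / deriv Ψ (t j)) / (s - t j)) := by
      simp only [hf, h.ext, k.ext, h.ext']
      push_cast
      rw [mul_sub, Finset.mul_sum]
      congr 1
      · field_simp
      · apply Finset.sum_congr rfl; intro j _; ring
    rw [e]
    refine hS.congr_fun ?_
    intro i; push_cast; ring
  have hae : ∀ᵐ s : ℝ, s ∉ range t := (countable_range t).ae_notMem volume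
  have hcψ := h.sol.cont
  obtain ⟨M, hMM⟩ := (isCompact_Icc (a := (-1:ℝ)) (b := 1)).exists_bound_of_continuousOn hcψ.continuousOn
  have hM0 : 0 ≤ M := (norm_nonneg _).trans (hMM 0 (by norm_num))
  have hsum := intervalIntegral.hasSum_integral_of_dominated_convergence (μ := volume) (a := -1) (b := 1)
    (F := fun i (s:ℝ) => ((ψ s * s^i : ℝ):ℂ) * b i) (f := fun s => (f s : ℂ))
    (fun i _ => M * (B * (1/ρ)^i))
    (fun i => Continuous.aestronglyMeasurable (by fun_prop))
    (fun i => Filter.Eventually.of_forall (fun s hs => by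
      rw [uIoc_of_le (by norm_num)] at hs
      rw [norm_mul, Complex.norm_real, norm_mul, norm_pow]
      have e1 := hMM s ⟨hs.1.le, hs.2⟩
      have e2 : ‖s‖^i ≤ 1 := pow_le_one₀ (norm_nonneg _) (abs_le.2 ⟨hs.1.le, hs.2⟩)
      have e3 := hb i
      have : ‖ψ s‖ * ‖s‖^i ≤ M := by
        calc _ ≤ M * 1 := mul_le_mul e1 e2 (by positivity) hM0
          _ = M := mul_one _
      exact mul_le_mul this e3 (norm_nonneg _) hM0))
    (Filter.Eventually.of_forall (fun s _ => by
      exact ((summable_geometric_of_lt_one (by positivity) hinv).mul_left B).mul_left M))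
    (by simp)
    (by filter_upwards [hae] with s hs hs'; exact hpt s hs' hs)
  have hint : ∀ i, (∫ s in (-1:ℝ)..1, ((ψ s * s^i : ℝ):ℂ) * b i) = (mom ψ i : ℂ) * b i := by
    intro i
    rw [intervalIntegral.integral_mul_const, intervalIntegral.integral_ofReal]; rfl
  simp only [hint] at hsum
  rw [intervalIntegral.integral_ofReal] at hsum
  have hQ := (ProlSol.Q_hasSum hcψ hρ).mul_left B
  have hle := hsum.norm_le_of_bounded hQ (fun i => by
    rw [norm_mul, Complex.norm_real, Real.norm_of_nonneg (hM i)]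
    calc _ ≤ mom ψ i * (B * (1/ρ)^i) := mul_le_mul_of_nonneg_left (hb i) (hM i)
      _ = _ := by ring)
  rw [Complex.norm_real, Real.norm_eq_abs] at hle
  have hfi : (∫ s in (-1:ℝ)..1, f s) = (∫ s in (-1:ℝ)..1, φ s) -
      ∑ j, (1 / deriv ψ (t j)) * (∫ s in (-1:ℝ)..1, ψ s / (s - t j)) * φ (t j) := by
    have hij : ∀ j, IntervalIntegrable (fun s => (φ (t j) / deriv ψ (t j)) * (ψ s / (s - t j))) volume (-1) 1 :=
      fun j => (div_int hψd (h0 j)).const_mul _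
    simp only [hf]
    have hss : IntervalIntegrable (fun s => ∑ j, (φ (t j) / deriv ψ (t j)) * (ψ s / (s - t j))) volume (-1) 1 := by
      have := IntervalIntegrable.sum Finset.univ (fun j _ => hij j)
      refine this.congr_ae ?_
      filter_upwards with s
      simp
    rw [intervalIntegral.integral_sub (k.sol.cont.intervalIntegrable _ _) hss,
      intervalIntegral.integral_finsetSum (fun j _ => hij j)]
    congr 1
    apply Finset.sum_congr rfl; intro j _
    rw [intervalIntegral.integral_const_mul]; ring
  rw [← hfi]; exact hle
end

section
theorem final_num {c R g ε y p : ℝ} (hc : 60 < c) (hR : 1 < R) (hg : g = c * (R - 1/R)) (hε0 : 0 < ε)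
    (hε1 : ε < 1) (hbig : 3*(10+(3/2)*log c+(1/2)*log (1/ε)) ≤ g) (hp : 0 < p) (hy : 0 < y)
    (hpy : p^2 ≤ 6*(c*y)) :
    (27100*c^2*R^3/√y) * (8*c*R*p*exp (1-π*g/4)) < ε := by
  have hc0 : 0 < c := by linarith
  have hR0 : 0 < R := by linarith
  have hsc : 0 < √c := sqrt_pos.2 hc0
  have hsy : 0 < √y := sqrt_pos.2 hy
  have hp' : p ≤ 2.45 * (√c * √y) := by
    apply abs_le_of_sq_le_sq' _ (by positivity) |>.2
    rw [mul_pow, mul_pow, sq_sqrt hc0.le, sq_sqrt hy.le]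
    have : 0 < c * y := by positivity
    norm_num at *
    nlinarith
  have hL : 0 ≤ log (1/ε) := log_nonneg (by rw [le_div_iff₀ hε0]; linarith)
  have hle : log (1/ε) = - log ε := by rw [one_div, log_inv]
  have hRg : R ≤ 1 + g/60 := by
    have h1 : 1/R < 1 := by rw [div_lt_one hR0]; exact hR
    have h2 : 60*(R-1) ≤ c*(R-1/R) := by
      apply mul_le_mul hc.le _ (by linarith) hc0.le
      linarith
    rw [← hg] at h2; linarith
  have hlogR : log R ≤ log 9 + R/9 - 1 := by
    have h1 := log_le_sub_one_of_pos (show 0 < R/9 by positivity)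
    rw [log_div hR0.ne' (by norm_num)] at h1
    linarith
  have hlog2 := Real.log_two_lt_d9
  have hlog9 : log 9 ≤ 4 * log 2 := by
    rw [← Real.log_rpow (by norm_num)]
    exact log_le_log (by norm_num) (by norm_num)
  have hlogK : log 531160 ≤ 20 * log 2 := by
    rw [← Real.log_rpow (by norm_num)]
    exact log_le_log (by norm_num) (by norm_num)
  have hpi := Real.pi_gt_d4
  have hg0 : 0 < g := by
    have := log60 hc
    linarith
  have key : log 531160 + 3.5 * log c + 4 * log R + (1 - π*g/4) < log ε := by
    have : 3.1415 * g ≤ π * g := by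
      apply mul_le_mul_of_nonneg_right _ hg0.le
      norm_num at *; linarith
    rw [hle] at *
    norm_num at *
    linarith
  have e1 : exp (log 531160 + 3.5 * log c + 4 * log R + (1 - π*g/4)) = 531160 * (c^3 * √c) * R^4 * exp (1 - π*g/4) := by
    rw [exp_add, exp_add, exp_add, exp_log (by norm_num)]
    congr 2
    · congr 1
      have : 3.5 * log c = log (c^3 * √c) := by
        rw [log_mul (by positivity) (by positivity), log_pow, log_sqrt hc0.le]; push_cast; ring
      rw [this, exp_log (by positivity)]
    · have : 4 * log R = log (R^4) := by rw [log_pow]; push_cast; ring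
      rw [this, exp_log (by positivity)]
  have e2 := exp_lt_exp.2 key
  rw [e1, exp_log hε0] at e2
  refine lt_of_le_of_lt ?_ e2
  calc (27100*c^2*R^3/√y) * (8*c*R*p*exp (1-π*g/4))
      = (27100*c^2*R^3/√y) * (8*c*R*exp (1-π*g/4)) * p := by ring
    _ ≤ (27100*c^2*R^3/√y) * (8*c*R*exp (1-π*g/4)) * (2.45 * (√c * √y)) :=
        mul_le_mul_of_nonneg_left hp' (by positivity)
    _ = _ := by field_simp; norm_num

theorem quad_core {c ε χ χm : ℝ} {n m : ℕ} {ψ φ : ℝ → ℝ} {Ψ Φ : ℂ → ℂ} (hc : 60 < c) (hε0 : 0 < ε) (hε1 : ε < 1)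
    (hmn : m < n) (h : CExt c χ ψ Ψ) (k : CExt c χm φ Φ)
    (hn1 : ∫ t in (-1:ℝ)..1, (ψ t)^2 = 1) (hm1 : ∫ t in (-1:ℝ)..1, (φ t)^2 = 1)
    (hnz : {x : ℝ | x ∈ Set.Ioo (-1:ℝ) 1 ∧ ψ x = 0}.encard = n)
    (hmz : {x : ℝ | x ∈ Set.Ioo (-1:ℝ) 1 ∧ φ x = 0}.encard = m) (h1 : 0 < ψ 1)
    {t : Fin n → ℝ} (ht : Function.Injective t) (htm : ∀ j, t j ∈ Ioo (-1:ℝ) 1) (h0 : ∀ j, ψ (t j) = 0)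
    (hbig : (n : ℝ) > 2*c/π + (10 + (3/2) * Real.log c + (1/2) * Real.log (1/ε)) * Real.log (c/2)) :
    |(∫ s in (-1:ℝ)..1, φ s) - ∑ j, (1 / deriv ψ (t j)) * (∫ s in (-1:ℝ)..1, ψ s / (s - t j)) * φ (t j)| < ε := by
  have hc0 : 0 < c := by linarith
  have hall : ∀ x ∈ Ioo (-1:ℝ) 1, ψ x = 0 → ∃ j, x = t j := by
    have hfin : {x : ℝ | x ∈ Set.Ioo (-1:ℝ) 1 ∧ ψ x = 0}.Finite := by
      apply Set.finite_of_encard_eq_coe hnz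
    have hsub : range t ⊆ {x : ℝ | x ∈ Set.Ioo (-1:ℝ) 1 ∧ ψ x = 0} := by
      rintro _ ⟨j, rfl⟩; exact ⟨htm j, h0 j⟩
    have hcard : (range t).encard = n := by
      rw [← image_univ, ht.encard_image, encard_univ]; simp
    have heq := (hfin.subset hsub).eq_of_subset_of_encard_le hsub (by rw [hnz, hcard])
    intro x hx hx0
    have : x ∈ range t := by rw [heq]; exact ⟨hx, hx0⟩
    obtain ⟨j, hj⟩ := this
    exact ⟨j, hj.symm⟩
  obtain ⟨R, hR, hχ, hgb⟩ := h.sol.chi_lower hc hε0 hε1 hnz hbig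
  have hR0 : 0 < R := by linarith
  obtain ⟨g, hg⟩ : ∃ g, g = c*(R-1/R) := ⟨_, rfl⟩
  rw [← hg] at hgb
  have hL : 0 ≤ log (1/ε) := log_nonneg (by rw [le_div_iff₀ hε0]; linarith)
  have hg48 : 48 ≤ g := by
    have := log60 hc
    linarith
  have hy : c*(R^2-1) = g*R := by rw [hg]; field_simp
  have hcd : 48 ≤ c*(R^2-1) := by rw [hy]; nlinarith
  have hR2 : 0 < R^2-1 := by nlinarith
  have hω : 1/(2*(c^2*(R^2-1))) < R^2-1 := by
    rw [div_lt_iff₀ (by positivity)]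
    nlinarith
  have hω0 : 0 < 1/(2*(c^2*(R^2-1))) := by positivity
  obtain ⟨ρ, hρ⟩ : ∃ ρ, ρ = √(R^2 - 1/(2*(c^2*(R^2-1)))) := ⟨_, rfl⟩
  have hρ2 : ρ^2 = R^2 - 1/(2*(c^2*(R^2-1))) := by rw [hρ, sq_sqrt (by linarith)]
  have hρ0 : 0 ≤ ρ := by rw [hρ]; exact sqrt_nonneg _
  have hρ1 : 1 < ρ := by nlinarith
  have hρR : ρ ≤ R := by nlinarith
  have hχ2 : 2 < χ := by
    rw [hχ]; nlinarith [mul_pos hc0 hc0]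
  have hlt := h.sol.chi_lt k.sol hnz hmz hmn
  have hB : (0:ℝ) ≤ 27100*c^2*R^3/√(c*(R^2-1)) := by positivity
  have hE := contourC h k hρ1 ht htm h0 (fun j => h.sol.deriv_ne h1.ne' (h0 j)) (B := 27100*c^2*R^3/√(c*(R^2-1)))
    (by
      intro z hz hz0
      obtain ⟨x, hx, rfl, hx0⟩ := h.zero_free hc hR hχ hcd h1 (z := z) (by
        rw [← hρ2]; exact pow_le_pow_left₀ (norm_nonneg _) hz 2) hz0
      obtain ⟨j, hj⟩ := hall x hx hx0
      exact ⟨j, by rw [hj]⟩) hB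
    (by
      intro z hz
      exact h.ratio_bound k hc hR hχ hcd h1 hn1 hm1 (by linarith) (by rw [hz, hρ2]))
    (h.sol.mom_nonneg hc0 hχ2 h1)
  have hQ := h.sol.Q_rho_small hc hR hχ h1 hg hg48 hρ1 hρR (by rw [hρ2]; ring_nf)
  have hN := final_num hc hR hg hε0 hε1 hgb h1 (y := c*(R^2-1)) (by linarith)
    (h.one_le_bound hc hR hχ hcd h1 hn1)
  exact lt_of_le_of_lt (hE.trans (mul_le_mul_of_nonneg_left hQ hB)) hN
end

theorem ProlateDatum.psol {c : ℝ} {k : ℕ} {ψ : ℝ → ℝ} {lam : ℂ} {χ : ℝ} (h : ProlateDatum c k ψ lam χ) :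
    ProlSol c χ ψ := ⟨h.analytic, h.diff_eq⟩

theorem quad_error_lt_eps
    (c : ℝ) (hc : c > 60)
    (ε : ℝ) (hε0 : 0 < ε) (hε1 : ε < 1)
    (n m : ℕ) (hn : 0 < n) (hmn : m < n)
    (ψm : ℝ → ℝ) (lamm : ℂ) (χm : ℝ)
    (hm : ProlateDatum c m ψm lamm χm)
    (ψn : ℝ → ℝ) (lamn : ℂ) (χn : ℝ)
    (hnd : ProlateDatum c n ψn lamn χn)
    (t : Fin n → ℝ) (ht_mono : StrictMono t)
    (ht_mem : ∀ j, t j ∈ Set.Ioo (-1:ℝ) 1)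
    (ht_zero : ∀ j, ψn (t j) = 0)
    (hbig : (n : ℝ) >
      2*c/π + (10 + (3/2) * Real.log c + (1/2) * Real.log (1/ε)) * Real.log (c/2)) :
    |(∫ s in (-1:ℝ)..1, ψm s) - ∑ j : Fin n, quadWeight ψn (t j) * ψm (t j)| < ε := by
  obtain ⟨Φ, hΦ⟩ := exists_ext hm.psol hm.lam_ne_zero hm.integral_eig
  obtain ⟨Ψ, hΨ⟩ := exists_ext hnd.psol hnd.lam_ne_zero hnd.integral_eig
  have hne : ∃ z, ψn z ≠ 0 := by
    by_contra hcon
    push Not at hcon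
    have := hnd.normalized
    simp [hcon] at this
  obtain ⟨z, hz⟩ := hne
  have h1 := hnd.psol.ne_one hz
  rcases lt_or_gt_of_ne h1 with h1 | h1
  · have hΨ' : CExt c χn (fun x => - ψn x) (fun z => - Ψ z) :=
      ⟨hnd.psol.neg, hΨ.diff.fun_neg, fun x => by simp [hΨ.ext]⟩
    have := quad_core hc hε0 hε1 hmn hΨ' hΦ (by simpa using hnd.normalized) hm.normalized
      (by simpa using hnd.zeros_card) hm.zeros_card (by simpa using h1) ht_mono.injective ht_mem
      (fun j => by simp [ht_zero]) hbig
    have e : ∀ j, quadWeight ψn (t j) = (1 / deriv (fun x => - ψn x) (t j)) *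
        (∫ s in (-1:ℝ)..1, (- ψn s) / (s - t j)) := by
      intro j
      simp only [quadWeight, deriv.fun_neg, neg_div, intervalIntegral.integral_neg]
      rw [div_neg]; ring
    simp only [e]
    exact this
  · exact quad_core hc hε0 hε1 hmn hΨ hΦ hnd.normalized hm.normalized
      hnd.zeros_card hm.zeros_card h1 ht_mono.injective ht_mem ht_zero hbig
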